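/- For φ, ψ ∈ Diff₀(V) the following are equivalent: (i) φ and ψ are S-equivalent; (ii) for every nonseparating smoothly embedded 3-sphere P ⊆ V, there exist an integer n ≥ 1, lifts φ̂, ψ̂ of φ and ψ to the n-fold cover pₙ, and a connected component P̂ of pₙ⁻¹(P), such that φ̂ '' P̂ and ψ̂ '' P̂ are smoothly ambiently isotopic in V. (Equivalence i) ↔ iii) of Proposition 1.9 of the paper.) -/

import Mathlib

open scoped Manifold
open Metric Set Module

noncomputable section

/-- The 3-sphere: unit sphere in `EuclideanSpace ℝ (Fin 4)`. -/
abbrev S3 : Type := Metric.sphere (0 : EuclideanSpace ℝ (Fin 4)) 1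

/-- The 4-sphere: unit sphere in `EuclideanSpace ℝ (Fin 5)`. -/
abbrev S4 : Type := Metric.sphere (0 : EuclideanSpace ℝ (Fin 5)) 1

instance : Fact (Module.finrank ℝ (EuclideanSpace ℝ (Fin 4)) = 3 + 1) :=
  ⟨finrank_euclideanSpace_fin⟩
instance : Fact (Module.finrank ℝ (EuclideanSpace ℝ (Fin 5)) = 4 + 1) :=
  ⟨finrank_euclideanSpace_fin⟩

/-- A `C^∞` diffeomorphism between two smooth manifolds, as a predicate on maps. -/
def IsDiffeoB {E H M E' H' M' : Type*} [NormedAddCommGroup E] [NormedSpace ℝ E]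
    [TopologicalSpace H] [NormedAddCommGroup E'] [NormedSpace ℝ E'] [TopologicalSpace H']
    (I : ModelWithCorners ℝ E H) (I' : ModelWithCorners ℝ E' H')
    [TopologicalSpace M] [ChartedSpace H M] [TopologicalSpace M'] [ChartedSpace H' M']
    (f : M → M') : Prop :=
  ContMDiff I I' (⊤ : ℕ∞) f ∧ ∃ g : M' → M, ContMDiff I' I (⊤ : ℕ∞) g ∧
    Function.LeftInverse g f ∧ Function.RightInverse g f

/-- A smooth ambient isotopy of a manifold `M`: a family `F : ℝ → M → M` with `F 0 = id`,
each `F t` a bijection, and both `(t, x) ↦ F t x` and the family of inverses jointly `C^∞`. -/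
def IsAmbientIsotopy {E H M : Type*} [NormedAddCommGroup E] [NormedSpace ℝ E]
    [TopologicalSpace H] (I : ModelWithCorners ℝ E H)
    [TopologicalSpace M] [ChartedSpace H M]
    (F : ℝ → M → M) : Prop :=
  F 0 = id ∧ (∀ t, Function.Bijective (F t)) ∧
  ContMDiff (𝓘(ℝ, ℝ).prod I) I (⊤ : ℕ∞) (fun q : ℝ × M => F q.1 q.2) ∧
  ∃ G : ℝ → M → M, (∀ t, Function.LeftInverse (G t) (F t) ∧ Function.RightInverse (G t) (F t)) ∧
    ContMDiff (𝓘(ℝ, ℝ).prod I) I (⊤ : ℕ∞) (fun q : ℝ × M => G q.1 q.2)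

/-- Two subsets of a smooth manifold are smoothly ambiently isotopic. -/
def AmbIsotopic {E H M : Type*} [NormedAddCommGroup E] [NormedSpace ℝ E]
    [TopologicalSpace H] (I : ModelWithCorners ℝ E H)
    [TopologicalSpace M] [ChartedSpace H M]
    (A B : Set M) : Prop :=
  ∃ F : ℝ → M → M, IsAmbientIsotopy I F ∧ (F 1) '' A = B

/-- A smooth embedding of the 3-sphere into a smooth manifold: `C^∞`, injective, a topological
embedding, and an immersion. -/
def IsS3Embedding {E H M : Type*} [NormedAddCommGroup E] [NormedSpace ℝ E]
    [TopologicalSpace H] (I : ModelWithCorners ℝ E H)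
    [TopologicalSpace M] [ChartedSpace H M]
    (f : S3 → M) : Prop :=
  ContMDiff (𝓡 3) I (⊤ : ℕ∞) f ∧ Function.Injective f ∧ Topology.IsEmbedding f ∧
    ∀ x : S3, Function.Injective (mfderiv (𝓡 3) I f x)

/-- The 4-manifold `V = S¹ × S³`. -/
abbrev V : Type := Circle × S3

/-- The model for `V`. -/
abbrev IV := (𝓡 1).prod (𝓡 3)

/-- The model for `ℝ × S³`. -/
abbrev IRS := 𝓘(ℝ, ℝ).prod (𝓡 3)

/-- The universal covering `ℝ × S³ → V`, `(t, w) ↦ (exp t, w)`. -/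
def pcov : ℝ × S3 → V := fun q => (Circle.exp q.1, q.2)

/-- The `n`-fold covering `V → V`, `(z, w) ↦ (zⁿ, w)`. -/
def pcovN (n : ℕ) : V → V := fun q => (q.1 ^ n, q.2)

/-- Membership in `Diff₀(V)`: a diffeomorphism of `V` homotopic to the identity. -/
def InDiff0 (φ : V → V) : Prop :=
  IsDiffeoB IV IV φ ∧ ∃ hc : Continuous φ,
    ContinuousMap.Homotopic ⟨φ, hc⟩ (ContinuousMap.id V)

/-- A lift of `φ : V → V` to the `n`-fold cover. -/
def IsLiftN (n : ℕ) (φ φh : V → V) : Prop :=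
  IsDiffeoB IV IV φh ∧ ∀ q : V, pcovN n (φh q) = φ (pcovN n q)

/-- A lift of `φ : V → V` to the universal cover `ℝ × S³`. -/
def IsLiftU (φ : V → V) (φt : ℝ × S3 → ℝ × S3) : Prop :=
  IsDiffeoB IRS IRS φt ∧ ∀ q : ℝ × S3, pcov (φt q) = φ (pcov q)

/-- S-equivalence of elements of `Diff₀(V)`. -/
def SEquiv (φ ψ : V → V) : Prop :=
  ∃ n : ℕ, 1 ≤ n ∧ ∃ φh ψh : V → V, IsLiftN n φ φh ∧ IsLiftN n ψ ψh ∧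
    ∃ z₀ : Circle,
      AmbIsotopic IV (φh '' (({z₀} : Set Circle) ×ˢ (Set.univ : Set S3)))
        (ψh '' (({z₀} : Set Circle) ×ˢ (Set.univ : Set S3)))

/-- `φ` interpolates to `ψ`: some lift of `φ` can be glued to some lift of `ψ` by a
diffeomorphism of `ℝ × S³` agreeing with the first near `-∞` and the second near `+∞`. -/
def Interpolates (φ ψ : V → V) : Prop :=
  ∃ φt ψt h : ℝ × S3 → ℝ × S3, IsLiftU φ φt ∧ IsLiftU ψ ψt ∧
    IsDiffeoB IRS IRS h ∧ ∃ a b : ℝ, a ≤ b ∧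
      (∀ q : ℝ × S3, q.1 ≤ a → h q = φt q) ∧
      (∀ q : ℝ × S3, b ≤ q.1 → h q = ψt q)

/-- A smoothly embedded 3-sphere in `V`. -/
def IsEmbeddedS3inV (P : Set V) : Prop :=
  ∃ f : S3 → V, IsS3Embedding IV f ∧ Set.range f = P

namespace SphereIso
open scoped ContDiff Topology

abbrev E4 : Type := EuclideanSpace ℝ (Fin 4)

/-- The inverse of a bijection is smooth at the image of a smooth immersive point. -/
theorem contDiffAt_symm_of_injective_fderiv {W : Type*} [NormedAddCommGroup W] [NormedSpace ℝ W]
    [FiniteDimensional ℝ W] (f : Equiv.Perm W) {a : W} (hf : ContDiffAt ℝ ∞ f a)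
    (hinj : ∀ v, fderiv ℝ f a v = 0 → v = 0) : ContDiffAt ℝ ∞ f.symm (f a) := by
  have : CompleteSpace W := FiniteDimensional.complete ℝ W
  have hi : Function.Injective (fderiv ℝ f a) :=
    (injective_iff_map_eq_zero _).2 hinj
  have hs : Function.Surjective (fderiv ℝ f a) :=
    LinearMap.injective_iff_surjective.1 hi
  let f' : W ≃L[ℝ] W := ContinuousLinearEquiv.ofBijective (fderiv ℝ f a)
    (LinearMap.ker_eq_bot.2 hi) (LinearMap.range_eq_top.2 hs)
  have hff' : (f' : W →L[ℝ] W) = fderiv ℝ f a := by ext; rfl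
  have hne : (∞ : WithTop ℕ∞) ≠ 0 := by simp
  have hd : HasFDerivAt f (f' : W →L[ℝ] W) a := by
    rw [hff']; exact (hf.differentiableAt hne).hasFDerivAt
  have h1 := hf.to_localInverse hd hne
  have h2 := (hf.hasStrictFDerivAt' hd hne).eventually_right_inverse
  refine h1.congr_of_eventuallyEq ?_
  filter_upwards [h2] with y hy
  rw [Equiv.symm_apply_eq]
  exact hy.symm

/-- Smoothness away from the origin. -/
def PSmooth (f : E4 → E4) : Prop := ∀ y : E4, y ≠ 0 → ContDiffAt ℝ ∞ f y

theorem perm_ne_zero {f : Equiv.Perm E4} (h : f 0 = 0) {y : E4} (hy : y ≠ 0) : f y ≠ 0 :=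
  fun h' => hy (f.injective (h'.trans h.symm))

theorem symm_zero {f : Equiv.Perm E4} (h : f 0 = 0) : f.symm 0 = 0 := by
  rw [Equiv.symm_apply_eq, h]

/-- Bijections of `ℝ⁴` fixing the origin that are diffeomorphisms of the punctured space. -/
def puncturedDiffeo : Subgroup (Equiv.Perm E4) where
  carrier := {f | f 0 = 0 ∧ PSmooth f ∧ PSmooth f.symm}
  one_mem' := ⟨rfl, fun _ _ => contDiffAt_id, fun _ _ => contDiffAt_id⟩
  mul_mem' := by
    rintro f g ⟨hf, hf1, hf2⟩ ⟨hg, hg1, hg2⟩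
    refine ⟨by simp [hf, hg], fun y hy => ?_, fun y hy => ?_⟩
    · exact (hf1 _ (perm_ne_zero hg hy)).comp y (hg1 y hy)
    · exact (hg2 _ (perm_ne_zero (symm_zero hf) hy)).comp y (hf2 y hy)
  inv_mem' := by
    rintro f ⟨hf, hf1, hf2⟩
    exact ⟨symm_zero hf, hf2, hf1⟩

theorem mem_puncturedDiffeo_of_injective_fderiv {f : Equiv.Perm E4} (h0 : f 0 = 0)
    (hf : PSmooth f) (hinj : ∀ y ≠ 0, ∀ v, fderiv ℝ f y v = 0 → v = 0) :
    f ∈ puncturedDiffeo := by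
  refine ⟨h0, hf, fun y hy => ?_⟩
  have hy' := perm_ne_zero (symm_zero h0) hy
  have := contDiffAt_symm_of_injective_fderiv f (hf _ hy') (hinj _ hy')
  simpa using this

theorem fderiv_injective_of_mem {f : Equiv.Perm E4} (hf : f ∈ puncturedDiffeo) {y : E4}
    (hy : y ≠ 0) (v : E4) (hv : fderiv ℝ f y v = 0) : v = 0 := by
  have hne : (∞ : WithTop ℕ∞) ≠ 0 := by simp
  have h1 := ((hf.2.1 y hy).differentiableAt hne).hasFDerivAt
  have h2 := ((hf.2.2 _ (perm_ne_zero hf.1 hy)).differentiableAt hne).hasFDerivAt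
  have h3 := h2.comp y h1
  have h4 : (f.symm ∘ f : E4 → E4) = id := by ext1 x; simp
  rw [h4] at h3
  have h5 := h3.unique (hasFDerivAt_id y)
  have h6 := congrArg (fun L => L v) h5
  simpa [hv] using h6.symm

theorem isCompact_image_of_psmooth {f : E4 → E4} (hf : PSmooth f) {A : Set E4}
    (hA : IsCompact A) (h0 : (0 : E4) ∉ A) : IsCompact (f '' A) :=
  hA.image_of_continuousOn fun y hy =>
    (hf y (fun h => h0 (h ▸ hy))).continuousAt.continuousWithinAt

/-- A smooth isotopy of bijections of `ℝ⁴` supported in a compact subset of the punctured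
space. -/
structure IsCompactIsotopy (F : ℝ → Equiv.Perm E4) : Prop where
  zero : F 0 = 1
  smooth : ContDiff ℝ ∞ fun p : ℝ × E4 => F p.1 p.2
  smooth_symm : ContDiff ℝ ∞ fun p : ℝ × E4 => (F p.1).symm p.2
  supp : ∃ C : Set E4, IsCompact C ∧ (0 : E4) ∉ C ∧ ∀ t, ∀ y ∉ C, F t y = y

/-- Isotopy of subsets through compactly supported isotopies of the punctured space. -/
def Isot (A B : Set E4) : Prop := ∃ F, IsCompactIsotopy F ∧ F 1 '' A = B

theorem Isot.refl (A : Set E4) : Isot A A :=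
  ⟨fun _ => 1, ⟨rfl, contDiff_snd, contDiff_snd, ∅, isCompact_empty, by simp, fun _ _ _ => rfl⟩,
    by simp⟩

theorem Isot.symm {A B : Set E4} : Isot A B → Isot B A := by
  rintro ⟨F, hF, rfl⟩
  obtain ⟨C, hC, h0, hs⟩ := hF.supp
  refine ⟨fun t => (F t).symm, ⟨by simp [hF.zero]; rfl, hF.smooth_symm, hF.smooth,
    C, hC, h0, fun t y hy => ?_⟩, ?_⟩
  · rw [Equiv.symm_apply_eq, hs t y hy]
  · simp [Set.image_image]

theorem Isot.trans {A B D : Set E4} : Isot A B → Isot B D → Isot A D := by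
  rintro ⟨F, hF, rfl⟩ ⟨G, hG, rfl⟩
  obtain ⟨C, hC, h0, hs⟩ := hF.supp
  obtain ⟨C', hC', h0', hs'⟩ := hG.supp
  refine ⟨fun t => G t * F t, ⟨by simp [hF.zero, hG.zero], ?_, ?_, C ∪ C', hC.union hC',
    by simp [h0, h0'], fun t y hy => ?_⟩, ?_⟩
  · exact hG.smooth.comp (contDiff_fst.prodMk hF.smooth)
  · exact hF.smooth_symm.comp (contDiff_fst.prodMk hG.smooth_symm)
  · simp only [mem_union, not_or] at hy
    simp [hs t y hy.1, hs' t y hy.2]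
  · simp [Set.image_image]

theorem Isot.image {A B : Set E4} {g : Equiv.Perm E4} (hg : g ∈ puncturedDiffeo) :
    Isot A B → Isot (g '' A) (g '' B) := by
  rintro ⟨F, hF, rfl⟩
  obtain ⟨C, hC, h0, hs⟩ := hF.supp
  obtain ⟨g0, g1, g2⟩ := hg
  have key : ∀ G : ℝ → Equiv.Perm E4, (ContDiff ℝ ∞ fun p : ℝ × E4 => G p.1 p.2) →
      (∀ t, ∀ y ∉ C, G t y = y) → ContDiff ℝ ∞ fun p : ℝ × E4 => g (G p.1 (g.symm p.2)) := by
    intro G hG hGs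
    rw [contDiff_iff_contDiffAt]
    rintro ⟨t, y⟩
    by_cases hy : y = 0
    · have hopen : IsOpen (g '' C)ᶜ :=
        (isCompact_image_of_psmooth g1 hC h0).isClosed.isOpen_compl
      have hmem : (0 : E4) ∈ (g '' C)ᶜ := by
        rintro ⟨x, hx, hx0⟩
        exact perm_ne_zero g0 (fun h => h0 (h ▸ hx)) hx0
      refine contDiffAt_snd.congr_of_eventuallyEq ?_
      subst hy
      have : ∀ᶠ p : ℝ × E4 in 𝓝 (t, 0), p.2 ∈ (g '' C)ᶜ :=
        continuous_snd.continuousAt.eventually (hopen.mem_nhds hmem)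
      filter_upwards [this] with p hp
      rw [hGs _ _ (fun h => hp ⟨_, h, by simp⟩)]
      simp
    · have hy1 := perm_ne_zero (symm_zero g0) hy
      have hG0 : ∀ t, G t 0 = 0 := fun t => hGs t 0 h0
      have hy2 := perm_ne_zero (hG0 t) hy1
      have hc : ContDiffAt ℝ ∞ (fun p : ℝ × E4 => g.symm p.2) (t, y) :=
        (g2 y hy).comp (t, y) contDiffAt_snd
      have hc2 : ContDiffAt ℝ ∞ (fun p : ℝ × E4 => G p.1 (g.symm p.2)) (t, y) :=
        hG.contDiffAt.comp (t, y) (contDiffAt_fst.prodMk hc)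
      exact ContDiffAt.comp (t, y) (f := fun p : ℝ × E4 => G p.1 (g.symm p.2)) (g := g)
        (g1 _ hy2) hc2
  refine ⟨fun t => g * F t * g⁻¹, ⟨by simp [hF.zero], key F hF.smooth hs,
    key (fun t => (F t).symm) hF.smooth_symm
      (fun t y hy => by rw [Equiv.symm_apply_eq, hs t y hy]),
    g '' C, isCompact_image_of_psmooth g1 hC h0, ?_, fun t y hy => ?_⟩, ?_⟩
  · rintro ⟨x, hx, hx0⟩
    exact perm_ne_zero g0 (fun h => h0 (h ▸ hx)) hx0
  · have : g.symm y ∉ C := fun h => hy ⟨_, h, by simp⟩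
    change g (F t (g.symm y)) = y
    rw [hs t _ this]; simp
  · simp [Set.image_image]

theorem exists_compactIsotopy_of_small {u : E4 → E4} (hu : ContDiff ℝ ∞ u) {C : Set E4}
    (hC : IsCompact C) (h0 : (0 : E4) ∉ C) (huC : ∀ y ∉ C, u y = 0)
    (hsmall : ∀ y, ‖fderiv ℝ u y‖ ≤ 1 / 2) :
    ∃ F, IsCompactIsotopy F ∧ ∀ y, F 1 y = y + u y := by
  have hne : (∞ : WithTop ℕ∞) ≠ 0 := by simp
  have hσ : ContDiff ℝ ∞ Real.smoothTransition := Real.smoothTransition.contDiff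
  have hσ0 := Real.smoothTransition.nonneg
  have hσ1 := Real.smoothTransition.le_one
  set σ := Real.smoothTransition
  have hlip : LipschitzWith (1 / 2 : NNReal) u :=
    lipschitzWith_of_nnnorm_fderiv_le (𝕜 := ℝ) (hu.differentiable hne) fun y => by
      rw [← NNReal.coe_le_coe]; simpa using hsmall y
  have happ : ∀ r : ℝ, ApproximatesLinearOn (fun y => y + σ r • u y)
      ((ContinuousLinearEquiv.refl ℝ E4 : E4 ≃L[ℝ] E4) : E4 →L[ℝ] E4) univ (1 / 2 : NNReal) := by
    intro r x _ y _
    have h1 := hlip.dist_le_mul x y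
    rw [dist_eq_norm, dist_eq_norm] at h1
    have h2 : x + σ r • u x - (y + σ r • u y) -
        ((ContinuousLinearEquiv.refl ℝ E4 : E4 ≃L[ℝ] E4) : E4 →L[ℝ] E4) (x - y)
        = σ r • (u x - u y) := by
      simp [smul_sub]; abel
    rw [h2, norm_smul, Real.norm_of_nonneg (hσ0 r)]
    exact (mul_le_of_le_one_left (norm_nonneg _) (hσ1 r)).trans h1
  have hc : Subsingleton E4 ∨ (1 / 2 : NNReal) <
      ‖((ContinuousLinearEquiv.refl ℝ E4).symm : E4 →L[ℝ] E4)‖₊⁻¹ := by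
    right
    have : ‖((ContinuousLinearEquiv.refl ℝ E4).symm : E4 →L[ℝ] E4)‖₊ = 1 := by
      have h : ‖ContinuousLinearMap.id ℝ E4‖ = 1 := ContinuousLinearMap.norm_id
      exact NNReal.eq h
    rw [this]
    norm_num
  let F : ℝ → Equiv.Perm E4 := fun r => ((happ r).toHomeomorph _ hc).toEquiv
  have hF : ∀ r y, F r y = y + σ r • u y := fun r y => rfl
  have hsm : ContDiff ℝ ∞ fun p : ℝ × E4 => F p.1 p.2 :=
    contDiff_snd.add ((hσ.comp contDiff_fst).smul (hu.comp contDiff_snd))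
  let Ψ : Equiv.Perm (ℝ × E4) :=
    { toFun := fun p => (p.1, F p.1 p.2)
      invFun := fun p => (p.1, (F p.1).symm p.2)
      left_inv := fun p => by simp
      right_inv := fun p => by simp }
  have hΨ : ContDiff ℝ ∞ Ψ := contDiff_fst.prodMk hsm
  have hΨi : ∀ p : ℝ × E4, ∀ v, fderiv ℝ Ψ p v = 0 → v = 0 := by
    rintro ⟨r, y⟩ ⟨a, v⟩ hv
    have hd1 : HasFDerivAt (fun p : ℝ × E4 => F p.1 p.2)
        (fderiv ℝ (fun p : ℝ × E4 => F p.1 p.2) (r, y)) (r, y) :=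
      (hsm.differentiable hne _).hasFDerivAt
    have hd : HasFDerivAt Ψ _ (r, y) := HasFDerivAt.prodMk (hasFDerivAt_fst (p := (r, y))) hd1
    rw [hd.fderiv] at hv
    have ha : a = 0 := congrArg Prod.fst hv
    have hv2 : fderiv ℝ (fun p : ℝ × E4 => F p.1 p.2) (r, y) (a, v) = 0 := congrArg Prod.snd hv
    subst ha
    have hd2 : HasFDerivAt (fun y => F r y) (ContinuousLinearMap.id ℝ E4 + σ r • fderiv ℝ u y) y :=
      (hasFDerivAt_id y).add ((hu.differentiable hne y).hasFDerivAt.const_smul (σ r))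
    have hd3 : HasFDerivAt (fun y => F r y) _ y :=
      HasFDerivAt.comp (g := fun p : ℝ × E4 => F p.1 p.2) (f := fun y : E4 => (r, y)) y hd1
        ((hasFDerivAt_const r y).prodMk (hasFDerivAt_id y))
    have h4 := congrArg (fun L => L v) (hd3.unique hd2)
    simp at h4
    rw [hv2] at h4
    have h5 : ‖σ r • fderiv ℝ u y v‖ ≤ 1 / 2 * ‖v‖ := by
      rw [norm_smul, Real.norm_of_nonneg (hσ0 r)]
      refine (mul_le_of_le_one_left (norm_nonneg _) (hσ1 r)).trans ?_
      exact ((fderiv ℝ u y).le_opNorm v).trans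
        (mul_le_mul_of_nonneg_right (hsmall y) (norm_nonneg v))
    have h6 : v = -(σ r • fderiv ℝ u y v) := by
      rw [eq_neg_iff_add_eq_zero]; exact h4.symm
    have h7 : ‖v‖ ≤ 1 / 2 * ‖v‖ := by
      conv_lhs => rw [h6, norm_neg]
      exact h5
    have h8 : ‖v‖ = 0 := by linarith [norm_nonneg v]
    simp [norm_eq_zero.1 h8]
  have hΨs : ContDiff ℝ ∞ Ψ.symm := by
    rw [contDiff_iff_contDiffAt]
    intro p
    have := contDiffAt_symm_of_injective_fderiv Ψ (a := Ψ.symm p) hΨ.contDiffAt (hΨi _)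
    simpa using this
  refine ⟨F, ⟨?_, hsm, contDiff_snd.comp hΨs, C, hC, h0, fun t y hy => ?_⟩, fun y => ?_⟩
  · ext1 y
    rw [hF]; simp [σ, Real.smoothTransition.zero]
  · rw [hF, huC y hy]; simp
  · rw [hF]; simp [σ, Real.smoothTransition.one]

/-- A smooth cutoff function around a compact subset of the punctured space. -/
theorem exists_cutoff {A : Set E4} (hA : IsCompact A) {U : Set E4} (hU : IsOpen U)
    (hAU : A ⊆ U) : ∃ (χ : E4 → ℝ) (C : Set E4), ContDiff ℝ ∞ χ ∧ IsCompact C ∧ C ⊆ U ∧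
      (∀ y ∉ C, χ y = 0) ∧ (∀ y ∈ A, χ y = 1) ∧ ∀ y, χ y ∈ Icc (0 : ℝ) 1 := by
  obtain ⟨C, hC, h1, h2⟩ := exists_compact_between hA hU hAU
  obtain ⟨f, hf1, hf2, hf3⟩ :=
    exists_contMDiffMap_one_nhds_of_subset_interior (n := (⊤ : ℕ∞)) 𝓘(ℝ, E4) hA.isClosed h1
  exact ⟨f, C, f.contMDiff.contDiff, hC, h2, hf2,
    fun y hy => (hf1.self_of_nhdsSet) y hy, hf3⟩

theorem isot_of_local_close {f : ℝ → E4 → E4} {s₀ : ℝ} {A : Set E4} (hA : IsCompact A)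
    {U : Set E4} (hU : IsOpen U) (h0U : (0 : E4) ∉ U) (hAU : A ⊆ U)
    (hid : ∀ y ∈ U, f s₀ y = y)
    (hsm : ∀ s, ∀ y ∈ U, ContDiffAt ℝ ∞ (f s) y)
    (hc : ∀ y ∈ U, ContinuousAt (fun p : ℝ × E4 => f p.1 p.2) (s₀, y))
    (hc' : ∀ y ∈ U, ContinuousAt (fun p : ℝ × E4 => fderiv ℝ (f p.1) p.2) (s₀, y)) :
    ∀ᶠ s in 𝓝 s₀, Isot A (f s '' A) := by
  have hne : (∞ : WithTop ℕ∞) ≠ 0 := by simp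
  obtain ⟨χ, C, hχ, hC, hCU, hχC, hχA, -⟩ := exists_cutoff hA hU hAU
  have hC0 : (0 : E4) ∉ C := fun h => h0U (hCU h)
  let u : ℝ → E4 → E4 := fun s y => χ y • (f s y - y)
  have hu : ∀ s, ContDiff ℝ ∞ (u s) := by
    intro s
    rw [contDiff_iff_contDiffAt]
    intro y
    by_cases hy : y ∈ C
    · exact hχ.contDiffAt.smul ((hsm s y (hCU hy)).sub contDiffAt_id)
    · refine (contDiffAt_const (c := (0 : E4))).congr_of_eventuallyEq ?_
      filter_upwards [hC.isClosed.isOpen_compl.mem_nhds hy] with z hz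
      simp [u, hχC z hz]
  have hfd : ∀ s, ∀ y ∈ U, fderiv ℝ (u s) y = χ y • (fderiv ℝ (f s) y - ContinuousLinearMap.id ℝ E4)
      + (fderiv ℝ χ y).smulRight (f s y - y) := by
    intro s y hy
    have h1 : HasFDerivAt (fun y => f s y - y) _ y :=
      ((hsm s y hy).differentiableAt hne).hasFDerivAt.sub (hasFDerivAt_id y)
    exact ((hχ.differentiable hne y).hasFDerivAt.smul h1).fderiv
  have hev : ∀ᶠ s in 𝓝 s₀, ∀ y ∈ C, ‖fderiv ℝ (u s) y‖ ≤ 1 / 2 := by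
    apply hC.eventually_forall_of_forall_eventually
    intro y hy
    have hyU := hCU hy
    have hUn : ∀ᶠ p : ℝ × E4 in 𝓝 (s₀, y), p.2 ∈ U :=
      continuous_snd.continuousAt.eventually (hU.mem_nhds hyU)
    have hcont : ContinuousAt (fun p : ℝ × E4 =>
        χ p.2 • (fderiv ℝ (f p.1) p.2 - ContinuousLinearMap.id ℝ E4)
      + (fderiv ℝ χ p.2).smulRight (f p.1 p.2 - p.2)) (s₀, y) := by
      refine ContinuousAt.add (ContinuousAt.smul (hχ.continuous.comp continuous_snd).continuousAt
        ((hc' y hyU).sub continuousAt_const)) ?_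
      have h1 : ContinuousAt (fun p : ℝ × E4 => fderiv ℝ χ p.2) (s₀, y) :=
        ((hχ.continuous_fderiv hne).comp continuous_snd).continuousAt
      have h2 : ContinuousAt (fun p : ℝ × E4 => f p.1 p.2 - p.2) (s₀, y) :=
        (hc y hyU).sub continuousAt_snd
      exact ((ContinuousLinearMap.smulRightL ℝ E4 E4).continuous₂.continuousAt).comp (h1.prodMk h2)
    have hid' : fderiv ℝ (f s₀) y = ContinuousLinearMap.id ℝ E4 := by
      have : f s₀ =ᶠ[𝓝 y] id := by
        filter_upwards [hU.mem_nhds hyU] with z hz using hid z hz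
      rw [this.fderiv_eq]; exact fderiv_id
    have hlt := hcont.norm.eventually (gt_mem_nhds (show _ < (1 / 2 : ℝ) from by
      simp [hid', hid y hyU]))
    filter_upwards [hlt, hUn] with p hp hpU
    rw [hfd _ _ hpU]
    exact hp.le
  filter_upwards [hev] with s hs
  obtain ⟨F, hF, hF1⟩ := exists_compactIsotopy_of_small (hu s) hC hC0
    (fun y hy => by simp [u, hχC y hy]) (fun y => by
      by_cases hy : y ∈ C
      · exact hs y hy
      · have : u s =ᶠ[𝓝 y] fun _ => 0 := by
          filter_upwards [hC.isClosed.isOpen_compl.mem_nhds hy] with z hz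
          simp [u, hχC z hz]
        rw [this.fderiv_eq]; simp)
  refine ⟨F, hF, Set.image_congr fun y hy => ?_⟩
  rw [hF1]; simp [u, hχA y hy]

theorem isot_of_family {f : ℝ → Equiv.Perm E4} (hf : ∀ s, f s ∈ puncturedDiffeo)
    (hc : ∀ s, ∀ y ≠ 0, ContinuousAt (fun p : ℝ × E4 => f p.1 p.2) (s, y))
    (hc' : ∀ s, ∀ y ≠ 0, ContinuousAt (fun p : ℝ × E4 => fderiv ℝ (f p.1) p.2) (s, y))
    {A : Set E4} (hA : IsCompact A) (h0 : (0 : E4) ∉ A) (a b : ℝ) :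
    Isot (f a '' A) (f b '' A) := by
  have hne : (∞ : WithTop ℕ∞) ≠ 0 := by simp
  have : ∀ x y : ℝ, Isot (f x '' A) (f y '' A) := by
    intro x y
    refine isPreconnected_univ.induction₂ (fun s t => Isot (f s '' A) (f t '' A)) ?_
      (fun _ _ _ _ _ _ => Isot.trans) (fun _ _ _ _ => Isot.symm) (mem_univ x) (mem_univ y)
    intro s₀ _
    rw [nhdsWithin_univ]
    obtain ⟨g0, g1, g2⟩ := hf s₀
    have gs0 := symm_zero g0
    have h := isot_of_local_close (f := fun s y => f s ((f s₀).symm y)) (s₀ := s₀)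
      (A := f s₀ '' A) (U := {0}ᶜ)
      (isCompact_image_of_psmooth g1 hA h0)
      isOpen_compl_singleton (by simp)
      (by
        rintro y hy rfl
        obtain ⟨x, hx, hx0⟩ := hy
        exact perm_ne_zero g0 (fun h => h0 (h ▸ hx)) hx0)
      (by simp)
      (fun s y hy => ((hf s).2.1 _ (perm_ne_zero gs0 hy)).comp y (g2 y hy))
      (fun y hy => by
        refine ContinuousAt.comp (g := fun p : ℝ × E4 => f p.1 p.2)
          (f := fun p : ℝ × E4 => (p.1, (f s₀).symm p.2)) (hc s₀ _ (perm_ne_zero gs0 hy)) ?_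
        exact continuousAt_fst.prodMk ((g2 y hy).continuousAt.comp continuousAt_snd))
      (fun y hy => by
        have hev : (fun p : ℝ × E4 => fderiv ℝ (fun y => f p.1 ((f s₀).symm y)) p.2) =ᶠ[𝓝 (s₀, y)]
            fun p => (fderiv ℝ (f p.1) ((f s₀).symm p.2)).comp (fderiv ℝ (f s₀).symm p.2) := by
          have : ∀ᶠ p : ℝ × E4 in 𝓝 (s₀, y), p.2 ∈ ({0}ᶜ : Set E4) :=
            continuous_snd.continuousAt.eventually (isOpen_compl_singleton.mem_nhds hy)
          filter_upwards [this] with p hp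
          exact fderiv_comp p.2 (((hf p.1).2.1 _ (perm_ne_zero gs0 hp)).differentiableAt hne)
            ((g2 _ hp).differentiableAt hne)
        refine ContinuousAt.congr ?_ hev.symm
        refine ContinuousAt.clm_comp ?_ ?_
        · refine ContinuousAt.comp (g := fun p : ℝ × E4 => fderiv ℝ (f p.1) p.2)
            (f := fun p : ℝ × E4 => (p.1, (f s₀).symm p.2)) (hc' s₀ _ (perm_ne_zero gs0 hy)) ?_
          exact continuousAt_fst.prodMk ((g2 y hy).continuousAt.comp continuousAt_snd)
        · have h1 : ContinuousAt (fderiv ℝ (f s₀).symm) y :=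
            ((g2 y hy).fderiv_right (m := 0) (by simp)).continuousAt
          exact ContinuousAt.comp (f := fun p : ℝ × E4 => p.2) h1 continuousAt_snd)
    filter_upwards [h] with s hs
    simpa [Set.image_image] using hs
  exact this a b

theorem continuousAt_fderiv_of_family {f : ℝ → E4 → E4}
    (hs : ∀ s, ∀ y ≠ 0, ContDiffAt ℝ ∞ (fun p : ℝ × E4 => f p.1 p.2) (s, y)) (s : ℝ) {y : E4}
    (hy : y ≠ 0) : ContinuousAt (fun p : ℝ × E4 => fderiv ℝ (f p.1) p.2) (s, y) := by
  have hne : (∞ : WithTop ℕ∞) ≠ 0 := by simp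
  have h1 : ContinuousAt (fun p : ℝ × E4 => (fderiv ℝ (fun p : ℝ × E4 => f p.1 p.2) p).comp
      (ContinuousLinearMap.inr ℝ ℝ E4)) (s, y) :=
    ContinuousAt.clm_comp ((hs s y hy).fderiv_right (m := 0) (by simp)).continuousAt
      continuousAt_const
  refine h1.congr ?_
  have : ∀ᶠ p : ℝ × E4 in 𝓝 (s, y), p.2 ∈ ({0}ᶜ : Set E4) :=
    continuous_snd.continuousAt.eventually (isOpen_compl_singleton.mem_nhds hy)
  filter_upwards [this] with p hp
  have h2 := ((hs p.1 p.2 hp).differentiableAt hne).hasFDerivAt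
  have h3 := HasFDerivAt.comp (g := fun p : ℝ × E4 => f p.1 p.2) (f := fun y : E4 => (p.1, y)) p.2
        h2
        ((hasFDerivAt_const p.1 p.2).prodMk (hasFDerivAt_id p.2))
  exact h3.fderiv.symm

/-- Isotopy along a jointly smooth family. -/
theorem isot_of_smooth_family {f : ℝ → Equiv.Perm E4} (hf : ∀ s, f s ∈ puncturedDiffeo)
    (hs : ∀ s, ∀ y ≠ 0, ContDiffAt ℝ ∞ (fun p : ℝ × E4 => f p.1 p.2) (s, y))
    {A : Set E4} (hA : IsCompact A) (h0 : (0 : E4) ∉ A) (a b : ℝ) :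
    Isot (f a '' A) (f b '' A) :=
   isot_of_family hf (fun s y hy => (hs s y hy).continuousAt)
    (fun s _ hy => continuousAt_fderiv_of_family (f := fun s => f s) hs s hy) hA h0 a b

theorem isot_translate {A S : Set E4} (hA : IsCompact A) (hS : IsPreconnected S)
    (hSA : Disjoint S A) {q q' : E4} (hq : q ∈ S) (hq' : q' ∈ S) :
    Isot ((fun y => y - q) '' A) ((fun y => y - q') '' A) := by
  have hne : (∞ : WithTop ℕ∞) ≠ 0 := by simp
  refine hS.induction₂ (fun q q' => Isot ((fun y => y - q) '' A) ((fun y => y - q') '' A)) ?_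
      (fun _ _ _ _ _ _ => Isot.trans) (fun _ _ _ _ => Isot.symm) hq hq'
  intro q hq
  apply Filter.Eventually.filter_mono nhdsWithin_le_nhds
  have hB : IsCompact ((fun y => y - q) '' A) := hA.image (by fun_prop)
  have hB0 : (fun y => y - q) '' A ⊆ ({0}ᶜ : Set E4) := by
    rintro _ ⟨y, hy, rfl⟩ h0
    rw [mem_singleton_iff, sub_eq_zero] at h0
    exact hSA.ne_of_mem hq hy h0.symm
  obtain ⟨χ, C, hχ, hC, hCU, hχC, hχA, -⟩ := exists_cutoff hB isOpen_compl_singleton hB0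
  have hcs : HasCompactSupport χ := HasCompactSupport.intro hC hχC
  obtain ⟨M, hM⟩ := (hχ.continuous_fderiv hne).bounded_above_of_compact_support
    (hcs.fderiv (𝕜 := ℝ))
  have hev : ∀ᶠ q' in 𝓝 q, M * ‖q' - q‖ < 1 / 2 := by
    have hc : ContinuousAt (fun q' => M * ‖q' - q‖) q := by fun_prop
    exact hc.eventually (gt_mem_nhds (by simp))
  filter_upwards [hev] with q' hq'
  obtain ⟨F, hF, hF1⟩ := exists_compactIsotopy_of_small
    (u := fun y => χ y • (q - q')) (hχ.smul contDiff_const) hC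
    (fun h => hCU h rfl) (fun y hy => by simp [hχC y hy]) (fun y => by
      have h1 := ((hχ.differentiable hne y).hasFDerivAt.smul_const (q - q')).fderiv
      rw [h1, ContinuousLinearMap.norm_smulRight_apply, norm_sub_rev]
      exact (mul_le_mul_of_nonneg_right (hM y) (norm_nonneg _)).trans hq'.le)
  refine ⟨F, hF, ?_⟩
  rw [Set.image_image]
  refine Set.image_congr fun y hy => ?_
  rw [hF1, hχA _ (mem_image_of_mem _ hy)]
  simp

abbrev M4 : Type := Matrix (Fin 4) (Fin 4) ℝ

/-- The linear action of a matrix on `ℝ⁴`. -/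
abbrev act (M : M4) : E4 →L[ℝ] E4 := Matrix.toEuclideanCLM (𝕜 := ℝ) M

theorem act_mul (M N : M4) (y : E4) : act (M * N) y = act M (act N y) := by
  simp [act, map_mul]

theorem continuous_act : Continuous (fun M : M4 => act M) :=
  ((Matrix.toEuclideanCLM (𝕜 := ℝ)
    (n := Fin 4)).toAlgEquiv.toLinearMap).continuous_of_finiteDimensional

/-- The permutation of `ℝ⁴` induced by an invertible matrix. -/
def actPerm (M : M4) (hM : IsUnit M) : Equiv.Perm E4 where
  toFun := act M
  invFun := act M⁻¹
  left_inv y := by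
    rw [← act_mul, Matrix.nonsing_inv_mul _ ((Matrix.isUnit_iff_isUnit_det M).1 hM)]; simp [act]
  right_inv y := by
    rw [← act_mul, Matrix.mul_nonsing_inv _ ((Matrix.isUnit_iff_isUnit_det M).1 hM)]; simp [act]

theorem actPerm_mem (M : M4) (hM : IsUnit M) : actPerm M hM ∈ puncturedDiffeo :=
  ⟨by simp [actPerm], fun _ _ => (act M).contDiff.contDiffAt,
    fun _ _ => (act M⁻¹).contDiff.contDiffAt⟩

/-- Matrices whose action preserves the isotopy class of compact sets. -/
def IsotTrivial (M : M4) : Prop :=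
  ∀ A : Set E4, IsCompact A → (0 : E4) ∉ A → Isot A (act M '' A)

theorem IsotTrivial.one : IsotTrivial 1 := fun A _ _ => by
  have : act 1 '' A = A := by simp [act]
  rw [this]; exact Isot.refl A

theorem IsotTrivial.mul {M N : M4} (hM : IsotTrivial M) (hN : IsotTrivial N) (hu : IsUnit N) :
    IsotTrivial (M * N) := fun A hA h0 => by
  have h1 := hN A hA h0
  have h2 := hM (act N '' A) (hA.image (act N).continuous) (by
    rintro ⟨y, hy, hy0⟩
    exact perm_ne_zero (actPerm_mem N hu).1 (fun h => h0 (h ▸ hy)) hy0)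
  have h3 : act (M * N) '' A = act M '' (act N '' A) := by
    rw [Set.image_image]; simp only [act_mul]
  rw [h3]; exact h1.trans h2

theorem IsotTrivial.of_path {m : ℝ → M4} (hm : Continuous m) (h0 : m 0 = 1)
    (hu : ∀ s, IsUnit (m s)) : IsotTrivial (m 1) := fun A hA hA0 => by
  have hcm : Continuous fun s => act (m s) := continuous_act.comp hm
  have h := isot_of_family (f := fun s => actPerm (m s) (hu s)) (fun s => actPerm_mem _ _)
    (fun s y _ => by
      have : Continuous fun p : ℝ × E4 => act (m p.1) p.2 :=
        (hcm.comp continuous_fst).clm_apply continuous_snd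
      exact this.continuousAt)
    (fun s y _ => by
      have : (fun p : ℝ × E4 => fderiv ℝ (actPerm (m p.1) (hu p.1)) p.2)
          = fun p => act (m p.1) := by
        ext1 p; exact (act (m p.1)).fderiv
      rw [this]
      exact (hcm.comp continuous_fst).continuousAt) hA hA0 0 1
  have h1 : actPerm (m 0) (hu 0) '' A = A := by
    have : ∀ y, actPerm (m 0) (hu 0) y = y := fun y => by simp [actPerm, h0]
    simp [this]
  rw [h1] at h
  exact h

open Matrix in
theorem isotTrivial_transvection (t : TransvectionStruct (Fin 4) ℝ) : IsotTrivial t.toMatrix := by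
  have h := IsotTrivial.of_path (m := fun s => transvection t.i t.j (s * t.c)) (by
    unfold transvection
    refine continuous_const.add ?_
    refine continuous_matrix fun i j => ?_
    by_cases h : t.i = i ∧ t.j = j <;> simp [h] <;> fun_prop) (by simp)
    (fun s => (Matrix.isUnit_iff_isUnit_det _).2 (by rw [det_transvection_of_ne _ _ t.hij]; simp))
  simpa [TransvectionStruct.toMatrix] using h

open Matrix in
theorem isotTrivial_diagonal_pos {d : Fin 4 → ℝ} (hd : ∀ i, 0 < d i) :
    IsotTrivial (diagonal d) := by
  have h := IsotTrivial.of_path (m := fun s => diagonal fun i => Real.exp (s * Real.log (d i)))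
    (Continuous.matrix_diagonal (by fun_prop)) (by simp) (fun s => by
      rw [Matrix.isUnit_iff_isUnit_det, det_diagonal, isUnit_iff_ne_zero]
      exact Finset.prod_ne_zero_iff.2 fun i _ => (Real.exp_pos _).ne')
  simpa [Real.exp_log (hd _)] using h

open Matrix in
/-- The half-turn in a coordinate plane is a product of transvections. -/
theorem isotTrivial_halfTurn {i j : Fin 4} (hij : i ≠ j) :
    IsotTrivial (diagonal fun k => if k = i ∨ k = j then -1 else 1) := by
  have ht : ∀ (a b : Fin 4) (c : ℝ), a ≠ b →
      IsotTrivial (transvection a b c) ∧ IsUnit (transvection a b c) := fun a b c hab =>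
    ⟨isotTrivial_transvection ⟨a, b, hab, c⟩,
      (Matrix.isUnit_iff_isUnit_det _).2 (by rw [det_transvection_of_ne _ _ hab]; simp)⟩
  obtain ⟨h1, u1⟩ := ht i j (-1) hij
  obtain ⟨h2, u2⟩ := ht j i 1 hij.symm
  have hq := (h1.mul h2 u2).mul h1 u1
  have uq := (u1.mul u2).mul u1
  have hh := hq.mul hq uq
  have hZ : ∀ i j : Fin 4, i ≠ j →
      (transvection i j (-1 : ℤ) * transvection j i 1 * transvection i j (-1)) *
      (transvection i j (-1 : ℤ) * transvection j i 1 * transvection i j (-1))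
      = diagonal fun k => if k = i ∨ k = j then -1 else 1 := by decide
  have hR := congrArg (fun M => M.map (Int.castRingHom ℝ)) (hZ i j hij)
  have hmt : ∀ (a b : Fin 4) (c : ℤ), (transvection a b c).map (Int.castRingHom ℝ)
      = transvection a b (c : ℝ) := fun a b c => by
    ext x y
    simp only [transvection, Matrix.map_apply, Matrix.add_apply, Matrix.one_apply,
      Matrix.single_apply, map_add]
    split_ifs <;> simp
  simp only [Matrix.map_mul, hmt] at hR
  push_cast at hR
  rw [hR] at hh
  convert hh using 1
  ext x y
  simp only [Matrix.map_apply, Matrix.diagonal_apply]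
  split_ifs <;> simp

open Matrix in
theorem isotTrivial_diagonal {d : Fin 4 → ℝ} (hd : 0 < ∏ i, d i) : IsotTrivial (diagonal d) := by
  have hd0 : ∀ i, d i ≠ 0 := fun i h => by
    rw [Finset.prod_eq_zero (Finset.mem_univ i) h] at hd; exact lt_irrefl _ hd
  have hpos : ∀ c : Fin 4 → ℝ, (∀ i, 0 < d i * c i) → (∀ i, c i * c i = 1) →
      IsotTrivial (diagonal c) → IsotTrivial (diagonal d) := by
    intro c hc hcc hT
    have h := (isotTrivial_diagonal_pos hc).mul hT (by
      rw [Matrix.isUnit_iff_isUnit_det, det_diagonal, isUnit_iff_ne_zero]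
      refine Finset.prod_ne_zero_iff.2 fun i _ h0 => ?_
      have := hcc i; rw [h0] at this; simp at this)
    rw [diagonal_mul_diagonal] at h
    simpa [mul_assoc, hcc] using h
  have hu : ∀ i j : Fin 4, IsUnit (diagonal fun k => if k = i ∨ k = j then (-1 : ℝ) else 1) := by
    intro i j
    rw [Matrix.isUnit_iff_isUnit_det, det_diagonal, isUnit_iff_ne_zero]
    refine Finset.prod_ne_zero_iff.2 fun k _ => ?_
    split_ifs <;> norm_num
  have hall := (isotTrivial_halfTurn (show (0 : Fin 4) ≠ 1 by decide)).mul
    (isotTrivial_halfTurn (show (2 : Fin 4) ≠ 3 by decide)) (hu 2 3)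
  rw [diagonal_mul_diagonal] at hall
  have hsq : ∀ i j k : Fin 4, (if k = i ∨ k = j then (-1 : ℝ) else 1) *
    (if k = i ∨ k = j then (-1 : ℝ) else 1) = 1 := fun i j k => by split_ifs <;> norm_num
  rw [Fin.prod_univ_four] at hd
  have h2 : ∀ i j : Fin 4, i ≠ j →
      (∀ k, 0 < d k * (if k = i ∨ k = j then (-1 : ℝ) else 1)) → IsotTrivial (diagonal d) :=
    fun i j hij h => hpos _ h (hsq i j) (isotTrivial_halfTurn hij)
  rcases lt_or_gt_of_ne (hd0 0) with h0 | h0 <;> rcases lt_or_gt_of_ne (hd0 1) with h1 | h1 <;>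
  rcases lt_or_gt_of_ne (hd0 2) with h2' | h2' <;> rcases lt_or_gt_of_ne (hd0 3) with h3 | h3
  · refine hpos _ (fun i => ?_) (fun i => ?_) hall
    · fin_cases i <;> simp [h0, h1, h2', h3]
    · fin_cases i <;> simp
  all_goals first
    | (exfalso
       have e1 := abs_pos.2 (hd0 0)
       have e2 := abs_pos.2 (hd0 1)
       have e3 := abs_pos.2 (hd0 2)
       have e4 := abs_pos.2 (hd0 3)
       have e := mul_pos (mul_pos (mul_pos e1 e2) e3) e4
       simp only [abs_of_neg, abs_of_pos, h0, h1, h2', h3] at e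
       linarith)
    | (refine h2 0 1 (by decide) (fun i => ?_); fin_cases i <;> simp [h0, h1, h2', h3]; done)
    | (refine h2 0 2 (by decide) (fun i => ?_); fin_cases i <;> simp [h0, h1, h2', h3]; done)
    | (refine h2 0 3 (by decide) (fun i => ?_); fin_cases i <;> simp [h0, h1, h2', h3]; done)
    | (refine h2 1 2 (by decide) (fun i => ?_); fin_cases i <;> simp [h0, h1, h2', h3]; done)
    | (refine h2 1 3 (by decide) (fun i => ?_); fin_cases i <;> simp [h0, h1, h2', h3]; done)
    | (refine h2 2 3 (by decide) (fun i => ?_); fin_cases i <;> simp [h0, h1, h2', h3]; done)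
    | (refine isotTrivial_diagonal_pos (fun i => ?_); fin_cases i <;> simp [h0, h1, h2', h3])

open Matrix in
theorem isotTrivial_of_det_pos {M : M4} (hM : 0 < M.det) : IsotTrivial M := by
  obtain ⟨L, L', D, rfl⟩ := Pivot.exists_list_transvec_mul_diagonal_mul_list_transvec M
  have hl : ∀ L : List (TransvectionStruct (Fin 4) ℝ),
      IsotTrivial (L.map TransvectionStruct.toMatrix).prod ∧
      (L.map TransvectionStruct.toMatrix).prod.det = 1 := by
    intro L
    induction L with
    | nil => exact ⟨by simpa using IsotTrivial.one, by simp⟩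
    | cons t L ih =>
      simp only [List.map_cons, List.prod_cons]
      exact ⟨(isotTrivial_transvection t).mul ih.1
        ((Matrix.isUnit_iff_isUnit_det _).2 (by rw [ih.2]; exact isUnit_one)), by simp [ih.2]⟩
  simp only [det_mul, (hl _).2, det_diagonal, one_mul, mul_one] at hM
  exact ((hl L).1.mul (isotTrivial_diagonal hM) (by
    rw [Matrix.isUnit_iff_isUnit_det, det_diagonal]
    exact isUnit_iff_ne_zero.2 hM.ne')).mul (hl L').1
    ((Matrix.isUnit_iff_isUnit_det _).2 (by rw [(hl _).2]; exact isUnit_one))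

theorem isot_image_clm {L : E4 →L[ℝ] E4} (hL : 0 < L.det) {A : Set E4} (hA : IsCompact A)
    (h0 : (0 : E4) ∉ A) : Isot A (L '' A) := by
  obtain ⟨M, rfl⟩ := (Matrix.toEuclideanCLM (𝕜 := ℝ) (n := Fin 4)).surjective L
  refine isotTrivial_of_det_pos ?_ A hA h0
  have : (Matrix.toEuclideanCLM (𝕜 := ℝ) M).det = M.det := by
    rw [ContinuousLinearMap.det]
    rw [show ((Matrix.toEuclideanCLM (𝕜 := ℝ) M : E4 →L[ℝ] E4) : E4 →ₗ[ℝ] E4)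
      = Matrix.toLin (EuclideanSpace.basisFun _ ℝ).toBasis (EuclideanSpace.basisFun _ ℝ).toBasis M
      from by rw [Matrix.coe_toEuclideanCLM_eq_toEuclideanLin,
        Matrix.toEuclideanLin_eq_toLin_orthonormal]]
    exact LinearMap.det_toLin _ _
  exact this ▸ hL

section
open MeasureTheory

/-- The standard basis of `ℝ⁴`. -/
abbrev bas : Module.Basis (Fin 4) ℝ E4 := (EuclideanSpace.basisFun (Fin 4) ℝ).toBasis

/-- The standard volume form of `ℝ⁴`. -/
def volForm : E4 [⋀^Fin 4]→L[ℝ] ℝ where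
  toMultilinearMap := bas.det.toMultilinearMap
  cont := by
    change Continuous fun v => (bas.toMatrix v).det
    refine Continuous.matrix_det (continuous_matrix fun i j => ?_)
    simp only [Basis.toMatrix_apply, OrthonormalBasis.coe_toBasis_repr_apply,
      EuclideanSpace.basisFun_repr]
    fun_prop
  map_eq_zero_of_eq' := bas.det.map_eq_zero_of_eq'

theorem volForm_clm (L : E4 →L[ℝ] E4) : volForm (fun i => L (bas i)) = L.det := by
  have h := bas.det_comp (L : E4 →ₗ[ℝ] E4) bas
  rw [bas.det_self, mul_one] at h
  exact h

theorem volForm_cramer (v : Fin 4 → E4) (w : E4) :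
    ∑ j, volForm (Function.update v j w) • v j = volForm v • w := by
  have h := Matrix.mulVec_cramer (bas.toMatrix v) (bas.repr w)
  have hc : ∀ j, (bas.toMatrix v).cramer (bas.repr w) j = volForm (Function.update v j w) := by
    intro j
    rw [Matrix.cramer_apply, ← Basis.toMatrix_update]
    rfl
  ext i
  have hi := congrFun h i
  simp only [Matrix.mulVec, dotProduct, hc, Pi.smul_apply] at hi
  simp only [WithLp.ofLp_sum, WithLp.ofLp_smul, Finset.sum_apply, Pi.smul_apply, smul_eq_mul]
  refine (Finset.sum_congr rfl fun j _ => ?_).trans hi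
  rw [mul_comm]; rfl

theorem volForm_update_comm (v : Fin 4 → E4) {j k : Fin 4} (hjk : j ≠ k) (w x : E4) :
    volForm (Function.update (Function.update v j w) k x)
      = - volForm (Function.update (Function.update v k w) j x) := by
  have h := volForm.toAlternatingMap.map_swap (Function.update (Function.update v k w) j x) hjk
  change volForm _ = - volForm _ at h
  rw [← h]
  congr 1
  ext1 i
  simp only [Function.comp, Function.update_apply]
  by_cases hj : i = j
  · subst hj; simp [hjk.symm, hjk]
  by_cases hk : i = k
  · subst hk; simp
  simp [Equiv.swap_apply_of_ne_of_ne hj hk, hj, hk]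

theorem det_fderiv_eq_volForm {F : ℝ × E4 → E4} {s : ℝ} {y : E4}
    (hF : DifferentiableAt ℝ F (s, y)) :
    (fderiv ℝ (fun y => F (s, y)) y).det = volForm fun i => fderiv ℝ F (s, y) (0, bas i) := by
  rw [← volForm_clm]
  have h : HasFDerivAt (fun y => F (s, y))
      ((fderiv ℝ F (s, y)).comp (ContinuousLinearMap.inr ℝ ℝ E4)) y :=
    hF.hasFDerivAt.comp y ((hasFDerivAt_const s y).prodMk (hasFDerivAt_id y))
  rw [h.fderiv]
  simp

section
variable {F : ℝ × E4 → E4} (hF : ContDiff ℝ ∞ F) {ρ : E4 → ℝ} (hρ : ContDiff ℝ ∞ ρ)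
include hF

theorem hasFDerivAt_fderiv_apply (p a : ℝ × E4) :
    HasFDerivAt (fun q => fderiv ℝ F q a) ((fderiv ℝ (fderiv ℝ F) p).flip a) p := by
  have h1 : ContDiff ℝ ∞ (fderiv ℝ F) := hF.fderiv_right (by simp)
  have := (h1.differentiable (by simp) p).hasFDerivAt
  exact this.clm_apply (hasFDerivAt_const a p) |>.congr_fderiv (by ext <;> simp)

theorem fderiv_fderiv_comm (p a b : ℝ × E4) :
    fderiv ℝ (fderiv ℝ F) p a b = fderiv ℝ (fderiv ℝ F) p b a :=
  (hF.contDiffAt.isSymmSndFDerivAt (by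
    rw [minSmoothness_of_isRCLikeNormedField]
    exact WithTop.coe_le_coe.2 (le_top (a := (2 : ℕ∞))))) a b

end

/-- The Jacobian determinant of a time-dependent map, in space directions. -/
def jacobian (F : ℝ × E4 → E4) (p : ℝ × E4) : ℝ := volForm fun i => fderiv ℝ F p (0, bas i)

/-- The Jacobian determinant with the `j`-th column replaced by the time derivative. -/
def jacobianFlux (F : ℝ × E4 → E4) (j : Fin 4) (p : ℝ × E4) : ℝ :=
  volForm (Function.update (fun i => fderiv ℝ F p (0, bas i)) j (fderiv ℝ F p (1, 0)))

theorem contDiff_volForm : ContDiff ℝ ∞ (fun v : Fin 4 → E4 => volForm v) :=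
  volForm.toContinuousMultilinearMap.contDiff

theorem contDiff_jacobian {F : ℝ × E4 → E4} (hF : ContDiff ℝ ∞ F) : ContDiff ℝ ∞ (jacobian F) := by
  have h1 : ContDiff ℝ ∞ (fderiv ℝ F) := hF.fderiv_right (by simp)
  exact contDiff_volForm.comp (contDiff_pi.2 fun i => h1.clm_apply contDiff_const)

theorem contDiff_jacobianFlux {F : ℝ × E4 → E4} (hF : ContDiff ℝ ∞ F) (j : Fin 4) :
    ContDiff ℝ ∞ (jacobianFlux F j) := by
  have h1 : ContDiff ℝ ∞ (fderiv ℝ F) := hF.fderiv_right (by simp)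
  refine contDiff_volForm.comp (contDiff_pi.2 fun i => ?_)
  by_cases h : i = j
  · subst h; simpa using h1.clm_apply contDiff_const
  · simpa [Function.update_of_ne h] using h1.clm_apply contDiff_const

theorem hasFDerivAt_volForm_comp {v : ℝ × E4 → Fin 4 → E4} {v' : Fin 4 → (ℝ × E4 →L[ℝ] E4)}
    {p : ℝ × E4} (h : ∀ i, HasFDerivAt (fun q => v q i) (v' i) p) :
    ∃ L : ℝ × E4 →L[ℝ] ℝ, HasFDerivAt (fun q => volForm (v q)) L p ∧
      ∀ a, L a = ∑ k, volForm (Function.update (v p) k (v' k a)) := by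
  have h1 : HasFDerivAt v (ContinuousLinearMap.pi v') p := hasFDerivAt_pi.2 h
  refine ⟨_, (volForm.toContinuousMultilinearMap.hasFDerivAt (v p)).comp p h1, fun a => ?_⟩
  simp [ContinuousMultilinearMap.linearDeriv_apply]

theorem jacobian_conservation {F : ℝ × E4 → E4} (hF : ContDiff ℝ ∞ F) (p : ℝ × E4) :
    fderiv ℝ (jacobian F) p (1, 0) = ∑ j, fderiv ℝ (jacobianFlux F j) p (0, bas j) := by
  obtain ⟨L, hL, hLa⟩ := hasFDerivAt_volForm_comp
    (fun i => hasFDerivAt_fderiv_apply hF p ((0 : ℝ), bas i))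
  have hL' : fderiv ℝ (jacobian F) p = L := hL.fderiv
  have hflux : ∀ j, fderiv ℝ (jacobianFlux F j) p (0, bas j) =
      ∑ k, volForm (Function.update
        (Function.update (fun i => fderiv ℝ F p (0, bas i)) j (fderiv ℝ F p (1, 0))) k
        (if k = j then fderiv ℝ (fderiv ℝ F) p (0, bas j) (1, 0)
          else fderiv ℝ (fderiv ℝ F) p (0, bas j) (0, bas k))) := by
    intro j
    obtain ⟨L, hL, hLa⟩ := hasFDerivAt_volForm_comp
      (v := fun q => Function.update (fun i => fderiv ℝ F q (0, bas i)) j (fderiv ℝ F q (1, 0)))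
      (v' := fun k => (fderiv ℝ (fderiv ℝ F) p).flip (if k = j then (1, 0) else (0, bas k)))
      (p := p) (fun i => by
        by_cases h : i = j
        · subst h; simpa using hasFDerivAt_fderiv_apply hF p _
        · simpa [Function.update_of_ne h, h] using hasFDerivAt_fderiv_apply hF p _)
    have hL' : fderiv ℝ (jacobianFlux F j) p = L := hL.fderiv
    rw [hL', hLa]
    refine Finset.sum_congr rfl fun k _ => ?_
    split_ifs <;> simp
  rw [hL', hLa]
  simp only [hflux]
  set v : Fin 4 → E4 := fun i => fderiv ℝ F p (0, bas i)
  set w : E4 := fderiv ℝ F p (1, 0)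
  set B := fderiv ℝ (fderiv ℝ F) p
  have hB : ∀ a b, B a b = B b a := fderiv_fderiv_comm hF p
  let T : Fin 4 → Fin 4 → ℝ := fun j k => if k = j then 0 else
    volForm (Function.update (Function.update v j w) k (B (0, bas j) (0, bas k)))
  have hT : ∀ j k, T j k = - T k j := by
    intro j k
    by_cases h : k = j
    · simp [T, h]
    · simp only [T, h, Ne.symm h, if_false]
      rw [volForm_update_comm v (Ne.symm h), hB]
  have hT0 : ∑ j, ∑ k, T j k = 0 := by
    have h1 : ∑ j, ∑ k, T j k = - ∑ j, ∑ k, T j k := by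
      conv_rhs => rw [Finset.sum_comm]
      simp only [← Finset.sum_neg_distrib]
      exact Finset.sum_congr rfl fun j _ => Finset.sum_congr rfl fun k _ => hT j k
    linarith
  have hsplit : ∀ j, ∑ k, volForm (Function.update (Function.update v j w) k
        (if k = j then B (0, bas j) (1, 0) else B (0, bas j) (0, bas k))) =
      volForm (Function.update v j (B (0, bas j) (1, 0))) + ∑ k, T j k := by
    intro j
    rw [← Finset.add_sum_erase _ _ (Finset.mem_univ j),
      ← Finset.add_sum_erase _ (fun k => T j k) (Finset.mem_univ j)]
    have : T j j = 0 := by simp [T]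
    rw [this, zero_add]
    congr 1
    · simp
    · refine Finset.sum_congr rfl fun k hk => ?_
      have := Finset.ne_of_mem_erase hk
      simp [T, this]
  simp only [hsplit, Finset.sum_add_distrib, hT0, add_zero]
  refine Finset.sum_congr rfl fun j _ => ?_
  rw [ContinuousLinearMap.flip_apply, hB]

theorem density_conservation {F : ℝ × E4 → E4} (hF : ContDiff ℝ ∞ F) {ρ : E4 → ℝ}
    (hρ : ContDiff ℝ ∞ ρ) (p : ℝ × E4) :
    fderiv ℝ (fun q => ρ (F q) * jacobian F q) p (1, 0)
      = ∑ j, fderiv ℝ (fun q => ρ (F q) * jacobianFlux F j q) p (0, bas j) := by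
  have hne : (∞ : WithTop ℕ∞) ≠ 0 := by simp
  have hρF : HasFDerivAt (fun q => ρ (F q)) ((fderiv ℝ ρ (F p)).comp (fderiv ℝ F p)) p :=
    (hρ.differentiable hne _).hasFDerivAt.comp p (hF.differentiable hne p).hasFDerivAt
  have h1 := (hρF.mul ((contDiff_jacobian hF).differentiable hne p).hasFDerivAt).fderiv
  have h2 := fun j =>
    (hρF.mul ((contDiff_jacobianFlux hF j).differentiable hne p).hasFDerivAt).fderiv
  have e1 : fderiv ℝ (fun q => ρ (F q) * jacobian F q) p = _ := h1
  have e2 : ∀ j, fderiv ℝ (fun q => ρ (F q) * jacobianFlux F j q) p = _ := h2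
  rw [e1]
  simp only [e2, add_apply, smul_apply, smul_eq_mul,
    ContinuousLinearMap.comp_apply, Finset.sum_add_distrib, ← Finset.mul_sum,
    ← jacobian_conservation hF p]
  congr 1
  have := congrArg (fderiv ℝ ρ (F p)) (volForm_cramer (fun i => fderiv ℝ F p (0, bas i))
    (fderiv ℝ F p (1, 0)))
  simpa [map_sum, jacobian, jacobianFlux] using this.symm

/-- Conservation of the degree integral along a homotopy. -/
theorem integral_degree_eq {F : ℝ × E4 → E4} (hF : ContDiff ℝ ∞ F) {ρ θ : E4 → ℝ}
    (hρ : ContDiff ℝ ∞ ρ) (hθ : ContDiff ℝ ∞ θ) (hθc : HasCompactSupport θ)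
    (hρθ : ∀ s y, fderiv ℝ θ y ≠ 0 → ρ (F (s, y)) = 0) (a b : ℝ) :
    ∫ y, θ y * (ρ (F (a, y)) * jacobian F (a, y))
      = ∫ y, θ y * (ρ (F (b, y)) * jacobian F (b, y)) := by
  have hne : (∞ : WithTop ℕ∞) ≠ 0 := by simp
  set g : ℝ × E4 → ℝ := fun q => ρ (F q) * jacobian F q with hg
  have hgs : ContDiff ℝ ∞ g := (hρ.comp hF).mul (contDiff_jacobian hF)
  have hg' : Continuous fun q => fderiv ℝ g q (1, 0) :=
    (hgs.continuous_fderiv hne).clm_apply continuous_const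
  have hint : ∀ (u : E4 → ℝ), Continuous u → Integrable fun y => θ y * u y := fun u hu =>
    (hθ.continuous.mul hu).integrable_of_hasCompactSupport hθc.mul_right
  have hder : ∀ s, HasDerivAt (fun s => ∫ y, θ y * g (s, y))
      (∫ y, θ y * fderiv ℝ g (s, y) (1, 0)) s := by
    intro s
    obtain ⟨M, hM⟩ :=
      ((isCompact_Icc (a := s - 1) (b := s + 1)).prod hθc).exists_bound_of_continuousOn
      (f := fun q : ℝ × E4 => θ q.2 * fderiv ℝ g q (1, 0))
      ((hθ.continuous.comp continuous_snd).mul hg').continuousOn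
    refine (hasDerivAt_integral_of_dominated_loc_of_deriv_le (s := Icc (s - 1) (s + 1))
      (bound := (tsupport θ).indicator fun _ => M)
      (F' := fun s y => θ y * fderiv ℝ g (s, y) (1, 0))
      (Icc_mem_nhds (by linarith) (by linarith)) ?_ ?_ ?_ ?_ ?_ ?_).2
    · exact Filter.Eventually.of_forall fun s =>
        (hθ.continuous.mul (hgs.continuous.comp (by fun_prop))).aestronglyMeasurable
    · exact hint _ (hgs.continuous.comp (by fun_prop))
    · exact (hθ.continuous.mul (hg'.comp (by fun_prop))).aestronglyMeasurable
    · refine Filter.Eventually.of_forall fun y s' hs' => ?_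
      by_cases hy : y ∈ tsupport θ
      · rw [indicator_of_mem hy]; exact hM (s', y) ⟨hs', hy⟩
      · rw [indicator_of_notMem hy, image_eq_zero_of_notMem_tsupport hy]; simp
    · exact (integrable_indicator_iff (isClosed_tsupport θ).measurableSet).2
        (integrableOn_const hθc.measure_ne_top)
    · refine Filter.Eventually.of_forall fun y s' _ => HasDerivAt.const_mul _ ?_
      have h1 : HasDerivAt (fun s : ℝ => (s, y)) (1, 0) s' :=
        (hasDerivAt_id s').prodMk (hasDerivAt_const s' y)
      exact (hgs.differentiable hne _).hasFDerivAt.comp_hasDerivAt s' h1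
  have hzero : ∀ s, ∫ y, θ y * fderiv ℝ g (s, y) (1, 0) = 0 := by
    intro s
    simp only [hg, density_conservation hF hρ, Finset.mul_sum]
    have hj : ∀ j, ContDiff ℝ ∞ fun q => ρ (F q) * jacobianFlux F j q := fun j =>
      (hρ.comp hF).mul (contDiff_jacobianFlux hF j)
    have hcj : ∀ j, Continuous fun y : E4 =>
        fderiv ℝ (fun q => ρ (F q) * jacobianFlux F j q) (s, y) (0, bas j) := fun j =>
      (((hj j).continuous_fderiv hne).clm_apply continuous_const).comp (by fun_prop)
    rw [integral_finsetSum _ fun j _ => hint _ (hcj j)]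
    refine Finset.sum_eq_zero fun j _ => ?_
    have hjs : ContDiff ℝ ∞ fun y => ρ (F (s, y)) * jacobianFlux F j (s, y) :=
      (hj j).comp (contDiff_const.prodMk contDiff_id)
    have hfd : ∀ y, fderiv ℝ (fun q => ρ (F q) * jacobianFlux F j q) (s, y) (0, bas j)
        = fderiv ℝ (fun y => ρ (F (s, y)) * jacobianFlux F j (s, y)) y (bas j) := by
      intro y
      have h : HasFDerivAt (fun y => ρ (F (s, y)) * jacobianFlux F j (s, y))
          ((fderiv ℝ (fun q => ρ (F q) * jacobianFlux F j q) (s, y)).comp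
            (ContinuousLinearMap.inr ℝ ℝ E4)) y :=
        ((hj j).differentiable hne (s, y)).hasFDerivAt.comp y
          ((hasFDerivAt_const s y).prodMk (hasFDerivAt_id y))
      rw [h.fderiv]; simp
    simp only [hfd]
    have hθ' : ∀ y, fderiv ℝ θ y (bas j) * (ρ (F (s, y)) * jacobianFlux F j (s, y)) = 0 := by
      intro y
      by_cases h : fderiv ℝ θ y = 0
      · simp [h]
      · simp [hρθ s y h]
    rw [integral_mul_fderiv_eq_neg_fderiv_mul_of_integrable (by
        simp only [hθ']; exact integrable_zero _ _ _)
      (hint _ ((hjs.continuous_fderiv hne).clm_apply continuous_const)) (hint _ hjs.continuous)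
      (fun y _ => hθ.differentiable hne y) (fun y _ => hjs.differentiable hne y)]
    simp only [hθ', integral_zero, neg_zero]
  have hconst := is_const_of_deriv_eq_zero (f := fun s => ∫ y, θ y * g (s, y))
    (fun s => (hder s).differentiableAt) (fun s => by rw [(hder s).deriv, hzero])
  exact hconst a b

end

section
open MeasureTheory

theorem continuousOn_det_fderiv {f : E4 → E4} (hf : PSmooth f) :
    ContinuousOn (fun y => (fderiv ℝ f y).det) {0}ᶜ := fun y hy =>
  (ContinuousLinearMap.continuous_det.continuousAt.comp
    ((hf y hy).continuousAt_fderiv (by simp))).continuousWithinAt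

theorem det_fderiv_ne_zero {f : Equiv.Perm E4} (hf : f ∈ puncturedDiffeo) {y : E4} (hy : y ≠ 0) :
    (fderiv ℝ f y).det ≠ 0 := fun h => by
  have h1 := LinearMap.bot_lt_ker_of_det_eq_zero (f := (fderiv ℝ f y : E4 →ₗ[ℝ] E4)) h
  exact h1.ne' (LinearMap.ker_eq_bot'.2 (fderiv_injective_of_mem hf hy))

theorem isConnected_punctured : IsConnected ({0}ᶜ : Set E4) :=
  isConnected_compl_singleton_of_one_lt_rank (by
    rw [← Module.finrank_eq_rank]; simp) 0

/-- A smooth cutoff vanishing near the origin. -/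
def originCutoff (y : E4) : ℝ := Real.smoothTransition (8 * ‖y‖ ^ 2 - 1)

theorem contDiff_originCutoff : ContDiff ℝ ∞ originCutoff :=
  Real.smoothTransition.contDiff.comp ((contDiff_const.mul (contDiff_norm_sq ℝ)).sub contDiff_const)

theorem originCutoff_eq_one {y : E4} (hy : 1 / 2 < ‖y‖) : originCutoff y = 1 :=
  Real.smoothTransition.one_of_one_le (by nlinarith)

theorem originCutoff_eventually_zero : ∀ᶠ y in 𝓝 (0 : E4), originCutoff y = 0 := by
  have : ∀ᶠ y : E4 in 𝓝 0, 8 * ‖y‖ ^ 2 - 1 < 0 := by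
    have h : ContinuousAt (fun y : E4 => 8 * ‖y‖ ^ 2 - 1) 0 := by fun_prop
    exact h.eventually (gt_mem_nhds (by simp))
  filter_upwards [this] with y hy using Real.smoothTransition.zero_of_nonpos hy.le

theorem originCutoff_mem (y : E4) : originCutoff y ∈ Icc (0 : ℝ) 1 :=
  ⟨Real.smoothTransition.nonneg _, Real.smoothTransition.le_one _⟩

theorem originCutoff_zero : originCutoff 0 = 0 := originCutoff_eventually_zero.self_of_nhds

theorem contDiff_originCutoff_smul {f : E4 → E4} (hf : PSmooth f) :
    ContDiff ℝ ∞ fun y => originCutoff y • f y := by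
  rw [contDiff_iff_contDiffAt]
  intro y
  by_cases hy : y = 0
  · subst hy
    refine (contDiffAt_const (c := (0 : E4))).congr_of_eventuallyEq ?_
    filter_upwards [originCutoff_eventually_zero] with y hy
    simp [hy]
  · exact contDiff_originCutoff.contDiffAt.smul (hf y hy)

/-- A self-diffeomorphism of the punctured space which is homotopic to the identity through maps
of controlled growth preserves the orientation. -/
theorem det_fderiv_pos_of_homotopy {φ : Equiv.Perm E4} (hφ : φ ∈ puncturedDiffeo)
    {H : ℝ × E4 → E4} (hH : ∀ s, ∀ y ≠ 0, ContinuousAt H (s, y))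
    (h0 : ∀ s ≤ 0, ∀ y ≠ 0, H (s, y) = y) (h1 : ∀ s ≥ 1, ∀ y ≠ 0, H (s, y) = φ y) {C : ℝ}
    (hC : 0 < C) (hlo : ∀ s, ∀ y ≠ 0, ‖y‖ ≤ C * ‖H (s, y)‖)
    (hhi : ∀ s, ∀ y ≠ 0, ‖H (s, y)‖ ≤ C * ‖y‖) {y : E4} (hy : y ≠ 0) :
    0 < (fderiv ℝ φ y).det := by
  by_contra hneg
  have hall : ∀ z ≠ 0, (fderiv ℝ φ z).det < 0 := by
    intro z hz
    by_contra hz'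
    obtain ⟨w, hw, hw0⟩ := isConnected_punctured.isPreconnected.intermediate_value hy hz
      (continuousOn_det_fderiv hφ.2.1) ⟨not_lt.1 hneg, not_lt.1 hz'⟩
    exact det_fderiv_ne_zero hφ hw hw0
  set K : ℝ × E4 → E4 := fun q => originCutoff q.2 • H q with hK
  have hKc : Continuous K := by
    rw [continuous_iff_continuousAt]
    rintro ⟨s, z⟩
    by_cases hz : z = 0
    · subst hz
      refine (continuousAt_const (y := (0 : E4))).congr ?_
      filter_upwards [continuousAt_snd.eventually originCutoff_eventually_zero] with q hq
      simp [hK, hq]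
    · exact ((contDiff_originCutoff.continuous.comp continuous_snd).continuousAt).smul (hH s z hz)
  set S : Set (ℝ × E4) := {q | q.1 ≤ -1 ∨ 2 ≤ q.1}
  set U : Set (ℝ × E4) := {q | q.1 < 0 ∨ 1 < q.1}
  have hS : IsClosed S := (isClosed_le continuous_fst continuous_const).union
    (isClosed_le continuous_const continuous_fst)
  have hUl : IsOpen {q : ℝ × E4 | q.1 < 0} := isOpen_lt continuous_fst continuous_const
  have hUr : IsOpen {q : ℝ × E4 | 1 < q.1} := isOpen_lt continuous_const continuous_fst
  have hSU : S ⊆ U := by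
    rintro q (h | h)
    · exact Or.inl (by linarith)
    · exact Or.inr (by linarith)
  have hKl : ∀ s < 0, ∀ y, K (s, y) = originCutoff y • y := by
    intro s hs y
    by_cases hy : y = 0
    · simp [hK, hy, originCutoff_zero]
    · simp [hK, h0 s hs.le y hy]
  have hKr : ∀ s > 1, ∀ y, K (s, y) = originCutoff y • φ y := by
    intro s hs y
    by_cases hy : y = 0
    · simp [hK, hy, originCutoff_zero]
    · simp [hK, h1 s hs.le y hy]
  have hKU : ContDiffOn ℝ ∞ K U := by
    rintro ⟨s, y⟩ (h | h)
    · refine ContDiffAt.contDiffWithinAt ?_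
      refine ((contDiff_originCutoff_smul (f := id) fun _ _ => contDiffAt_id).comp
        contDiff_snd).contDiffAt.congr_of_eventuallyEq ?_
      filter_upwards [hUl.mem_nhds h] with q hq using hKl q.1 hq q.2
    · refine ContDiffAt.contDiffWithinAt ?_
      refine ((contDiff_originCutoff_smul hφ.2.1).comp
        contDiff_snd).contDiffAt.congr_of_eventuallyEq ?_
      filter_upwards [hUr.mem_nhds h] with q hq using hKr q.1 hq q.2
  obtain ⟨F, hF, hFK, hFS, -⟩ := hKc.exists_contDiff_approx_and_eqOn ⊤ continuous_const
    (fun _ => one_pos) hS ((hUl.union hUr).mem_nhdsSet.2 hSU) hKU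
  have hF0 : ∀ y, F (-1, y) = originCutoff y • y := fun y => by
    rw [hFS (Or.inl le_rfl), hKl _ (by norm_num)]
  have hF1 : ∀ y, F (2, y) = originCutoff y • φ y := fun y => by
    rw [hFS (Or.inr le_rfl), hKr _ (by norm_num)]
  obtain ⟨p, hp⟩ : ∃ p : E4, ‖p‖ = C + 5 := ⟨EuclideanSpace.single 0 (C + 5), by
    rw [PiLp.norm_single, Real.norm_eq_abs, abs_of_pos (by linarith)]⟩
  let ρ : ContDiffBump p := ⟨1, 2, one_pos, one_lt_two⟩
  have hR : 0 < C * (C + 20) := by positivity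
  let θ : ContDiffBump (0 : E4) := ⟨C * (C + 20), 2 * (C * (C + 20)), hR, by linarith⟩
  have hρ : ∀ z, ρ z ≠ 0 → C + 3 < ‖z‖ ∧ ‖z‖ < C + 7 := by
    intro z hz
    have hz' : z ∈ ball p 2 := by
      have : z ∈ Function.support ρ := hz
      rwa [ρ.support_eq] at this
    rw [mem_ball, dist_eq_norm] at hz'
    have e1 := norm_sub_norm_le p z
    have e2 := norm_sub_norm_le z p
    rw [norm_sub_rev] at e1
    constructor <;> linarith
  have hfd : ∀ s y, fderiv ℝ θ y ≠ 0 → ρ (F (s, y)) = 0 := by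
    intro s y hy
    by_contra hρ0
    have hy' : C * (C + 20) ≤ ‖y‖ := by
      by_contra hlt
      have hb : y ∈ ball (0 : E4) θ.rIn := by simpa using hlt
      have : θ =ᶠ[𝓝 y] fun _ => 1 := by
        filter_upwards [isOpen_ball.mem_nhds hb] with z hz using
          θ.one_of_mem_closedBall (ball_subset_closedBall hz)
      exact hy (by rw [this.fderiv_eq]; simp)
    have hC20 : 1 / 2 < ‖y‖ := by
      have hy0 : y ≠ 0 := fun h => by rw [h, norm_zero] at hy'; linarith
      have h2 := hlo 0 y hy0
      rw [h0 0 le_rfl y hy0] at h2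
      have : 1 ≤ C := by
        by_contra hc; nlinarith
      nlinarith
    have hy0 : y ≠ 0 := fun h => by rw [h, norm_zero] at hC20; linarith
    have h3 := hFK (s, y)
    simp only [hK, originCutoff_eq_one hC20, one_smul] at h3
    rw [dist_eq_norm] at h3
    have h4 := norm_sub_norm_le (H (s, y)) (F (s, y))
    rw [norm_sub_rev] at h4
    have h5 := hlo s y hy0
    have h6 : C + 20 ≤ ‖H (s, y)‖ := le_of_mul_le_mul_left (hy'.trans h5) hC
    linarith [(hρ _ hρ0).2]
  have hkey := integral_degree_eq hF ρ.contDiff θ.contDiff θ.hasCompactSupport hfd (-1) 2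
  have hjac : ∀ {g : E4 → E4} {s y}, (∀ y, F (s, y) = originCutoff y • g y) → 1 / 2 < ‖y‖ →
      jacobian F (s, y) = (fderiv ℝ g y).det := by
    intro g s y hg hy
    rw [jacobian, ← det_fderiv_eq_volForm (hF.differentiable (by simp) _)]
    congr 1
    refine Filter.EventuallyEq.fderiv_eq ?_
    filter_upwards [continuous_norm.continuousAt.eventually (lt_mem_nhds hy)] with z hz
    rw [hg, originCutoff_eq_one hz, one_smul]
  have hj0 : ∀ {y : E4}, 1 / 2 < ‖y‖ → jacobian F (-1, y) = 1 := fun hy => by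
    rw [hjac (g := id) hF0 hy]; simp [ContinuousLinearMap.det]
  have hbig : ∀ {g : E4 → E4} {s y}, (∀ y, F (s, y) = originCutoff y • g y) →
      (∀ y, ‖g y‖ ≤ (C + 1) * ‖y‖) → ρ (F (s, y)) ≠ 0 → 1 / 2 < ‖y‖ := by
    intro g s y hg hgy hne
    by_contra hy
    have e1 := (hρ _ hne).1
    rw [hg, norm_smul, Real.norm_eq_abs, abs_of_nonneg (originCutoff_mem y).1] at e1
    have e2 := mul_le_of_le_one_left (norm_nonneg (g y)) (originCutoff_mem y).2
    nlinarith [hgy y]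
  have hpos : 0 < ∫ y, θ y * (ρ (F (-1, y)) * jacobian F (-1, y)) := by
    have hpn : 1 / 2 < ‖p‖ := by rw [hp]; linarith
    refine Continuous.integral_pos_of_hasCompactSupport_nonneg_nonzero (x := p) ?_ ?_ ?_ ?_
    · exact θ.continuous.mul ((ρ.continuous.comp (hF.continuous.comp (by fun_prop))).mul
        ((contDiff_jacobian hF).continuous.comp (by fun_prop)))
    · exact θ.hasCompactSupport.mul_right
    · intro y
      refine mul_nonneg θ.nonneg ?_
      by_cases hy : ρ (F (-1, y)) = 0
      · simp [hy]
      · rw [hj0 (hbig (g := id) hF0 (fun y => by simp; nlinarith [norm_nonneg y]) hy), mul_one]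
        exact ρ.nonneg
    · have e1 : θ p = 1 := θ.one_of_mem_closedBall (by
        rw [mem_closedBall, dist_zero_right, hp]
        have : 1 ≤ C := by
          have hp0 : p ≠ 0 := fun h => by rw [h, norm_zero] at hpn; linarith
          have h2 := hlo 0 p hp0
          rw [h0 0 le_rfl p hp0] at h2
          by_contra hc; nlinarith
        change C + 5 ≤ C * (C + 20)
        nlinarith)
      have e2 : ρ p = 1 := ρ.one_of_mem_closedBall (by simp [ρ])
      rw [hj0 hpn, hF0, originCutoff_eq_one hpn, one_smul, e1, e2]; norm_num
  have hnonpos : ∫ y, θ y * (ρ (F (2, y)) * jacobian F (2, y)) ≤ 0 := by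
    refine integral_nonpos fun y => ?_
    refine mul_nonpos_of_nonneg_of_nonpos θ.nonneg ?_
    by_cases hy : ρ (F (2, y)) = 0
    · simp [hy]
    · have hb := hbig (g := φ) hF1 (fun y => by
        by_cases hy : y = 0
        · simp [hy, hφ.1]
        · have := hhi 1 y hy
          rw [h1 1 le_rfl y hy] at this
          nlinarith [norm_nonneg y]) hy
      rw [hjac hF1 hb]
      refine mul_nonpos_of_nonneg_of_nonpos ρ.nonneg (hall y fun h => ?_).le
      rw [h, norm_zero] at hb; linarith
  linarith

/-- The orientation-preserving self-diffeomorphisms of the punctured space. -/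
def orientedDiffeo : Subgroup (Equiv.Perm E4) where
  carrier := {f | f ∈ puncturedDiffeo ∧ ∀ y ≠ 0, 0 < (fderiv ℝ f y).det}
  one_mem' := ⟨puncturedDiffeo.one_mem, fun y _ => by
    have : (fderiv ℝ (1 : Equiv.Perm E4) y) = ContinuousLinearMap.id ℝ E4 := fderiv_id
    rw [this]; simp [ContinuousLinearMap.det]⟩
  mul_mem' := by
    rintro f g ⟨hf, hf'⟩ ⟨hg, hg'⟩
    refine ⟨puncturedDiffeo.mul_mem hf hg, fun y hy => ?_⟩
    have hne : (∞ : WithTop ℕ∞) ≠ 0 := by simp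
    have h1 := ((hf.2.1 _ (perm_ne_zero hg.1 hy)).differentiableAt hne).hasFDerivAt.comp y
      ((hg.2.1 y hy).differentiableAt hne).hasFDerivAt
    have h2 : fderiv ℝ (f * g : Equiv.Perm E4) y = _ := h1.fderiv
    rw [h2]
    have := mul_pos (hf' _ (perm_ne_zero hg.1 hy)) (hg' y hy)
    rwa [ContinuousLinearMap.det, ContinuousLinearMap.det, ← LinearMap.det_comp] at this
  inv_mem' := by
    rintro f ⟨hf, hf'⟩
    refine ⟨puncturedDiffeo.inv_mem hf, fun y hy => ?_⟩
    have hne : (∞ : WithTop ℕ∞) ≠ 0 := by simp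
    have hz := perm_ne_zero (symm_zero hf.1) hy
    have h1 := ((hf.2.1 _ hz).differentiableAt hne).hasFDerivAt.comp y
      ((hf.2.2 y hy).differentiableAt hne).hasFDerivAt
    have h2 : (f : E4 → E4) ∘ f.symm = id := by ext1 y; simp
    rw [h2] at h1
    have h3 := congrArg ContinuousLinearMap.det (h1.unique (hasFDerivAt_id y))
    have h4 : (fderiv ℝ f (f.symm y)).det * (fderiv ℝ f.symm y).det = 1 := by
      rw [ContinuousLinearMap.det, ContinuousLinearMap.det, ← LinearMap.det_comp]
      refine h3.trans ?_
      simp [ContinuousLinearMap.det]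
    have h5 := hf' _ hz
    change 0 < (fderiv ℝ f.symm y).det
    by_contra h6
    nlinarith

end

/-- Maps of the punctured space, constant along rays, which embed the unit sphere. -/
structure IsSphereMap (g : E4 → E4) : Prop where
  smooth : PSmooth g
  homog : ∀ c : ℝ, 0 < c → ∀ y, g (c • y) = g y
  inj : InjOn g (sphere 0 1)
  immersive : ∀ x ∈ sphere (0 : E4) 1, ∀ v, inner ℝ x v = 0 → fderiv ℝ g x v = 0 → v = 0

theorem ne_zero_of_mem_unit {x : E4} (hx : x ∈ sphere (0 : E4) 1) : x ≠ 0 :=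
  ne_of_mem_sphere hx one_ne_zero

theorem norm_of_mem_unit {x : E4} (hx : x ∈ sphere (0 : E4) 1) : ‖x‖ = 1 := by simpa using hx

theorem normalize_mem_unit {y : E4} (hy : y ≠ 0) : ‖y‖⁻¹ • y ∈ sphere (0 : E4) 1 := by
  simp [norm_smul, hy]

namespace IsSphereMap
variable {g : E4 → E4}

theorem apply_normalize (hg : IsSphereMap g) {y : E4} (hy : y ≠ 0) : g (‖y‖⁻¹ • y) = g y :=
  hg.homog _ (inv_pos.2 (norm_pos_iff.2 hy)) y

theorem mem_image (hg : IsSphereMap g) {y : E4} (hy : y ≠ 0) : g y ∈ g '' sphere 0 1 :=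
  ⟨_, normalize_mem_unit hy, hg.apply_normalize hy⟩

theorem continuousAt (hg : IsSphereMap g) {y : E4} (hy : y ≠ 0) : ContinuousAt g y :=
  (hg.smooth y hy).continuousAt

theorem hasFDerivAt (hg : IsSphereMap g) {y : E4} (hy : y ≠ 0) : HasFDerivAt g (fderiv ℝ g y) y :=
  ((hg.smooth y hy).differentiableAt (by simp)).hasFDerivAt

theorem isCompact_image (hg : IsSphereMap g) : IsCompact (g '' sphere 0 1) :=
  (isCompact_sphere _ _).image_of_continuousOn fun _ hx =>
    (hg.continuousAt (ne_zero_of_mem_unit hx)).continuousWithinAt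

theorem fderiv_self (hg : IsSphereMap g) {y : E4} (hy : y ≠ 0) : fderiv ℝ g y y = 0 := by
  have h1 : HasDerivAt (fun t : ℝ => t • y) y 1 := by
    simpa using (hasDerivAt_id (1 : ℝ)).smul_const y
  have h2 : HasDerivAt (fun t : ℝ => g (t • y)) (fderiv ℝ g y y) 1 := by
    have h3 := hg.hasFDerivAt hy
    exact HasFDerivAt.comp_hasDerivAt (1 : ℝ) (by simpa using h3) h1
  have h3 : HasDerivAt (fun t : ℝ => g (t • y)) 0 1 := by
    refine (hasDerivAt_const (1 : ℝ) (g y)).congr_of_eventuallyEq ?_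
    filter_upwards [lt_mem_nhds one_pos] with t ht using hg.homog t ht y
  exact h2.unique h3

theorem exists_transversal (hg : IsSphereMap g) {x : E4} (hx : x ∈ sphere (0 : E4) 1) :
    ∃ ν, ν ∉ range (fderiv ℝ g x) := by
  by_contra! h
  have hs : Function.Surjective (fderiv ℝ g x : E4 →ₗ[ℝ] E4) := h
  have hi := LinearMap.injective_iff_surjective.2 hs
  have := hi (a₁ := x) (a₂ := 0) (by
    simpa using hg.fderiv_self (ne_zero_of_mem_unit hx))
  exact ne_zero_of_mem_unit hx this

theorem eq_zero_of_transversal (hg : IsSphereMap g) {x : E4} (hx : x ∈ sphere (0 : E4) 1) {ν : E4}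
    (hν : ν ∉ range (fderiv ℝ g x)) {c : ℝ} {v : E4} (h : fderiv ℝ g x v + c • ν = 0)
    (hc : c = 0 → inner ℝ x v = 0) : v = 0 := by
  by_cases hc0 : c = 0
  · exact hg.immersive x hx v (hc hc0) (by simpa [hc0] using h)
  · exfalso
    refine hν ⟨-(c⁻¹ • v), ?_⟩
    rw [map_neg, map_smul, eq_neg_iff_add_eq_zero.2 h, smul_neg, neg_neg, smul_smul,
      inv_mul_cancel₀ hc0, one_smul]

theorem sub_const (hg : IsSphereMap g) (q : E4) : IsSphereMap fun y => g y - q where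
  smooth y hy := (hg.smooth y hy).sub contDiffAt_const
  homog c hc y := by simp only [hg.homog c hc y]
  inj x hx y hy h := hg.inj hx hy (sub_left_injective h)
  immersive x hx v hv h := hg.immersive x hx v hv (by rwa [fderiv_sub_const] at h)

end IsSphereMap

theorem hasFDerivAt_norm_of_mem_unit {x : E4} (hx : x ∈ sphere (0 : E4) 1) :
    HasFDerivAt (fun y : E4 => ‖y‖) (innerSL ℝ x) x := by
  have hx0 := ne_zero_of_mem_unit hx
  have hx1 := norm_of_mem_unit hx
  have h1 := ((contDiffAt_norm ℝ hx0).differentiableAt (n := 1) (by simp)).hasFDerivAt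
  refine h1.congr_fderiv ?_
  have h2 := (hasStrictFDerivAt_norm_sq x).hasFDerivAt
  have h3 := h1.pow 2
  have h4 := h3.unique h2
  ext v
  have h5 := congrArg (fun L => L v) h4
  simp [hx1] at h5
  simpa using h5

/-- A smooth map with injective derivative is injective, with a smooth inverse, near a point. -/
theorem exists_localInverse {Q : E4 → E4} {x : E4} (hQ : ContDiffAt ℝ ∞ Q x)
    (hinj : ∀ v, fderiv ℝ Q x v = 0 → v = 0) :
    ∃ L : E4 → E4, ContDiffAt ℝ ∞ L (Q x) ∧ L (Q x) = x ∧ (∀ᶠ y in 𝓝 x, L (Q y) = y) ∧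
      (∀ᶠ w in 𝓝 (Q x), Q (L w) = w) := by
  have hne : (∞ : WithTop ℕ∞) ≠ 0 := by simp
  have hi : Function.Injective (fderiv ℝ Q x : E4 →ₗ[ℝ] E4) :=
    (injective_iff_map_eq_zero _).2 hinj
  let e : E4 ≃L[ℝ] E4 := ContinuousLinearEquiv.ofBijective (fderiv ℝ Q x)
    (LinearMap.ker_eq_bot.2 hi) (LinearMap.range_eq_top.2 (LinearMap.injective_iff_surjective.1 hi))
  have he : HasFDerivAt Q (e : E4 →L[ℝ] E4) x :=
    (hQ.differentiableAt hne).hasFDerivAt.congr_fderiv (by ext1; rfl)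
  have hs : HasStrictFDerivAt Q (e : E4 →L[ℝ] E4) x := hQ.hasStrictFDerivAt' he hne
  exact ⟨hQ.localInverse he hne, hQ.to_localInverse he hne, hQ.localInverse_apply_image he hne,
    hs.eventually_left_inverse, hs.eventually_right_inverse⟩

namespace IsSphereMap
variable {g : E4 → E4}

/-- The two sides of an embedded sphere near one of its points. -/
theorem exists_sides (hg : IsSphereMap g) {x : E4} (hx : x ∈ sphere (0 : E4) 1) {ν : E4}
    (hν : ν ∉ range (fderiv ℝ g x)) :
    ∃ δ > 0, (∀ y ∈ ball x δ, y ≠ 0) ∧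
      (∀ y ∈ ball x δ, ∀ t : ℝ, t ≠ 0 → |t| < δ → g y + t • ν ∉ g '' sphere 0 1) ∧
      ∀ᶠ w in 𝓝 (g x), ∃ y ∈ ball x δ, ∃ t : ℝ, |t| < δ ∧ w = g y + t • ν := by
  have hx0 := ne_zero_of_mem_unit hx
  have hx1 := norm_of_mem_unit hx
  set Q : E4 → E4 := fun y => g y + (‖y‖ - 1) • ν with hQ
  have hQs : ContDiffAt ℝ ∞ Q x := (hg.smooth x hx0).add
    (((contDiffAt_norm ℝ hx0).sub contDiffAt_const).smul contDiffAt_const)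
  have hQx : Q x = g x := by simp [hQ, hx1]
  have hnorm := hasFDerivAt_norm_of_mem_unit hx
  have hQd : HasFDerivAt Q (fderiv ℝ g x + (innerSL ℝ x).smulRight ν) x :=
    (hg.hasFDerivAt hx0).add ((hnorm.sub_const 1).smul_const ν)
  obtain ⟨L, hLs, hLx, hLQ, hQL⟩ := exists_localInverse hQs (fun v hv => by
    rw [hQd.fderiv] at hv
    refine hg.eq_zero_of_transversal hx hν (c := inner ℝ x v) (by simpa using hv) id)
  obtain ⟨U, hUL, hUo, hxU⟩ := _root_.eventually_nhds_iff.1 hLQ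
  set C := g '' (sphere 0 1 \ U)
  have hCc : IsClosed C := by
    refine IsCompact.isClosed (((isCompact_sphere (0 : E4) 1).diff hUo).image_of_continuousOn ?_)
    exact fun z hz => (hg.continuousAt (ne_zero_of_mem_unit hz.1)).continuousWithinAt
  have hxC : g x ∉ C := by
    rintro ⟨z, hz, hzx⟩
    exact hz.2 (hg.inj hz.1 hx hzx ▸ hxU)
  have hV : ∀ᶠ y in 𝓝 x, y ∈ U ∧ Q y ∉ C := by
    refine Filter.Eventually.and (hUo.mem_nhds hxU) ?_
    refine hQs.continuousAt.eventually (hCc.isOpen_compl.mem_nhds ?_)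
    rw [hQx]; exact hxC
  have hc : ContinuousAt (fun p : E4 × ℝ => (1 + p.2) • (‖p.1‖⁻¹ • p.1)) (x, 0) := by
    have h1 : ContinuousAt (fun p : E4 × ℝ => ‖p.1‖⁻¹) (x, 0) :=
      ContinuousAt.inv₀ (by fun_prop) (by simp [hx1])
    have h2 : ContinuousAt (fun p : E4 × ℝ => 1 + p.2) (x, 0) := by fun_prop
    exact h2.smul (h1.smul continuousAt_fst)
  have hc' : Filter.Tendsto (fun p : E4 × ℝ => (1 + p.2) • (‖p.1‖⁻¹ • p.1)) (𝓝 (x, 0)) (𝓝 x) := by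
    simpa [ContinuousAt, hx1] using hc
  obtain ⟨δ₀, hδ₀, hδV⟩ := Metric.eventually_nhds_iff_ball.1 (hc'.eventually hV)
  set δ := min δ₀ (1 / 2)
  have hδpos : 0 < δ := lt_min hδ₀ (by norm_num)
  have hy0 : ∀ y ∈ ball x δ, y ≠ 0 := by
    rintro y hy rfl
    rw [mem_ball, dist_zero_left, hx1] at hy
    linarith [min_le_right δ₀ (1 / 2)]
  refine ⟨δ, hδpos, hy0, ?_, ?_⟩
  · rintro y hy t ht htδ ⟨z, hz, hzt⟩
    have ht1 : 0 < 1 + t := by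
      have := (abs_lt.1 htδ).1; linarith [min_le_right δ₀ (1 / 2)]
    have hmem : (y, t) ∈ ball (x, (0 : ℝ)) δ₀ := by
      rw [mem_ball, Prod.dist_eq]
      exact max_lt (lt_of_lt_of_le hy (min_le_left _ _))
        (by simpa using lt_of_lt_of_le htδ (min_le_left _ _))
    obtain ⟨hU', hC'⟩ := hδV _ hmem
    have hQe : Q ((1 + t) • (‖y‖⁻¹ • y)) = g y + t • ν := by
      have h1 : ‖(1 + t) • (‖y‖⁻¹ • y)‖ = 1 + t := by
        rw [norm_smul, norm_of_mem_unit (normalize_mem_unit (hy0 y hy)), Real.norm_eq_abs,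
          abs_of_pos ht1, mul_one]
      simp only [hQ, hg.homog _ ht1, hg.apply_normalize (hy0 y hy), h1, add_sub_cancel_left]
    simp only at hU' hC'
    rw [hQe, ← hzt] at hC'
    have hzU : z ∈ U := by
      by_contra h; exact hC' ⟨z, ⟨hz, h⟩, rfl⟩
    have h1 := hUL _ hU'
    have h2 := hUL _ hzU
    have hQz : Q z = g z := by simp [hQ, norm_of_mem_unit hz]
    rw [hQe, ← hzt] at h1
    rw [hQz, h1] at h2
    have h3 := congrArg norm h2
    rw [norm_smul, norm_of_mem_unit (normalize_mem_unit (hy0 y hy)), norm_of_mem_unit hz,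
      Real.norm_eq_abs, abs_of_pos ht1] at h3
    exact ht (by linarith)
  · have h1 : Filter.Tendsto L (𝓝 (g x)) (𝓝 x) := by
      have := hLs.continuousAt.tendsto
      rwa [hLx, hQx] at this
    rw [hQx] at hQL
    have h2 : ∀ᶠ y in 𝓝 x, y ∈ ball x δ ∧ |‖y‖ - 1| < δ := by
      refine Filter.Eventually.and (ball_mem_nhds x hδpos) ?_
      have h3 : ContinuousAt (fun y : E4 => |‖y‖ - 1|) x := by fun_prop
      exact h3.eventually (gt_mem_nhds (by simpa [hx1] using hδpos))
    filter_upwards [hQL, h1.eventually h2] with w hw hLw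
    exact ⟨L w, hLw.1, ‖L w‖ - 1, hLw.2, hw.symm⟩

/-- Every point of an embedded sphere is accessible from the component of the origin in the
complement. -/
theorem exists_side_mem_component (hg : IsSphereMap g) (h0 : (0 : E4) ∉ g '' sphere 0 1) {x : E4}
    (hx : x ∈ sphere (0 : E4) 1) {ν : E4} (hν : ν ∉ range (fderiv ℝ g x)) :
    ∃ δ > 0, (∀ t : ℝ, t ≠ 0 → |t| < δ → g x + t • ν ∉ g '' sphere 0 1) ∧
      ((∀ t ∈ Ioo 0 δ, g x + t • ν ∈ connectedComponentIn (g '' sphere 0 1)ᶜ 0) ∨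
       (∀ t ∈ Ioo 0 δ, g x - t • ν ∈ connectedComponentIn (g '' sphere 0 1)ᶜ 0)) := by
  set P := g '' sphere 0 1
  set A := connectedComponentIn Pᶜ 0
  have hPc : IsClosed P := hg.isCompact_image.isClosed
  have hAo : IsOpen A := hPc.isOpen_compl.connectedComponentIn
  have hAP : A ⊆ Pᶜ := connectedComponentIn_subset _ _
  have h0A : (0 : E4) ∈ A := mem_connectedComponentIn h0
  have key : ∀ x ∈ sphere (0 : E4) 1, ∀ ν ∉ range (fderiv ℝ g x), g x ∈ closure A →
      ∃ δ > 0, (∀ t : ℝ, t ≠ 0 → |t| < δ → g x + t • ν ∉ P) ∧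
        ((∀ y ∈ ball x δ, y ≠ 0 ∧ ∀ t ∈ Ioo 0 δ, g y + t • ν ∈ A) ∨
         (∀ y ∈ ball x δ, y ≠ 0 ∧ ∀ t ∈ Ioo 0 δ, g y + (-t) • ν ∈ A)) := by
    intro x hx ν hν hxA
    obtain ⟨δ, hδ, hy0, hside, hnhds⟩ := hg.exists_sides hx hν
    refine ⟨δ, hδ, fun t => hside x (mem_ball_self hδ) t, ?_⟩
    obtain ⟨a, haA, y₁, hy₁, t₁, ht₁, rfl⟩ : ∃ w ∈ A, ∃ y ∈ ball x δ, ∃ t : ℝ, |t| < δ ∧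
        w = g y + t • ν := by
      obtain ⟨w, hw, hwA⟩ := mem_closure_iff_nhds.1 hxA _ hnhds
      exact ⟨w, hwA, hw⟩
    have hσ : ∀ σ : ℝ, |σ| = 1 → 0 < σ * t₁ →
        ∀ y ∈ ball x δ, y ≠ 0 ∧ ∀ t ∈ Ioo 0 δ, g y + (σ * t) • ν ∈ A := by
      intro σ hσ hσt y hy
      refine ⟨hy0 y hy, fun t ht => ?_⟩
      have hσ2 : σ * σ = 1 := by rw [← abs_mul_abs_self, hσ, one_mul]
      set W := (fun p : E4 × ℝ => g p.1 + (σ * p.2) • ν) '' (ball x δ ×ˢ Ioo 0 δ)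
      have hW : IsPreconnected W := by
        refine ((convex_ball x δ).isPreconnected.prod isPreconnected_Ioo).image _ ?_
        rintro ⟨y, t⟩ ⟨hy, -⟩
        refine ContinuousAt.continuousWithinAt (ContinuousAt.add ?_ (by fun_prop))
        exact (hg.continuousAt (hy0 y hy)).comp (f := Prod.fst) continuousAt_fst
      have hWP : W ⊆ Pᶜ := by
        rintro _ ⟨⟨y, t⟩, ⟨hy, ht⟩, rfl⟩
        refine hside y hy _ ?_ ?_
        · exact mul_ne_zero (fun h => by simp [h] at hσ) ht.1.ne'
        · rw [abs_mul, hσ, one_mul, abs_of_pos ht.1]; exact ht.2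
      have ha : g y₁ + t₁ • ν ∈ W := by
        refine ⟨(y₁, σ * t₁), ⟨hy₁, hσt, ?_⟩, ?_⟩
        · have : |σ * t₁| < δ := by rwa [abs_mul, hσ, one_mul]
          rwa [abs_of_pos hσt] at this
        · simp only [← mul_assoc, hσ2, one_mul]
      have hsub := hW.subset_connectedComponentIn ha hWP
      have hAe : A = connectedComponentIn Pᶜ (g y₁ + t₁ • ν) := connectedComponentIn_eq haA
      rw [hAe]
      exact hsub ⟨(y, t), ⟨hy, ht⟩, rfl⟩
    have ht1 : t₁ ≠ 0 := by
      rintro rfl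
      refine hAP haA ?_
      rw [zero_smul, add_zero]
      exact hg.mem_image (hy0 y₁ hy₁)
    rcases lt_or_gt_of_ne ht1 with h | h
    · right; simpa using hσ (-1) (by simp) (by linarith)
    · left; simpa using hσ 1 (by simp) (by linarith)
  have hZ : ∀ x ∈ sphere (0 : E4) 1, g x ∈ closure A := by
    have hS : IsPreconnected (sphere (0 : E4) 1) := isPreconnected_sphere (by
      rw [← Module.finrank_eq_rank]; simp) 0 1
    have hne : ∃ x ∈ sphere (0 : E4) 1, g x ∈ closure A := by
      by_contra! h
      have hcl : closure A ⊆ Pᶜ := by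
        rintro w hw ⟨x, hx, rfl⟩
        exact h x hx hw
      have hcA : closure A ⊆ A := isPreconnected_connectedComponentIn.closure
        |>.subset_connectedComponentIn (subset_closure h0A) hcl
      have hcl : IsClopen A := ⟨isClosed_of_closure_subset hcA, hAo⟩
      have hu := hcl.eq_univ ⟨0, h0A⟩
      obtain ⟨x, hx⟩ : (sphere (0 : E4) 1).Nonempty := NormedSpace.sphere_nonempty.2 zero_le_one
      exact hAP (hu ▸ mem_univ (g x)) ⟨x, hx, rfl⟩
    obtain ⟨x₁, hx₁, hx₁A⟩ := hne
    let p : E4 → E4 → Prop := fun x y => g x ∈ closure A ↔ g y ∈ closure A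
    intro x hx
    refine (hS.induction₂' p (fun x hx => ?_) (fun _ _ _ _ _ _ => Iff.trans) hx₁ hx).1 hx₁A
    by_cases hxA : g x ∈ closure A
    · obtain ⟨ν, hν⟩ := hg.exists_transversal hx
      obtain ⟨δ, hδ, -, hside⟩ := key x hx ν hν hxA
      have hlim : ∀ y (σ : ℝ), (∀ t ∈ Ioo 0 δ, g y + (σ * t) • ν ∈ A) → g y ∈ closure A := by
        intro y σ hy
        have hc : Filter.Tendsto (fun t : ℝ => g y + (σ * t) • ν) (𝓝[>] 0) (𝓝 (g y)) := by
          have : Continuous fun t : ℝ => g y + (σ * t) • ν := by fun_prop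
          simpa using (this.tendsto 0).mono_left nhdsWithin_le_nhds
        refine mem_closure_of_tendsto hc ?_
        filter_upwards [Ioo_mem_nhdsGT hδ] with t ht using hy t ht
      have : ∀ᶠ y in 𝓝[sphere 0 1] x, g y ∈ closure A := by
        filter_upwards [nhdsWithin_le_nhds (ball_mem_nhds x hδ)] with y hy
        rcases hside with h | h
        · exact hlim y 1 (by simpa using (h y hy).2)
        · exact hlim y (-1) (by simpa using (h y hy).2)
      filter_upwards [this] with y hy
      exact ⟨⟨fun _ => hy, fun _ => hxA⟩, ⟨fun _ => hxA, fun _ => hy⟩⟩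
    · have : ∀ᶠ y in 𝓝[sphere 0 1] x, g y ∉ closure A :=
        nhdsWithin_le_nhds ((hg.continuousAt (ne_zero_of_mem_unit hx)).eventually
          (isClosed_closure.isOpen_compl.mem_nhds hxA))
      filter_upwards [this] with y hy
      exact ⟨⟨fun h => absurd h hxA, fun h => absurd h hy⟩,
        ⟨fun h => absurd h hy, fun h => absurd h hxA⟩⟩
  obtain ⟨δ, hδ, h1, h2⟩ := key x hx ν hν (hZ x hx)
  refine ⟨δ, hδ, h1, h2.imp (fun h => (h x (mem_ball_self hδ)).2) fun h t ht => ?_⟩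
  simpa [sub_eq_add_neg] using (h x (mem_ball_self hδ)).2 t ht

end IsSphereMap

theorem Isot.isCompact {A B : Set E4} (h : Isot A B) (hA : IsCompact A) : IsCompact B := by
  obtain ⟨F, hF, rfl⟩ := h
  refine hA.image ?_
  have := hF.smooth.continuous
  exact this.comp (Continuous.prodMk_right 1)

theorem Isot.zero_notMem {A B : Set E4} (h : Isot A B) (h0 : (0 : E4) ∉ A) : (0 : E4) ∉ B := by
  obtain ⟨F, hF, rfl⟩ := h
  obtain ⟨C, -, h0C, hC⟩ := hF.supp
  rintro ⟨y, hy, hy0⟩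
  rw [← hC 1 0 h0C] at hy0
  exact h0 ((F 1).injective hy0 ▸ hy)

/-- Smooth functions on the punctured space which are constant along rays. -/
structure IsRadiallyConstant (l : E4 → ℝ) : Prop where
  smooth : ∀ y ≠ 0, ContDiffAt ℝ ∞ l y
  homog : ∀ c : ℝ, 0 < c → ∀ y, l (c • y) = l y

/-- The permutation `y ↦ exp (l y) • y`, for `l` constant along rays. -/
def radialPerm (l : E4 → ℝ) (hl : IsRadiallyConstant l) : Equiv.Perm E4 where
  toFun y := Real.exp (l y) • y
  invFun y := Real.exp (-l y) • y
  left_inv y := by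
    simp only [hl.homog _ (Real.exp_pos _), smul_smul, ← Real.exp_add, neg_add_cancel,
      Real.exp_zero,
      one_smul]
  right_inv y := by
    simp only [hl.homog _ (Real.exp_pos _), smul_smul, ← Real.exp_add, add_neg_cancel,
      Real.exp_zero,
      one_smul]

theorem IsRadiallyConstant.const_mul {l : E4 → ℝ} (hl : IsRadiallyConstant l) (s : ℝ) :
    IsRadiallyConstant fun y => s * l y where
  smooth y hy := contDiffAt_const.mul (hl.smooth y hy)
  homog c hc y := by simp only [hl.homog c hc]

@[simp] theorem radialPerm_apply {l : E4 → ℝ} (hl : IsRadiallyConstant l) (y : E4) :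
    radialPerm l hl y = Real.exp (l y) • y := rfl

theorem radialPerm_mem {l : E4 → ℝ} (hl : IsRadiallyConstant l) :
    radialPerm l hl ∈ puncturedDiffeo :=
  ⟨by simp, fun y hy => ((hl.smooth y hy).exp).smul contDiffAt_id,
    fun y hy => ((hl.smooth y hy).neg.exp).smul contDiffAt_id⟩

theorem isot_radialPerm {l : E4 → ℝ} (hl : IsRadiallyConstant l) {A : Set E4} (hA : IsCompact A)
    (h0 : (0 : E4) ∉ A) : Isot A (radialPerm l hl '' A) := by
  have h := isot_of_smooth_family (f := fun s => radialPerm _ (hl.const_mul s))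
    (fun s => radialPerm_mem _) (fun s y hy => ?_) hA h0 0 1
  · simpa using h
  · simp only [radialPerm_apply]
    refine ContDiffAt.smul ((contDiffAt_fst.mul ?_).exp) contDiffAt_snd
    exact (hl.smooth y hy).comp (s, y) contDiffAt_snd

/-- A cutoff function equal to one on a cone about `ν` and to zero off a larger cone. -/
def coneCutoff (ν : E4) (a b : ℝ) (y : E4) : ℝ :=
  Real.smoothTransition ((inner ℝ y ν / ‖y‖ - a) / (b - a))

theorem contDiffAt_inner_div_norm (ν : E4) {y : E4} (hy : y ≠ 0) :
    ContDiffAt ℝ ∞ (fun y : E4 => inner ℝ y ν / ‖y‖) y :=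
  (contDiffAt_id.inner ℝ contDiffAt_const).div (contDiffAt_norm ℝ hy) (norm_ne_zero_iff.2 hy)

theorem isRadiallyConstant_coneCutoff (ν : E4) (a b : ℝ) :
    IsRadiallyConstant (coneCutoff ν a b) where
  smooth y hy := Real.smoothTransition.contDiffAt.comp y
    (((contDiffAt_inner_div_norm ν hy).sub contDiffAt_const).div_const _)
  homog c hc y := by
    simp only [coneCutoff, norm_smul, inner_smul_left, Real.norm_eq_abs, abs_of_pos hc]
    rw [show (starRingEnd ℝ) c = c from rfl, mul_div_mul_left _ _ hc.ne']

theorem coneCutoff_eq_one {ν : E4} {a b : ℝ} (hab : a < b) {y : E4} (hy : y ≠ 0)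
    (h : b * ‖y‖ ≤ inner ℝ y ν) : coneCutoff ν a b y = 1 := by
  refine Real.smoothTransition.one_of_one_le ?_
  rw [one_le_div (sub_pos.2 hab)]
  have := (le_div_iff₀ (norm_pos_iff.2 hy)).2 h
  linarith

theorem coneCutoff_eq_zero {ν : E4} {a b : ℝ} (hab : a < b) {y : E4} (hy : y ≠ 0)
    (h : inner ℝ y ν ≤ a * ‖y‖) : coneCutoff ν a b y = 0 := by
  refine Real.smoothTransition.zero_of_nonpos (div_nonpos_of_nonpos_of_nonneg ?_ (sub_pos.2 hab).le)
  have := (div_le_iff₀ (norm_pos_iff.2 hy)).2 h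
  linarith

/-- The product of a cone cutoff with a function that is only controlled in the cone. -/
theorem isRadiallyConstant_coneCutoff_mul {ν : E4} {a b c : ℝ} (hca : c < a) (hab : a < b)
    {l : E4 → ℝ} (hl : ∀ y ≠ 0, c * ‖y‖ < inner ℝ y ν → ContDiffAt ℝ ∞ l y)
    (hh : ∀ c : ℝ, 0 < c → ∀ y, l (c • y) = l y) :
    IsRadiallyConstant fun y => coneCutoff ν a b y * l y where
  smooth y hy := by
    by_cases h : c * ‖y‖ < inner ℝ y ν
    · exact ((isRadiallyConstant_coneCutoff ν a b).smooth y hy).mul (hl y hy h)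
    · have h1 : inner ℝ y ν < a * ‖y‖ :=
        (not_lt.1 h).trans_lt (mul_lt_mul_of_pos_right hca (norm_pos_iff.2 hy))
      have h2 : ∀ᶠ z in 𝓝 y, z ≠ 0 ∧ inner ℝ z ν < a * ‖z‖ := by
        refine Filter.Eventually.and (isOpen_ne.mem_nhds hy) ?_
        refine (IsOpen.mem_nhds (s := {z : E4 | inner ℝ z ν < a * ‖z‖}) ?_ h1)
        exact isOpen_lt (by fun_prop) (by fun_prop)
      refine (contDiffAt_const (c := (0 : ℝ))).congr_of_eventuallyEq ?_
      filter_upwards [h2] with z hz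
      rw [coneCutoff_eq_zero hab hz.1 hz.2.le, zero_mul]
  homog c hc y := by
    simp only [(isRadiallyConstant_coneCutoff ν a b).homog c hc, hh c hc]

section Boost
variable (ν : E4)

/-- The time component of the image of a null vector under a boost. -/
def boostTime (s : ℝ) (y : E4) : ℝ := ‖y‖ * Real.cosh s + inner ℝ y ν * Real.sinh s

/-- The space component of the image of a null vector under a boost. -/
def boostSpace (s : ℝ) (y : E4) : E4 :=
  y + (inner ℝ y ν * (Real.cosh s - 1) + ‖y‖ * Real.sinh s) • ν

/-- The conformal action of a boost on directions, extended to preserve norms. -/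
def boost (s : ℝ) (y : E4) : E4 := (‖y‖ / boostTime ν s y) • boostSpace ν s y

variable {ν}

theorem inner_boostSpace (hν : ‖ν‖ = 1) (s : ℝ) (y : E4) :
    inner ℝ (boostSpace ν s y) ν = inner ℝ y ν * Real.cosh s + ‖y‖ * Real.sinh s := by
  simp only [boostSpace, inner_add_left, inner_smul_left, real_inner_self_eq_norm_sq, hν]
  rw [show ∀ x : ℝ, (starRingEnd ℝ) x = x from fun _ => rfl]
  ring

theorem boostTime_pos (hν : ‖ν‖ = 1) (s : ℝ) {y : E4} (hy : y ≠ 0) : 0 < boostTime ν s y := by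
  have h1 : |inner ℝ y ν| ≤ ‖y‖ := by simpa [hν] using abs_real_inner_le_norm y ν
  have hn : 0 < ‖y‖ := norm_pos_iff.2 hy
  have h2 := Real.exp_pos s
  have h3 := Real.exp_pos (-s)
  have h4 := abs_le.1 h1
  rw [boostTime, Real.cosh_eq, Real.sinh_eq]
  have : ‖y‖ * ((Real.exp s + Real.exp (-s)) / 2) + inner ℝ y ν * ((Real.exp s - Real.exp (-s)) / 2)
    = ((‖y‖ + inner ℝ y ν) * Real.exp s + (‖y‖ - inner ℝ y ν) * Real.exp (-s)) / 2 := by ring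
  rw [this]
  rcases lt_or_ge (inner ℝ y ν) 0 with h | h
  · have := mul_pos (show 0 < ‖y‖ - inner ℝ y ν by linarith) h3
    have := mul_nonneg (show 0 ≤ ‖y‖ + inner ℝ y ν by linarith) h2.le
    linarith
  · have := mul_pos (show 0 < ‖y‖ + inner ℝ y ν by linarith) h2
    have := mul_nonneg (show 0 ≤ ‖y‖ - inner ℝ y ν by linarith) h3.le
    linarith

theorem norm_boostSpace (hν : ‖ν‖ = 1) (s : ℝ) (y : E4) :
    ‖boostSpace ν s y‖ = boostTime ν s y := by
  rcases eq_or_ne y 0 with rfl | hy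
  · simp [boostSpace, boostTime]
  rw [← sq_eq_sq₀ (norm_nonneg _) (boostTime_pos hν s hy).le, ← real_inner_self_eq_norm_sq]
  simp only [boostSpace, boostTime, inner_add_left, inner_add_right, inner_smul_left,
    inner_smul_right, real_inner_self_eq_norm_sq, hν, real_inner_comm y ν]
  rw [show ∀ x : ℝ, (starRingEnd ℝ) x = x from fun _ => rfl]
  have := Real.cosh_sq s
  have h2 : Real.cosh s ^ 2 = Real.sinh s ^ 2 + 1 := this
  generalize Real.cosh s = C at *
  generalize Real.sinh s = S at *
  rw [real_inner_comm ν y]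
  linear_combination (inner ℝ ν y ^ 2 - ‖y‖ ^ 2) * h2

theorem norm_boost (hν : ‖ν‖ = 1) (s : ℝ) (y : E4) : ‖boost ν s y‖ = ‖y‖ := by
  rcases eq_or_ne y 0 with rfl | hy
  · simp [boost]
  have h := boostTime_pos hν s hy
  rw [boost, norm_smul, norm_boostSpace hν, norm_div, norm_norm, Real.norm_eq_abs, abs_of_pos h,
    div_mul_cancel₀ _ h.ne']

theorem inner_boost (hν : ‖ν‖ = 1) (s : ℝ) (y : E4) :
    inner ℝ (boost ν s y) ν =
      ‖y‖ / boostTime ν s y * (inner ℝ y ν * Real.cosh s + ‖y‖ * Real.sinh s) := by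
  rw [boost, inner_smul_left, inner_boostSpace hν]; rfl

theorem boost_neg_boost (hν : ‖ν‖ = 1) (s : ℝ) (y : E4) : boost ν (-s) (boost ν s y) = y := by
  rcases eq_or_ne y 0 with rfl | hy
  · simp [boost]
  have hT := boostTime_pos hν s hy
  have hcs : Real.cosh s ^ 2 = Real.sinh s ^ 2 + 1 := Real.cosh_sq s
  have h1 : boostTime ν (-s) (boost ν s y) = ‖y‖ * ‖y‖ / boostTime ν s y := by
    rw [boostTime, norm_boost hν, inner_boost hν, Real.cosh_neg, Real.sinh_neg, eq_div_iff hT.ne']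
    field_simp
    rw [boostTime]
    linear_combination ‖y‖ * hcs
  have h2 : boostSpace ν (-s) (boost ν s y) = (‖y‖ / boostTime ν s y) • y := by
    rw [boostSpace, norm_boost hν, inner_boost hν, boost, boostSpace, smul_add, smul_smul,
      add_assoc,
      ← add_smul, Real.cosh_neg, Real.sinh_neg]
    convert add_zero _ using 2
    convert zero_smul ℝ ν using 2
    field_simp
    rw [boostTime]
    linear_combination ‖y‖ * inner ℝ y ν * hcs
  rw [boost, h1, h2, norm_boost hν, smul_smul]
  convert one_smul ℝ y using 2
  field_simp

/-- The boost as a permutation. -/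
def boostPerm (hν : ‖ν‖ = 1) (s : ℝ) : Equiv.Perm E4 where
  toFun := boost ν s
  invFun := boost ν (-s)
  left_inv := boost_neg_boost hν s
  right_inv y := by simpa using boost_neg_boost hν (-s) y

theorem contDiffAt_boost (hν : ‖ν‖ = 1) (s : ℝ) {y : E4} (hy : y ≠ 0) :
    ContDiffAt ℝ ∞ (fun p : ℝ × E4 => boost ν p.1 p.2) (s, y) := by
  have h1 : ContDiffAt ℝ ∞ (fun p : ℝ × E4 => ‖p.2‖) (s, y) :=
    (contDiffAt_norm ℝ hy).comp (s, y) contDiffAt_snd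
  have h2 : ContDiffAt ℝ ∞ (fun p : ℝ × E4 => inner ℝ p.2 ν) (s, y) :=
    contDiffAt_snd.inner ℝ contDiffAt_const
  have h3 : ContDiffAt ℝ ∞ (fun p : ℝ × E4 => Real.cosh p.1) (s, y) :=
    Real.contDiff_cosh.contDiffAt.comp (s, y) contDiffAt_fst
  have h4 : ContDiffAt ℝ ∞ (fun p : ℝ × E4 => Real.sinh p.1) (s, y) :=
    Real.contDiff_sinh.contDiffAt.comp (s, y) contDiffAt_fst
  have hT := (boostTime_pos hν s hy).ne'
  exact (h1.div ((h1.mul h3).add (h2.mul h4)) hT).smul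
    (contDiffAt_snd.add (((h2.mul (h3.sub contDiffAt_const)).add (h1.mul h4)).smul
      contDiffAt_const))

theorem contDiffAt_boost_right (hν : ‖ν‖ = 1) (s : ℝ) {y : E4} (hy : y ≠ 0) :
    ContDiffAt ℝ ∞ (boost ν s) y :=
  (contDiffAt_boost hν s hy).comp y (contDiffAt_const.prodMk contDiffAt_id)

theorem boostPerm_mem (hν : ‖ν‖ = 1) (s : ℝ) : boostPerm hν s ∈ puncturedDiffeo :=
  ⟨by simp [boostPerm, boost], fun _ hy => contDiffAt_boost_right hν s hy,
    fun _ hy => contDiffAt_boost_right hν (-s) hy⟩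

theorem isot_boost (hν : ‖ν‖ = 1) (s : ℝ) {A : Set E4} (hA : IsCompact A) (h0 : (0 : E4) ∉ A) :
    Isot A (boost ν s '' A) := by
  have h := isot_of_smooth_family (f := fun s => boostPerm hν s)
    (fun s => boostPerm_mem hν s) (fun s y hy => contDiffAt_boost hν s hy) hA h0 0 s
  have h0 : (boostPerm hν 0 : E4 → E4) '' A = A := by
    have : ∀ y : E4, boostPerm hν 0 y = y := by
      intro y
      rcases eq_or_ne y 0 with rfl | hy
      · simp [boostPerm, boost]
      · simp [boostPerm, boost, boostTime, boostSpace, hy]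
    simp [this]
  rw [h0] at h
  exact h

/-- Boosts move a whole half-space into a narrow cone. -/
theorem inner_boost_neg_lt (hν : ‖ν‖ = 1) {s c : ℝ} (hs : 0 ≤ s) (hc : Real.exp (-s) < 1 - c)
    {y : E4} (hy : y ≠ 0) (h : inner ℝ y ν ≤ 0) :
    c * ‖boost ν (-s) y‖ < inner ℝ (boost ν (-s) y) (-ν) := by
  have hT := boostTime_pos hν (-s) hy
  have hn : 0 < ‖y‖ := norm_pos_iff.2 hy
  rw [norm_boost hν, inner_neg_right, inner_boost hν, div_mul_eq_mul_div, ← neg_div,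
    lt_div_iff₀ hT]
  rw [mul_comm c, mul_assoc, ← mul_neg]
  refine mul_lt_mul_of_pos_left ?_ hn
  have h1 : ‖y‖ ≤ boostTime ν (-s) y := by
    rw [boostTime, Real.cosh_neg, Real.sinh_neg]
    nlinarith [Real.one_le_cosh s, Real.sinh_nonneg_iff.2 hs]
  have h2 : boostTime ν (-s) y + (inner ℝ y ν * Real.cosh (-s) + ‖y‖ * Real.sinh (-s)) =
      (‖y‖ + inner ℝ y ν) * Real.exp (-s) := by
    rw [← Real.cosh_add_sinh, boostTime]; ring
  nlinarith [Real.exp_pos (-s)]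

/-- Boosts move the complement of a narrow cone into a narrow opposite cone. -/
theorem lt_inner_boost (hν : ‖ν‖ = 1) {s c η : ℝ} (hs : 0 ≤ s) (hc0 : 0 ≤ c) (hc1 : c < 1)
    (hc : 2 * Real.exp (-s) < η * (1 - c))
    {y : E4} (hy : y ≠ 0) (h : -(c * ‖y‖) ≤ inner ℝ y ν) :
    (1 - η) * ‖boost ν s y‖ < inner ℝ (boost ν s y) ν := by
  have hT := boostTime_pos hν s hy
  have hn : 0 < ‖y‖ := norm_pos_iff.2 hy
  rw [norm_boost hν, inner_boost hν, div_mul_eq_mul_div, lt_div_iff₀ hT]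
  rw [mul_comm (1 - η), mul_assoc]
  refine mul_lt_mul_of_pos_left ?_ hn
  have hsh := Real.sinh_nonneg_iff.2 hs
  have hch := Real.one_le_cosh s
  have hcs : Real.sinh s ≤ Real.cosh s := (Real.sinh_lt_cosh s).le
  have h1 : ‖y‖ * (1 - c) ≤ boostTime ν s y := by
    rw [boostTime]
    have h3 : -(c * ‖y‖) * Real.sinh s ≤ inner ℝ y ν * Real.sinh s :=
      mul_le_mul_of_nonneg_right h hsh
    have h4 : c * ‖y‖ * Real.sinh s ≤ c * ‖y‖ * Real.cosh s :=
      mul_le_mul_of_nonneg_left hcs (by positivity)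
    have h5 : ‖y‖ * (1 - c) * 1 ≤ ‖y‖ * (1 - c) * Real.cosh s :=
      mul_le_mul_of_nonneg_left hch (mul_nonneg hn.le (by linarith))
    linarith
  have h2 : boostTime ν s y - (inner ℝ y ν * Real.cosh s + ‖y‖ * Real.sinh s) =
      (‖y‖ - inner ℝ y ν) * Real.exp (-s) := by
    rw [← Real.cosh_sub_sinh, boostTime]; ring
  have h3 : ‖y‖ - inner ℝ y ν ≤ 2 * ‖y‖ := by
    have := neg_le_of_abs_le (abs_real_inner_le_norm y ν)
    rw [hν, mul_one] at this; linarith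
  have h4 : (‖y‖ - inner ℝ y ν) * Real.exp (-s) ≤ 2 * ‖y‖ * Real.exp (-s) :=
    mul_le_mul_of_nonneg_right h3 (Real.exp_pos _).le
  have hη : 0 < η := by
    by_contra! hη
    nlinarith [Real.exp_pos (-s)]
  have h5 : η * (‖y‖ * (1 - c)) ≤ η * boostTime ν s y := mul_le_mul_of_nonneg_left h1 hη.le
  nlinarith

end Boost

/-- A local inverse that is smooth near the image of the base point. -/
theorem exists_smooth_localInverse {Q : E4 → E4} {x : E4} (hQ : ∀ᶠ y in 𝓝 x, ContDiffAt ℝ ∞ Q y)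
    (hinj : ∀ v, fderiv ℝ Q x v = 0 → v = 0) :
    ∃ L : E4 → E4, (∀ᶠ w in 𝓝 (Q x), ContDiffAt ℝ ∞ L w) ∧ L (Q x) = x ∧
      (∀ᶠ y in 𝓝 x, L (Q y) = y) ∧ (∀ᶠ w in 𝓝 (Q x), Q (L w) = w) := by
  have hne : (∞ : WithTop ℕ∞) ≠ 0 := by simp
  have hQx := hQ.self_of_nhds
  have hi : Function.Injective (fderiv ℝ Q x : E4 →ₗ[ℝ] E4) :=
    (injective_iff_map_eq_zero _).2 hinj
  let e : E4 ≃L[ℝ] E4 := ContinuousLinearEquiv.ofBijective (fderiv ℝ Q x)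
    (LinearMap.ker_eq_bot.2 hi) (LinearMap.range_eq_top.2 (LinearMap.injective_iff_surjective.1 hi))
  have hee : (e : E4 →L[ℝ] E4) = fderiv ℝ Q x := by ext1; rfl
  have he : HasFDerivAt Q (e : E4 →L[ℝ] E4) x :=
    (hQx.differentiableAt hne).hasFDerivAt.congr_fderiv hee.symm
  let Φ := hQx.toOpenPartialHomeomorph Q he hne
  have hxs : x ∈ Φ.source := hQx.mem_toOpenPartialHomeomorph_source he hne
  have hxt : Q x ∈ Φ.target := Φ.map_source hxs
  have hL : Φ.symm (Q x) = x := Φ.left_inv hxs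
  refine ⟨Φ.symm, ?_, hL, Φ.eventually_left_inverse hxs, Φ.eventually_right_inverse hxt⟩
  have hcont : Filter.Tendsto Φ.symm (𝓝 (Q x)) (𝓝 x) := by
    have := Φ.continuousAt_symm hxt
    rwa [ContinuousAt, hL] at this
  have hequiv : ∀ᶠ y in 𝓝 x, fderiv ℝ Q y ∈ range ((↑) : (E4 ≃L[ℝ] E4) → E4 →L[ℝ] E4) := by
    refine (hQx.continuousAt_fderiv hne).eventually ?_
    rw [← hee]
    exact ContinuousLinearEquiv.nhds e
  filter_upwards [hcont.eventually (hequiv.and hQ), Φ.open_target.mem_nhds hxt] with w hw hwt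
  obtain ⟨⟨e', he'⟩, hwQ⟩ := hw
  refine Φ.contDiffAt_symm (f₀' := e') hwt ?_ hwQ
  rw [he']
  exact (hwQ.differentiableAt hne).hasFDerivAt

/-- A sphere around the origin which meets a ray transversally and only once can be made round near
that ray. -/
theorem IsSphereMap.exists_flattening {g : E4 → E4} (hg : IsSphereMap g)
    (h0 : (0 : E4) ∉ g '' sphere 0 1)
    {x₀ ν : E4} (hx₀ : x₀ ∈ sphere (0 : E4) 1) (hν : ‖ν‖ = 1) {τ : ℝ} (hτ : 0 < τ)
    (hgx : g x₀ = τ • ν) (htr : ν ∉ range (fderiv ℝ g x₀))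
    (honly : ∀ x ∈ sphere (0 : E4) 1, ∀ r : ℝ, 0 < r → g x = r • ν → x = x₀) :
    ∃ η : ℝ, 0 < η ∧ η < 1 ∧ ∃ A : Set E4, Isot (g '' sphere 0 1) A ∧
      ∀ y, (1 - η) * ‖y‖ < inner ℝ y ν → (y ∈ A ↔ ‖y‖ = 1) := by
  have hx0 := ne_zero_of_mem_unit hx₀
  have hx1 := norm_of_mem_unit hx₀
  set Q : E4 → E4 := fun y => ‖y‖ • g y with hQ
  have hQs : ∀ᶠ y in 𝓝 x₀, ContDiffAt ℝ ∞ Q y := by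
    filter_upwards [isOpen_ne.mem_nhds hx0] with y hy
    exact (contDiffAt_norm ℝ hy).smul (hg.smooth y hy)
  have hQx : Q x₀ = τ • ν := by simp [hQ, hx1, hgx]
  have hnorm := hasFDerivAt_norm_of_mem_unit hx₀
  have hQd : HasFDerivAt Q (fderiv ℝ g x₀ + (innerSL ℝ x₀).smulRight (τ • ν)) x₀ := by
    have := hnorm.smul (hg.hasFDerivAt hx0)
    rw [hx1, hgx, one_smul] at this
    exact this
  obtain ⟨L, hLs, hLx, hLQ, hQL⟩ := exists_smooth_localInverse hQs (fun v hv => by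
    rw [hQd.fderiv] at hv
    refine hg.eq_zero_of_transversal hx₀ htr (c := inner ℝ x₀ v * τ)
      (by simpa [smul_smul] using hv) fun h => ?_
    exact (mul_eq_zero.1 h).resolve_right hτ.ne')
  rw [hQx] at hLs hLx hQL
  have hL0 : ∀ᶠ w in 𝓝 (τ • ν), L w ≠ 0 := by
    have : ContinuousAt L (τ • ν) := hLs.self_of_nhds.continuousAt
    exact this.eventually_ne (by rwa [hLx])
  obtain ⟨ρ, hρ, hball⟩ := Metric.eventually_nhds_iff_ball.1 (hLs.and (hQL.and hL0))
  obtain ⟨U, hUL, hUo, hxU⟩ := _root_.eventually_nhds_iff.1 hLQ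
  have hgn : ∀ x ∈ sphere (0 : E4) 1, 0 < ‖g x‖ := fun x hx =>
    norm_pos_iff.2 fun h => h0 ⟨x, hx, h⟩
  -- outside a neighbourhood of `x₀` the sphere stays away from the ray
  obtain ⟨η₁, hη₁, hη₁c⟩ : ∃ η₁ : ℝ, 0 < η₁ ∧ ∀ x ∈ sphere (0 : E4) 1,
      (1 - η₁) * ‖g x‖ < inner ℝ (g x) ν → (τ / ‖g x‖) • x ∈ U := by
    set K := sphere (0 : E4) 1 ∩ {x | (τ / ‖g x‖) • x ∈ U}ᶜ
    have hcg : ContinuousOn g (sphere (0 : E4) 1) := fun x hx =>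
      (hg.continuousAt (ne_zero_of_mem_unit hx)).continuousWithinAt
    have hcK : IsCompact K := by
      have hcm : ContinuousOn (fun x => (τ / ‖g x‖) • x) (sphere (0 : E4) 1) :=
        ContinuousOn.smul (continuousOn_const.div hcg.norm fun x hx => (hgn x hx).ne')
          continuousOn_id
      exact (isCompact_sphere (0 : E4) 1).of_isClosed_subset
        (hcm.preimage_isClosed_of_isClosed isClosed_sphere hUo.isClosed_compl) inter_subset_left
    have hcf : ContinuousOn (fun x => 1 - inner ℝ (g x) ν / ‖g x‖) K := by
      have hcg' := hcg.mono (inter_subset_left : K ⊆ _)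
      exact continuousOn_const.sub ((hcg'.inner continuousOn_const).div hcg'.norm
        fun x hx => (hgn x hx.1).ne')
    have hpos : ∀ x ∈ K, 0 < 1 - inner ℝ (g x) ν / ‖g x‖ := by
      intro x hx
      rw [sub_pos, div_lt_one (hgn x hx.1)]
      refine lt_of_le_of_ne (by simpa [hν] using real_inner_le_norm (g x) ν) fun h => ?_
      have h1 : inner ℝ (g x) ν = ‖g x‖ * ‖ν‖ := by rw [h, hν, mul_one]
      have h2 := inner_eq_norm_mul_iff_real.1 h1
      rw [hν, one_smul] at h2
      have h3 := honly x hx.1 _ (hgn x hx.1) h2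
      refine hx.2 ?_
      rw [h3]
      simpa [hgx, norm_smul, hν, abs_of_pos hτ, div_self hτ.ne'] using hxU
    rcases K.eq_empty_or_nonempty with hKe | hKn
    · refine ⟨1, one_pos, fun x hx _ => ?_⟩
      by_contra h
      exact (hKe ▸ (⟨hx, h⟩ : x ∈ K) : x ∈ (∅ : Set E4))
    · obtain ⟨z, hz, hmin⟩ := hcK.exists_isMinOn hKn hcf
      refine ⟨_, hpos z hz, fun x hx hlt => ?_⟩
      by_contra h
      have h1 := hmin (⟨hx, h⟩ : x ∈ K)
      simp only [mem_ofPred_eq] at h1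
      have h2 : 1 - (1 - inner ℝ (g z) ν / ‖g z‖) < inner ℝ (g x) ν / ‖g x‖ := by
        rwa [lt_div_iff₀ (hgn x hx)]
      linarith
  set η₀ := min (min η₁ (ρ ^ 2 / (2 * τ ^ 2))) (1 / 2)
  have hη₀pos : 0 < η₀ := by positivity
  have hcone : ∀ y, y ≠ 0 → (1 - η₀) * ‖y‖ < inner ℝ y ν → (τ / ‖y‖) • y ∈ ball (τ • ν) ρ := by
    intro y hy h
    have hn : 0 < ‖y‖ := norm_pos_iff.2 hy
    rw [mem_ball, dist_eq_norm, ← sq_lt_sq₀ (norm_nonneg _) hρ.le, @norm_sub_sq_real]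
    rw [norm_smul, norm_smul, inner_smul_left, inner_smul_right, hν, Real.norm_eq_abs,
      Real.norm_eq_abs, abs_of_pos (div_pos hτ hn), abs_of_pos hτ, div_mul_cancel₀ _ hn.ne',
      show (starRingEnd ℝ) (τ / ‖y‖) = τ / ‖y‖ from rfl]
    have h1 : 1 - η₀ < inner ℝ y ν / ‖y‖ := by rwa [lt_div_iff₀ hn]
    have h2 : η₀ ≤ ρ ^ 2 / (2 * τ ^ 2) := (min_le_left _ _).trans (min_le_right _ _)
    rw [le_div_iff₀ (by positivity)] at h2
    have h3 : τ / ‖y‖ * (τ * inner ℝ y ν) = τ ^ 2 * (inner ℝ y ν / ‖y‖) := by ring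
    have h4 := mul_lt_mul_of_pos_left h1 (pow_pos hτ 2)
    rw [h3]
    nlinarith
  set G : E4 → ℝ := fun w => Real.log (‖L ((τ / ‖w‖) • w)‖ / τ) with hG
  have hhom : ∀ c : ℝ, 0 < c → ∀ y, G (c • y) = G y := by
    intro c hc y
    simp only [hG, norm_smul, smul_smul, Real.norm_eq_abs, abs_of_pos hc]
    congr 5
    field_simp
  have hGs : ∀ y ≠ 0, (1 - η₀) * ‖y‖ < inner ℝ y ν → ContDiffAt ℝ ∞ G y := by
    intro y hy h
    obtain ⟨hb1, -, hb3⟩ := hball _ (hcone y hy h)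
    have hin : ContDiffAt ℝ ∞ (fun w : E4 => (τ / ‖w‖) • w) y :=
      (contDiffAt_const.div (contDiffAt_norm ℝ hy) (norm_ne_zero_iff.2 hy)).smul contDiffAt_id
    refine ContDiffAt.log (((contDiffAt_norm ℝ hb3).comp y
      (ContDiffAt.comp (g := L) (f := fun w : E4 => (τ / ‖w‖) • w) y hb1 hin)).div_const τ) ?_
    exact (div_pos (norm_pos_iff.2 hb3) hτ).ne'
  have hlam := isRadiallyConstant_coneCutoff_mul (ν := ν) (a := 1 - η₀ / 2) (b := 1 - η₀ / 3)
    (by linarith) (by linarith) hGs hhom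
  set l := fun y => coneCutoff ν (1 - η₀ / 2) (1 - η₀ / 3) y * G y with hl
  refine ⟨η₀ / 3, by positivity, by linarith [min_le_right (min η₁ (ρ ^ 2 / (2 * τ ^ 2))) (1 / 2)],
    radialPerm l hlam '' (g '' sphere 0 1), isot_radialPerm hlam hg.isCompact_image h0, ?_⟩
  intro y hy
  have hy0 : y ≠ 0 := by rintro rfl; simp at hy
  -- the point `w` moved to `y`
  set w := (radialPerm l hlam).symm y with hw
  have hyw : y = Real.exp (l w) • w := by
    rw [← radialPerm_apply hlam, hw, Equiv.apply_symm_apply]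
  have hwy : w = Real.exp (-l y) • y := rfl
  have hw0 : w ≠ 0 := by rw [hwy]; exact smul_ne_zero (Real.exp_pos _).ne' hy0
  have hwn : 0 < ‖w‖ := norm_pos_iff.2 hw0
  have hwc : (1 - η₀ / 3) * ‖w‖ < inner ℝ w ν := by
    rw [hwy, norm_smul, inner_smul_left, Real.norm_eq_abs, abs_of_pos (Real.exp_pos _)]
    have := mul_lt_mul_of_pos_left hy (Real.exp_pos (-l y))
    calc _ = Real.exp (-l y) * ((1 - η₀ / 3) * ‖y‖) := by ring
      _ < _ := this
  have hwc' : (1 - η₀) * ‖w‖ < inner ℝ w ν := by nlinarith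
  obtain ⟨-, hb2, hb3⟩ := hball _ (hcone w hw0 hwc')
  have hlw : l w = G w := by
    rw [hl]; simp only
    rw [coneCutoff_eq_one (by linarith) hw0 hwc.le, one_mul]
  set z := L ((τ / ‖w‖) • w) with hz
  have hzn : 0 < ‖z‖ := norm_pos_iff.2 hb3
  have hyn : ‖y‖ = ‖z‖ / τ * ‖w‖ := by
    rw [hyw, norm_smul, Real.norm_eq_abs, abs_of_pos (Real.exp_pos _), hlw, hG]
    simp only
    rw [Real.exp_log (div_pos hzn hτ)]
  have hmem : y ∈ radialPerm l hlam '' (g '' sphere 0 1) ↔ w ∈ g '' sphere 0 1 := by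
    rw [Equiv.image_eq_preimage_symm]; rfl
  rw [hmem, hyn]
  constructor
  · rintro ⟨x, hx, hxw⟩
    have h1 : (τ / ‖g x‖) • x ∈ U := by
      refine hη₁c x hx ?_
      rw [hxw]
      refine lt_of_le_of_lt ?_ hwc'
      exact mul_le_mul_of_nonneg_right
        (by linarith [(min_le_left _ _ : η₀ ≤ _).trans (min_le_left η₁ (ρ ^ 2 / (2 * τ ^ 2)))])
        hwn.le
    have h2 := hUL _ h1
    have h3 : Q ((τ / ‖g x‖) • x) = (τ / ‖w‖) • w := by
      have hpos : 0 < τ / ‖g x‖ := div_pos hτ (hgn x hx)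
      simp only [hQ]
      rw [norm_smul, norm_of_mem_unit hx, mul_one, hg.homog _ hpos, Real.norm_eq_abs,
        abs_of_pos hpos, hxw]
    rw [h3, hxw] at h2
    rw [hz, h2, norm_smul, norm_of_mem_unit hx, mul_one, Real.norm_eq_abs,
      abs_of_pos (div_pos hτ hwn)]
    field_simp
  · intro h
    have h1 : ‖z‖ • g z = (τ / ‖w‖) • w := hb2
    have h2 : ‖z‖ = τ / ‖w‖ := by field_simp at h ⊢; linarith
    rw [h2] at h1
    have h3 : g z = w := smul_right_injective _ (div_pos hτ hwn).ne' h1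
    rw [← h3]
    exact hg.mem_image hb3

/-- Every embedded sphere can be isotoped so that off a narrow cone it is either empty or a round
sphere. -/
theorem IsSphereMap.exists_isot_standard {g : E4 → E4} (hg : IsSphereMap g)
    (h0 : (0 : E4) ∉ g '' sphere 0 1) :
    ∃ ν : E4, ‖ν‖ = 1 ∧ ∀ c : ℝ, 0 ≤ c → c < 1 → ∃ A : Set E4, Isot (g '' sphere 0 1) A ∧
      (0 : E4) ∉ A ∧
      ((∀ y, ¬ c * ‖y‖ < inner ℝ y ν → y ∉ A) ∨
       (∀ y, ¬ c * ‖y‖ < inner ℝ y ν → (y ∈ A ↔ ‖y‖ = 1))) := by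
  set P := g '' sphere 0 1 with hP
  obtain ⟨x₀, hx₀, hmax⟩ := (isCompact_sphere (0 : E4) 1).exists_isMaxOn
    (NormedSpace.sphere_nonempty.2 zero_le_one) (f := fun x => ‖g x‖)
    (fun x hx => (hg.continuousAt (ne_zero_of_mem_unit hx)).norm.continuousWithinAt)
  have hx0 := ne_zero_of_mem_unit hx₀
  have hmax' : ∀ x ∈ sphere (0 : E4) 1, ‖g x‖ ≤ ‖g x₀‖ := fun x hx => hmax hx
  set R := ‖g x₀‖ with hR
  have hRpos : 0 < R := norm_pos_iff.2 fun h => h0 ⟨x₀, hx₀, h⟩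
  set ν := R⁻¹ • g x₀ with hνdef
  have hν : ‖ν‖ = 1 := by
    rw [hνdef, norm_smul, norm_inv, Real.norm_eq_abs, abs_of_pos hRpos, ← hR,
      inv_mul_cancel₀ hRpos.ne']
  have hgx : g x₀ = R • ν := by rw [hνdef, smul_smul, mul_inv_cancel₀ hRpos.ne', one_smul]
  clear_value ν
  have hνν : ∀ r : ℝ, inner ℝ (r • ν) ν = r := fun r => by
    rw [inner_smul_left, real_inner_self_eq_norm_sq, hν, one_pow, mul_one]; rfl
  have htr : ν ∉ range (fderiv ℝ g x₀) := by
    rintro ⟨v, hv⟩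
    have hloc : IsLocalMax (fun y => ‖g y‖ ^ 2) x₀ := by
      filter_upwards [isOpen_ne.mem_nhds hx0] with y hy
      have := hmax' _ (normalize_mem_unit hy)
      rw [hg.apply_normalize hy] at this
      exact pow_le_pow_left₀ (norm_nonneg _) this 2
    have h1 := hloc.hasFDerivAt_eq_zero (hg.hasFDerivAt hx0).norm_sq
    have h2 := congrArg (fun T : E4 →L[ℝ] ℝ => T v) h1
    have h3 : inner ℝ (g x₀) ν = R := by rw [hgx, hνν]
    simp [hv, h3] at h2
    exact hRpos.ne' h2
  obtain ⟨δ, hδ, hside, hcomp⟩ := hg.exists_side_mem_component h0 hx₀ htr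
  set τ := min (δ / 2) (R / 2)
  have hτ : 0 < τ := by positivity
  have hτδ : τ ∈ Ioo 0 δ := ⟨hτ, (min_le_left _ _).trans_lt (by linarith)⟩
  have htrans : ∀ q ∈ connectedComponentIn Pᶜ 0, Isot P ((fun y => g y - q) '' sphere 0 1) := by
    intro q hq
    have h := isot_translate hg.isCompact_image isPreconnected_connectedComponentIn
      (disjoint_compl_left.mono_left (connectedComponentIn_subset _ _))
      (mem_connectedComponentIn h0) hq
    simpa [image_image, hP] using h
  have hle : ∀ x ∈ sphere (0 : E4) 1, inner ℝ (g x) ν ≤ R := fun x hx =>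
    (real_inner_le_norm _ _).trans (by rw [hν, mul_one]; exact hmax' x hx)
  refine ⟨-ν, by simpa using hν, fun c hc0 hc1 => ?_⟩
  rcases hcomp with hcomp | hcomp
  · have hI := htrans _ (hcomp τ hτδ)
    set P' := (fun y => g y - (g x₀ + τ • ν)) '' sphere 0 1
    have hP'c : IsCompact P' := hI.isCompact hg.isCompact_image
    have hP'0 := hI.zero_notMem h0
    obtain ⟨s, hs0, hs⟩ : ∃ s : ℝ, 0 ≤ s ∧ Real.exp (-s) < 1 - c := by
      have := (Real.tendsto_exp_neg_atTop_nhds_zero.eventually (gt_mem_nhds (sub_pos.2 hc1))).and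
        (Filter.eventually_ge_atTop 0)
      obtain ⟨s, h1, h2⟩ := this.exists
      exact ⟨s, h2, h1⟩
    have hB := isot_boost hν (-s) hP'c hP'0
    refine ⟨_, hI.trans hB, hB.zero_notMem hP'0, Or.inl ?_⟩
    rintro _ hy ⟨z, hz, rfl⟩
    refine hy (inner_boost_neg_lt hν hs0 hs (fun h => hP'0 (h ▸ hz)) ?_)
    obtain ⟨x, hx, rfl⟩ := hz
    rw [inner_sub_left, inner_add_left, hgx, hνν, hνν]
    linarith [hle x hx]
  · have hI := htrans _ (hcomp τ hτδ)
    have hg' := hg.sub_const (g x₀ - τ • ν)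
    obtain ⟨η, hη, hη1, A, hIA, hA⟩ := hg'.exists_flattening (hI.zero_notMem h0) hx₀ hν hτ
      (by simp) (by rwa [fderiv_sub_const]) (by
        intro x hx r hr hxr
        have h1 : g x = (R + (r - τ)) • ν := by
          rw [sub_eq_iff_eq_add.1 hxr, hgx]
          simp only [add_smul, sub_smul]; abel
        rcases eq_or_ne r τ with h | h
        · rw [h, sub_self, add_zero, ← hgx] at h1
          exact hg.inj hx hx₀ h1
        exfalso
        rcases lt_or_gt_of_ne h with h | h
        · refine hside (r - τ) (sub_ne_zero.2 h.ne) ?_ ⟨x, hx, ?_⟩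
          · rw [abs_of_neg (by linarith)]; linarith [hτδ.2]
          · rw [h1, hgx, add_smul]
        · have h2 := hle x hx
          rw [h1, hνν] at h2
          linarith)
    have hIA' : Isot P A := hI.trans hIA
    have hAc := hIA'.isCompact hg.isCompact_image
    have hA0 := hIA'.zero_notMem h0
    obtain ⟨s, hs0, hs⟩ : ∃ s : ℝ, 0 ≤ s ∧ 2 * Real.exp (-s) < η * (1 - c) := by
      have h1 : 0 < η * (1 - c) / 2 := by have := sub_pos.2 hc1; positivity
      have := (Real.tendsto_exp_neg_atTop_nhds_zero.eventually (gt_mem_nhds h1)).and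
        (Filter.eventually_ge_atTop 0)
      obtain ⟨s, h1, h2⟩ := this.exists
      exact ⟨s, h2, by linarith⟩
    have hB := isot_boost hν (-s) hAc hA0
    refine ⟨_, hIA'.trans hB, hB.zero_notMem hA0, Or.inr fun y hy => ?_⟩
    have hmem : y ∈ boost ν (-s) '' A ↔ boost ν s y ∈ A := by
      constructor
      · rintro ⟨z, hz, rfl⟩
        have := boost_neg_boost hν (-s) z
        rw [neg_neg] at this
        rwa [this]
      · exact fun h => ⟨_, h, boost_neg_boost hν s y⟩
    rw [hmem]
    rcases eq_or_ne y 0 with rfl | hy0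
    · have : boost ν s 0 = 0 := by simp [boost]
      simp [this, hA0]
    rw [hA _ (lt_inner_boost hν hs0 hc0 hc1 hs hy0 (by
      rw [inner_neg_right] at hy; linarith)), norm_boost hν]

section Hadamard
variable {F : Type*} [NormedAddCommGroup F] [NormedSpace ℝ F]

/-- The quotient of `G (ε, y)` by `ε`, extended to `ε = 0` by the partial derivative. -/
def hadamardQuotient (G : ℝ × E4 → F) (p : ℝ × E4) : F :=
  if p.1 = 0 then fderiv ℝ G p (1, 0) else p.1⁻¹ • G p

theorem continuousAt_hadamardQuotient {G : ℝ × E4 → F} {ε : ℝ} {y : E4}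
    (hG : ContDiffAt ℝ 1 G (ε, y)) (h0 : ε = 0 → ∀ᶠ z in 𝓝 y, G (0, z) = 0) :
    ContinuousAt (hadamardQuotient G) (ε, y) := by
  by_cases hε : ε = 0
  · subst hε
    set D := fderiv ℝ G (0, y) with hD
    have hs : HasStrictFDerivAt G D (0, y) := hG.hasStrictFDerivAt (by simp)
    have hf : ContinuousAt (fun p => fderiv ℝ G p (1, 0)) ((0 : ℝ), y) :=
      (hG.continuousAt_fderiv (by simp)).clm_apply continuousAt_const
    have hval : hadamardQuotient G (0, y) = D (1, 0) := by simp [hadamardQuotient, hD]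
    rw [ContinuousAt, hval, Metric.tendsto_nhds]
    intro e he
    have h1 : ∀ᶠ p in 𝓝 ((0 : ℝ), y), dist (fderiv ℝ G p (1, 0)) (D (1, 0)) < e :=
      Metric.tendsto_nhds.1 hf e he
    have h2 := hs.isLittleO.def (half_pos he)
    have h3 : Filter.Tendsto (fun p : ℝ × E4 => (p, ((0 : ℝ), p.2))) (𝓝 (0, y))
        (𝓝 ((0, y), (0, y))) := by
      have : Continuous fun p : ℝ × E4 => (p, ((0 : ℝ), p.2)) := by fun_prop
      exact this.tendsto (0, y)
    have h4 : ∀ᶠ p : ℝ × E4 in 𝓝 (0, y), G (0, p.2) = 0 :=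
      (continuous_snd.tendsto ((0 : ℝ), y)).eventually (h0 rfl)
    filter_upwards [h1, h3.eventually h2, h4] with p hp1 hp2 hp4
    by_cases hp : p.1 = 0
    · simpa [hadamardQuotient, hp] using hp1
    · rw [hadamardQuotient, if_neg hp, dist_eq_norm]
      have h5 : p - ((0 : ℝ), p.2) = p.1 • ((1 : ℝ), (0 : E4)) := by
        ext1 <;> simp
      simp only [h5, hp4, sub_zero, map_smul] at hp2
      have h6 : p.1⁻¹ • G p - D (1, 0) = p.1⁻¹ • (G p - p.1 • D (1, 0)) := by
        rw [smul_sub, smul_smul, inv_mul_cancel₀ hp, one_smul]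
      have h7 : ‖((1 : ℝ), (0 : E4))‖ = 1 := by simp [Prod.norm_def]
      rw [norm_smul, h7, mul_one] at hp2
      have h8 : 0 < ‖p.1‖ := norm_pos_iff.2 hp
      rw [h6, norm_smul, norm_inv, inv_mul_lt_iff₀ h8]
      nlinarith
  · have h1 : ∀ᶠ p : ℝ × E4 in 𝓝 (ε, y), p.1 ≠ 0 :=
      continuous_fst.continuousAt.eventually_ne hε
    have h2 : ContinuousAt (fun p : ℝ × E4 => p.1⁻¹ • G p) (ε, y) :=
      (continuousAt_fst.inv₀ hε).smul hG.continuousAt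
    refine h2.congr ?_
    filter_upwards [h1] with p hp
    rw [hadamardQuotient, if_neg hp]

variable {G : ℝ × E4 → ℝ}

theorem contDiffAt_hadamardQuotient (hG : ∀ s, ∀ y ≠ 0, ContDiffAt ℝ ∞ G (s, y)) (s : ℝ) {y : E4}
    (hy : y ≠ 0) : ContDiffAt ℝ ∞ (fun z => hadamardQuotient G (s, z)) y := by
  have hi : ContDiffAt ℝ ∞ (fun z : E4 => (s, z)) y := contDiffAt_const.prodMk contDiffAt_id
  by_cases hs : s = 0
  · simp only [hadamardQuotient, if_pos hs]
    have h := (hG s y hy).fderiv_right (m := ∞) (by simp)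
    exact (ContDiffAt.comp (g := fderiv ℝ G) y h hi).clm_apply contDiffAt_const
  · simp only [hadamardQuotient, if_neg hs]
    exact contDiffAt_const (c := s⁻¹) |>.smul (ContDiffAt.comp (g := G) y (hG s y hy) hi)

theorem continuousAt_fderiv_hadamardQuotient (hG : ∀ s, ∀ y ≠ 0, ContDiffAt ℝ ∞ G (s, y))
    (h0 : ∀ y ≠ 0, G (0, y) = 0) (s : ℝ) {y : E4} (hy : y ≠ 0) :
    ContinuousAt (fun p : ℝ × E4 => fderiv ℝ (fun z => hadamardQuotient G (p.1, z)) p.2)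
      (s, y) := by
  have hne : (∞ : WithTop ℕ∞) ≠ 0 := by simp
  let K : ℝ × E4 → E4 →L[ℝ] ℝ := fun p => (fderiv ℝ G p).comp (ContinuousLinearMap.inr ℝ ℝ E4)
  have hdG : ∀ s, ∀ y ≠ 0, ContDiffAt ℝ ∞ (fderiv ℝ G) (s, y) := fun s y hy =>
    (hG s y hy).fderiv_right (m := ∞) (by simp)
  have hK : ∀ s, ∀ y ≠ 0, ContDiffAt ℝ ∞ K (s, y) := fun s y hy =>
    (hdG s y hy).clm_comp contDiffAt_const
  have hpart : ∀ s, ∀ z ≠ 0, HasFDerivAt (fun z => G (s, z)) (K (s, z)) z := fun s z hz =>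
    HasFDerivAt.comp (g := G) z ((hG s z hz).differentiableAt hne).hasFDerivAt
      (hasFDerivAt_prodMk_right s z)
  have hK0 : ∀ᶠ z in 𝓝 y, K (0, z) = 0 := by
    filter_upwards [isOpen_ne.mem_nhds hy] with z hz
    refine (hpart 0 z hz).unique ?_
    refine (hasFDerivAt_const (0 : ℝ) z).congr_of_eventuallyEq ?_
    filter_upwards [isOpen_ne.mem_nhds hz] with w hw using h0 w hw
  refine (continuousAt_hadamardQuotient ((hK s y hy).of_le (by simp)) fun _ => hK0).congr ?_
  have h1 : ∀ᶠ p : ℝ × E4 in 𝓝 (s, y), p.2 ≠ 0 := continuous_snd.continuousAt.eventually_ne hy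
  filter_upwards [h1] with p hp
  obtain ⟨r, z⟩ := p
  simp only at hp
  by_cases hr : r = 0
  · subst hr
    simp only [hadamardQuotient, if_true]
    have hd2 := ((hdG 0 z hp).differentiableAt hne).hasFDerivAt
    have h2 : HasFDerivAt (fun w => fderiv ℝ G (0, w) (1, 0)) _ z :=
      (HasFDerivAt.comp (g := fderiv ℝ G) z hd2 (hasFDerivAt_prodMk_right (0 : ℝ) z)).clm_apply
        (hasFDerivAt_const _ _)
    have h3 : HasFDerivAt K _ ((0 : ℝ), z) := hd2.clm_comp (hasFDerivAt_const _ _)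
    rw [h2.fderiv, h3.fderiv]
    ext v
    have hsymm : IsSymmSndFDerivAt ℝ G ((0 : ℝ), z) :=
      (hG 0 z hp).isSymmSndFDerivAt (by
        rw [minSmoothness_of_isRCLikeNormedField]; exact WithTop.coe_le_coe.2 le_top)
    have := hsymm (1, 0) (0, v)
    simpa using this
  · simp only [hadamardQuotient, if_neg hr]
    exact (HasFDerivAt.fderiv ((hpart r z hp).const_smul r⁻¹)).symm

end Hadamard

/-- The sign of the Jacobian is constant along a family. -/
theorem det_pos_of_family {f : ℝ → Equiv.Perm E4} (hf : ∀ s, f s ∈ puncturedDiffeo)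
    (hc' : ∀ s, ∀ y ≠ 0, ContinuousAt (fun p : ℝ × E4 => fderiv ℝ (f p.1) p.2) (s, y))
    {a : ℝ} (ha : f a ∈ orientedDiffeo) (b : ℝ) : f b ∈ orientedDiffeo := by
  refine ⟨hf b, fun y hy => ?_⟩
  have hcont : Continuous fun s => (fderiv ℝ (f s) y).det := by
    rw [continuous_iff_continuousAt]
    intro s
    exact ContinuousLinearMap.continuous_det.continuousAt.comp
      (f := fun s => fderiv ℝ (f s) y)
      (ContinuousAt.comp (g := fun p : ℝ × E4 => fderiv ℝ (f p.1) p.2) (f := fun s => (s, y))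
        (hc' s y hy) (by fun_prop))
  by_contra! hneg
  have := isPreconnected_univ.intermediate_value (mem_univ b) (mem_univ a) hcont.continuousOn
    (show (0 : ℝ) ∈ Icc _ _ from ⟨hneg, (ha.2 y hy).le⟩)
  obtain ⟨s, -, hs⟩ := this
  exact det_fderiv_ne_zero (hf s) hy hs

/-- The power map on radii. -/
def powMap (s : ℝ) (y : E4) : E4 := Real.exp (s * Real.log ‖y‖) • (‖y‖⁻¹ • y)

theorem norm_powMap (s : ℝ) {y : E4} (hy : y ≠ 0) :
    ‖powMap s y‖ = Real.exp (s * Real.log ‖y‖) := by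
  rw [powMap, norm_smul, norm_of_mem_unit (normalize_mem_unit hy), mul_one, Real.norm_eq_abs,
    abs_of_pos (Real.exp_pos _)]

theorem normalize_smul {c : ℝ} (hc : 0 < c) (y : E4) : ‖c • y‖⁻¹ • (c • y) = ‖y‖⁻¹ • y := by
  rw [norm_smul, Real.norm_eq_abs, abs_of_pos hc, smul_smul, mul_inv, mul_right_comm,
    inv_mul_cancel₀ hc.ne', one_mul]

theorem normalize_eq_self {y : E4} (hy : ‖y‖ = 1) : ‖y‖⁻¹ • y = y := by simp [hy]

theorem powMap_powMap (s t : ℝ) {y : E4} (hy : y ≠ 0) :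
    powMap s (powMap t y) = powMap (s * t) y := by
  have hn : ‖(‖y‖⁻¹ • y)‖ = 1 := norm_of_mem_unit (normalize_mem_unit hy)
  rw [powMap, norm_powMap t hy, Real.log_exp, ← norm_powMap t hy]
  conv_lhs => rw [powMap, normalize_smul (Real.exp_pos _), normalize_eq_self hn]
  rw [powMap, mul_assoc]

theorem powMap_ne_zero (s : ℝ) {y : E4} (hy : y ≠ 0) : powMap s y ≠ 0 :=
  smul_ne_zero (Real.exp_pos _).ne' (ne_zero_of_mem_unit (normalize_mem_unit hy))

theorem powMap_one (y : E4) : powMap 1 y = y := by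
  rcases eq_or_ne y 0 with rfl | hy
  · simp [powMap]
  have := norm_pos_iff.2 hy
  rw [powMap, one_mul, Real.exp_log this, smul_smul, mul_inv_cancel₀ this.ne', one_smul]

theorem powMap_zero_right (s : ℝ) : powMap s 0 = 0 := by simp [powMap]

theorem contDiffAt_powMap (s : ℝ) {y : E4} (hy : y ≠ 0) :
    ContDiffAt ℝ ∞ (fun p : ℝ × E4 => powMap p.1 p.2) (s, y) := by
  have h1 : ContDiffAt ℝ ∞ (fun p : ℝ × E4 => ‖p.2‖) (s, y) :=
    (contDiffAt_norm ℝ hy).comp (s, y) contDiffAt_snd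
  have h2 : ‖((s, y) : ℝ × E4).2‖ ≠ 0 := norm_ne_zero_iff.2 hy
  exact (contDiffAt_fst.mul (h1.log h2)).exp.smul ((h1.inv h2).smul contDiffAt_snd)

theorem contDiffAt_powMap_right (s : ℝ) {y : E4} (hy : y ≠ 0) : ContDiffAt ℝ ∞ (powMap s) y :=
  (contDiffAt_powMap s hy).comp y (contDiffAt_const.prodMk contDiffAt_id)

/-- The power map on radii as a permutation. -/
def powPerm (s : ℝ) (hs : s ≠ 0) : Equiv.Perm E4 where
  toFun := powMap s
  invFun := powMap s⁻¹
  left_inv y := by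
    rcases eq_or_ne y 0 with rfl | hy
    · simp [powMap_zero_right]
    · rw [powMap_powMap _ _ hy, inv_mul_cancel₀ hs, powMap_one]
  right_inv y := by
    rcases eq_or_ne y 0 with rfl | hy
    · simp [powMap_zero_right]
    · rw [powMap_powMap _ _ hy, mul_inv_cancel₀ hs, powMap_one]

theorem powPerm_mem (s : ℝ) (hs : s ≠ 0) : powPerm s hs ∈ puncturedDiffeo :=
  ⟨powMap_zero_right s, fun _ hy => contDiffAt_powMap_right s hy,
    fun _ hy => contDiffAt_powMap_right s⁻¹ hy⟩

theorem contDiffAt_normalize {y : E4} (hy : y ≠ 0) :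
    ContDiffAt ℝ ∞ (fun y : E4 => ‖y‖⁻¹ • y) y :=
  ((contDiffAt_norm ℝ hy).inv (norm_ne_zero_iff.2 hy)).smul contDiffAt_id

theorem hasFDerivAt_normalize {x : E4} (hx : ‖x‖ = 1) :
    HasFDerivAt (fun y : E4 => ‖y‖⁻¹ • y)
      (ContinuousLinearMap.id ℝ E4 - (innerSL ℝ x).smulRight x) x := by
  have h1 := hasFDerivAt_norm_of_mem_unit (x := x) (by simpa using hx)
  have h2 : HasFDerivAt (fun y : E4 => ‖y‖⁻¹) (-innerSL ℝ x) x := by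
    refine ((hasDerivAt_inv (x := ‖x‖) (by simp [hx])).comp_hasFDerivAt x h1).congr_fderiv ?_
    ext v
    simp [hx]
  refine (h2.smul (hasFDerivAt_id x)).congr_fderiv ?_
  ext1 v
  simp [hx, sub_eq_add_neg]

/-- Diffeomorphisms preserving the unit sphere and its inside. -/
structure PreservesUnitSphere (f : Equiv.Perm E4) : Prop where
  norm_eq_one : ∀ y, ‖f y‖ = 1 ↔ ‖y‖ = 1
  norm_lt_one : ∀ y, ‖f y‖ < 1 ↔ ‖y‖ < 1

namespace PreservesUnitSphere
variable {f : Equiv.Perm E4}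

theorem symm (hf : PreservesUnitSphere f) : PreservesUnitSphere f.symm where
  norm_eq_one y := by rw [← hf.norm_eq_one, Equiv.apply_symm_apply]
  norm_lt_one y := by rw [← hf.norm_lt_one, Equiv.apply_symm_apply]

/-- The map with prescribed radial stretching `a` and with the same values as `f` on the unit
sphere. -/
def polarPerm (hS : PreservesUnitSphere f) (a : E4 → ℝ) (ha : IsRadiallyConstant a)
    (ha0 : ∀ y ≠ 0, 0 < a y) : Equiv.Perm E4 where
  toFun y := if y = 0 then 0 else Real.exp (a y * Real.log ‖y‖) • f (‖y‖⁻¹ • y)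
  invFun y := if y = 0 then 0 else
    Real.exp (Real.log ‖y‖ / a (f.symm (‖y‖⁻¹ • y))) • f.symm (‖y‖⁻¹ • y)
  left_inv y := by
    by_cases hy : y = 0
    · simp [hy]
    have hn := norm_of_mem_unit (normalize_mem_unit hy)
    have hfn := (hS.norm_eq_one _).2 hn
    have hf0 : f (‖y‖⁻¹ • y) ≠ 0 := by rw [← norm_ne_zero_iff, hfn]; exact one_ne_zero
    have hE := Real.exp_pos (a y * Real.log ‖y‖)
    have h1 := (normalize_smul hE (f (‖y‖⁻¹ • y))).trans (normalize_eq_self hfn)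
    have h2 : Real.log ‖Real.exp (a y * Real.log ‖y‖) • f (‖y‖⁻¹ • y)‖ = a y * Real.log ‖y‖ := by
      rw [norm_smul, hfn, mul_one, Real.norm_eq_abs, abs_of_pos hE, Real.log_exp]
    simp only [if_neg hy, if_neg (smul_ne_zero hE.ne' hf0), h1, h2, Equiv.symm_apply_apply]
    have hy' := norm_pos_iff.2 hy
    rw [ha.homog _ (inv_pos.2 hy'), mul_div_cancel_left₀ _ (ha0 y hy).ne', Real.exp_log hy',
      smul_smul, mul_inv_cancel₀ hy'.ne', one_smul]
  right_inv y := by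
    by_cases hy : y = 0
    · simp [hy]
    have hn := norm_of_mem_unit (normalize_mem_unit hy)
    have hfn := (hS.symm.norm_eq_one _).2 hn
    have hf0 : f.symm (‖y‖⁻¹ • y) ≠ 0 := by rw [← norm_ne_zero_iff, hfn]; exact one_ne_zero
    have hE := Real.exp_pos (Real.log ‖y‖ / a (f.symm (‖y‖⁻¹ • y)))
    have h1 := (normalize_smul hE (f.symm (‖y‖⁻¹ • y))).trans (normalize_eq_self hfn)
    have h2 : Real.log ‖Real.exp (Real.log ‖y‖ / a (f.symm (‖y‖⁻¹ • y))) • f.symm (‖y‖⁻¹ • y)‖ =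
        Real.log ‖y‖ / a (f.symm (‖y‖⁻¹ • y)) := by
      rw [norm_smul, hfn, mul_one, Real.norm_eq_abs, abs_of_pos hE, Real.log_exp]
    simp only [if_neg hy, if_neg (smul_ne_zero hE.ne' hf0), h1, h2, Equiv.apply_symm_apply]
    have hy' := norm_pos_iff.2 hy
    rw [ha.homog _ hE, mul_div_cancel₀ _ (ha0 _ hf0).ne', Real.exp_log hy',
      smul_smul, mul_inv_cancel₀ hy'.ne', one_smul]

variable (hS : PreservesUnitSphere f)

theorem polarPerm_apply {a : E4 → ℝ} (ha : IsRadiallyConstant a) (ha0 : ∀ y ≠ 0, 0 < a y) {y : E4}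
    (hy : y ≠ 0) : hS.polarPerm a ha ha0 y = Real.exp (a y * Real.log ‖y‖) • f (‖y‖⁻¹ • y) :=
  if_neg hy

theorem polarPerm_mem (hf : f ∈ puncturedDiffeo) {a : E4 → ℝ} (ha : IsRadiallyConstant a)
    (ha0 : ∀ y ≠ 0, 0 < a y) : hS.polarPerm a ha ha0 ∈ puncturedDiffeo := by
  obtain ⟨-, hf1, hf2⟩ := hf
  have hlog : ∀ y : E4, y ≠ 0 → ContDiffAt ℝ ∞ (fun y : E4 => Real.log ‖y‖) y := fun y hy =>
    (contDiffAt_norm ℝ hy).log (norm_ne_zero_iff.2 hy)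
  refine ⟨if_pos rfl, fun y hy => ?_, fun y hy => ?_⟩
  · have hn := ne_zero_of_mem_unit (normalize_mem_unit hy)
    have : ContDiffAt ℝ ∞ (fun y => Real.exp (a y * Real.log ‖y‖) • f (‖y‖⁻¹ • y)) y :=
      ((ha.smooth y hy).mul (hlog y hy)).exp.smul
        (ContDiffAt.comp (f := fun y : E4 => ‖y‖⁻¹ • y) y (hf1 _ hn) (contDiffAt_normalize hy))
    refine this.congr_of_eventuallyEq ?_
    filter_upwards [isOpen_ne.mem_nhds hy] with z hz using if_neg hz
  · have hn := normalize_mem_unit hy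
    have hfn := (hS.symm.norm_eq_one _).2 (norm_of_mem_unit hn)
    have hf0 : f.symm (‖y‖⁻¹ • y) ≠ 0 := by rw [← norm_ne_zero_iff, hfn]; exact one_ne_zero
    have h1 : ContDiffAt ℝ ∞ (fun y : E4 => f.symm (‖y‖⁻¹ • y)) y :=
      ContDiffAt.comp (f := fun y : E4 => ‖y‖⁻¹ • y) y (hf2 _ (ne_zero_of_mem_unit hn))
        (contDiffAt_normalize hy)
    have : ContDiffAt ℝ ∞ (fun y => Real.exp (Real.log ‖y‖ / a (f.symm (‖y‖⁻¹ • y))) •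
        f.symm (‖y‖⁻¹ • y)) y :=
      ((hlog y hy).div (ContDiffAt.comp (f := fun y : E4 => f.symm (‖y‖⁻¹ • y)) y
        (ha.smooth _ hf0) h1) (ha0 _ hf0).ne').exp.smul h1
    refine this.congr_of_eventuallyEq ?_
    filter_upwards [isOpen_ne.mem_nhds hy] with z hz using if_neg hz

/-- The radial stretching of `f` along the unit sphere. -/
def stretch (f : E4 → E4) (y : E4) : ℝ :=
  inner ℝ (f (‖y‖⁻¹ • y)) (fderiv ℝ f (‖y‖⁻¹ • y) (‖y‖⁻¹ • y))

theorem isRadiallyConstant_stretch (hf : PSmooth f) : IsRadiallyConstant (stretch f) where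
  smooth y hy := by
    have hn := ne_zero_of_mem_unit (normalize_mem_unit hy)
    have h1 := contDiffAt_normalize hy
    exact (ContDiffAt.comp (f := fun y : E4 => ‖y‖⁻¹ • y) y (hf _ hn) h1).inner ℝ
      ((ContDiffAt.comp (f := fun y : E4 => ‖y‖⁻¹ • y) (g := fderiv ℝ f) y
        ((hf _ hn).fderiv_right (m := ∞) (by simp)) h1).clm_apply h1)
  homog c hc y := by simp only [stretch, normalize_smul hc]

include hS in
/-- The logarithm of the norm along a ray has derivative given by the stretching. -/
theorem hasDerivAt_log_norm (hf : PSmooth f) (t : ℝ) {x : E4} (hx : ‖x‖ = 1) :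
    HasDerivAt (fun s : ℝ => Real.log ‖f (Real.exp (s * t) • x)‖)
      (t * inner ℝ (f x) (fderiv ℝ f x x)) 0 := by
  have hne : (∞ : WithTop ℕ∞) ≠ 0 := by simp
  have hx0 : x ≠ 0 := by rw [← norm_ne_zero_iff, hx]; exact one_ne_zero
  have hfx : ‖f x‖ = 1 := (hS.norm_eq_one x).2 hx
  have h1 : HasDerivAt (fun s : ℝ => Real.exp (s * t) • x) (t • x) 0 := by
    have := (((hasDerivAt_id (0 : ℝ)).mul_const t).exp).smul_const x
    simpa using this
  have h2 : HasDerivAt (fun s : ℝ => f (Real.exp (s * t) • x)) (t • fderiv ℝ f x x) 0 := by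
    have := HasFDerivAt.comp_hasDerivAt (l := f) (f := fun s : ℝ => Real.exp (s * t) • x)
      (l' := fderiv ℝ f x) (0 : ℝ)
      (by simpa using ((hf x hx0).differentiableAt hne).hasFDerivAt) h1
    simpa [Function.comp_def] using this
  have h3 : HasDerivAt (fun s : ℝ => Real.log (‖f (Real.exp (s * t) • x)‖ ^ 2) / 2)
      (t * inner ℝ (f x) (fderiv ℝ f x x)) 0 := by
    have := ((h2.norm_sq).log (by simp [hfx])).div_const 2
    refine this.congr_deriv ?_
    simp [hfx, inner_smul_right]
  refine h3.congr_of_eventuallyEq (Filter.Eventually.of_forall fun s => ?_)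
  simp [Real.log_pow]

include hS in
theorem stretch_pos (hf : f ∈ puncturedDiffeo) {y : E4} (hy : y ≠ 0) : 0 < stretch f y := by
  have hne : (∞ : WithTop ℕ∞) ≠ 0 := by simp
  set x := ‖y‖⁻¹ • y
  have hx1 : ‖x‖ = 1 := norm_of_mem_unit (normalize_mem_unit hy)
  have hx0 : x ≠ 0 := ne_zero_of_mem_unit (normalize_mem_unit hy)
  have hfx : ‖f x‖ = 1 := (hS.norm_eq_one x).2 hx1
  have hd := ((hf.2.1 x hx0).differentiableAt hne).hasFDerivAt
  refine lt_of_le_of_ne ?_ fun h => ?_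
  · have h1 := hS.hasDerivAt_log_norm hf.2.1 1 hx1
    rw [one_mul] at h1
    refine ge_of_tendsto (hasDerivAt_iff_tendsto_slope.1 h1) ?_
    filter_upwards [self_mem_nhdsWithin] with s hs
    have hfs0 : f (Real.exp s • x) ≠ 0 :=
      perm_ne_zero hf.1 (smul_ne_zero (Real.exp_pos _).ne' hx0)
    have hfs : 0 < ‖f (Real.exp s • x)‖ := norm_pos_iff.2 hfs0
    have hns : ‖Real.exp s • x‖ = Real.exp s := by
      rw [norm_smul, hx1, mul_one, Real.norm_eq_abs, abs_of_pos (Real.exp_pos _)]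
    simp only [slope, vsub_eq_sub, sub_zero, mul_one, Real.exp_zero, one_smul, hfx,
      Real.log_one, smul_eq_mul]
    rcases lt_or_gt_of_ne hs with h | h
    · have : ‖f (Real.exp s • x)‖ < 1 :=
        (hS.norm_lt_one _).2 (by rw [hns]; exact Real.exp_lt_one_iff.2 h)
      exact mul_nonneg_of_nonpos_of_nonpos (inv_nonpos.2 (le_of_lt h))
        (Real.log_nonpos hfs.le this.le)
    · have : 1 ≤ ‖f (Real.exp s • x)‖ := not_lt.1 fun h' => by
        have := (hS.norm_lt_one _).1 h'
        rw [hns] at this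
        exact absurd this (not_lt.2 (Real.one_le_exp (le_of_lt h)))
      exact mul_nonneg (inv_nonneg.2 (le_of_lt h)) (Real.log_nonneg this)
  · have hinj : Function.Injective (fderiv ℝ f x : E4 →ₗ[ℝ] E4) :=
      (injective_iff_map_eq_zero _).2 (fderiv_injective_of_mem hf hx0)
    obtain ⟨v, hv⟩ := LinearMap.injective_iff_surjective.1 hinj (f x)
    have h1 : HasFDerivAt (fun y : E4 => f (‖y‖⁻¹ • y)) _ x :=
      HasFDerivAt.comp (g := f) (f := fun y : E4 => ‖y‖⁻¹ • y) x
        (by rw [normalize_eq_self hx1]; exact hd) (hasFDerivAt_normalize hx1)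
    have h2 : (fun y : E4 => ‖f (‖y‖⁻¹ • y)‖ ^ 2) =ᶠ[𝓝 x] fun _ => (1 : ℝ) := by
      filter_upwards [isOpen_ne.mem_nhds hx0] with z hz
      rw [(hS.norm_eq_one _).2 (norm_of_mem_unit (normalize_mem_unit hz)), one_pow]
    have h3 := h1.norm_sq.unique ((hasFDerivAt_const (1 : ℝ) x).congr_of_eventuallyEq h2)
    have h4 := congrArg (fun T : E4 →L[ℝ] ℝ => T v) h3
    have hv' : fderiv ℝ f x v = f x := hv
    have h5 : inner ℝ (f x) (fderiv ℝ f x x) = 0 := h.symm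
    simp [hv', normalize_eq_self hx1, hfx, h5] at h4

end PreservesUnitSphere

open PreservesUnitSphere in
/-- A diffeomorphism of the punctured space preserving the unit sphere and its inside can be
replaced, as far as images of compact sets go, by one which is homogeneous and norm-preserving. -/
theorem exists_homogeneous {f : Equiv.Perm E4} (hf : f ∈ orientedDiffeo)
    (hS : PreservesUnitSphere f) :
    ∃ g : Equiv.Perm E4, g ∈ orientedDiffeo ∧ (∀ c : ℝ, 0 < c → ∀ y, g (c • y) = c • g y) ∧
      (∀ y, ‖g y‖ = ‖y‖) ∧
      ∀ A : Set E4, IsCompact A → (0 : E4) ∉ A → Isot (f '' A) (g '' A) := by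
  have hne : (∞ : WithTop ℕ∞) ≠ 0 := by simp
  have hfp := hf.1
  obtain ⟨hf0, hf1, hf2⟩ := hf.1
  have hα := isRadiallyConstant_stretch hf1
  have hα0 : ∀ y ≠ 0, 0 < stretch f y := fun y hy => hS.stretch_pos hfp hy
  -- first deformation
  let G : ℝ × E4 → ℝ := fun p => Real.log ‖f (powMap p.1 p.2)‖
  let N : ℝ × E4 → E4 := fun p => ‖f (powMap p.1 p.2)‖⁻¹ • f (powMap p.1 p.2)
  have hfc : ∀ s, ∀ y ≠ 0, ContDiffAt ℝ ∞ (fun p : ℝ × E4 => f (powMap p.1 p.2)) (s, y) :=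
    fun s y hy => ContDiffAt.comp (g := f) (f := fun p : ℝ × E4 => powMap p.1 p.2) (s, y)
      (hf1 _ (powMap_ne_zero s hy)) (contDiffAt_powMap s hy)
  have hfc0 : ∀ s, ∀ y ≠ 0, f (powMap s y) ≠ 0 := fun s y hy =>
    perm_ne_zero hf0 (powMap_ne_zero s hy)
  have hG : ∀ s, ∀ y ≠ 0, ContDiffAt ℝ ∞ G (s, y) := fun s y hy =>
    ((hfc s y hy).norm ℝ (hfc0 s y hy)).log (norm_ne_zero_iff.2 (hfc0 s y hy))
  have hN : ∀ s, ∀ y ≠ 0, ContDiffAt ℝ ∞ N (s, y) := fun s y hy =>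
    (((hfc s y hy).norm ℝ (hfc0 s y hy)).inv (norm_ne_zero_iff.2 (hfc0 s y hy))).smul (hfc s y hy)
  have hpow0 : ∀ y, powMap 0 y = ‖y‖⁻¹ • y := fun y => by simp [powMap]
  have hG0 : ∀ y ≠ 0, G (0, y) = 0 := fun y hy => by
    simp only [G, hpow0]
    rw [(hS.norm_eq_one _).2 (norm_of_mem_unit (normalize_mem_unit hy)), Real.log_one]
  let Φ : ℝ → E4 → E4 := fun s y => Real.exp (hadamardQuotient G (s, y)) • N (s, y)
  have hdG0 : ∀ y ≠ 0, hadamardQuotient G (0, y) = stretch f y * Real.log ‖y‖ := by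
    intro y hy
    have h1 := hS.hasDerivAt_log_norm hf1 (Real.log ‖y‖)
      (norm_of_mem_unit (normalize_mem_unit hy))
    have h2 : HasDerivAt (fun s : ℝ => G (s, y)) (fderiv ℝ G (0, y) (1, 0)) 0 :=
      HasFDerivAt.comp_hasDerivAt (l := G) (f := fun s : ℝ => (s, y)) (0 : ℝ)
        ((hG 0 y hy).differentiableAt hne).hasFDerivAt
        ((hasDerivAt_id (0 : ℝ)).prodMk (hasDerivAt_const (0 : ℝ) y))
    rw [hadamardQuotient, if_pos rfl, h2.unique h1, mul_comm]
    rfl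
  let fam : ℝ → Equiv.Perm E4 := fun s => if hs : s = 0 then hS.polarPerm _ hα hα0 else
    powPerm s⁻¹ (inv_ne_zero hs) * f * powPerm s hs
  have hfam : ∀ s, ∀ y ≠ 0, fam s y = Φ s y := by
    intro s y hy
    by_cases hs : s = 0
    · subst hs
      simp only [fam, Φ, dif_pos]
      rw [polarPerm_apply hS hα hα0 hy, hdG0 y hy]
      simp only [N, hpow0]
      rw [(hS.norm_eq_one _).2 (norm_of_mem_unit (normalize_mem_unit hy)), inv_one, one_smul]
    · simp only [fam, Φ, dif_neg hs, hadamardQuotient, if_neg hs]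
      rfl
  have hfamD : ∀ s, ∀ y ≠ 0, fderiv ℝ (fam s) y = fderiv ℝ (Φ s) y := fun s y hy =>
    Filter.EventuallyEq.fderiv_eq (by
      filter_upwards [isOpen_ne.mem_nhds hy] with z hz using hfam s z hz)
  have hmem : ∀ s, fam s ∈ puncturedDiffeo := by
    intro s
    by_cases hs : s = 0
    · simp only [fam, dif_pos hs]
      exact hS.polarPerm_mem hfp hα hα0
    · simp only [fam, dif_neg hs]
      exact mul_mem (mul_mem (powPerm_mem _ _) hfp) (powPerm_mem _ _)
  have hev : ∀ (s : ℝ) (y : E4), y ≠ 0 → ∀ᶠ p : ℝ × E4 in 𝓝 (s, y), p.2 ≠ 0 := fun s y hy =>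
    (continuous_snd.tendsto (s, y)).eventually (isOpen_ne.mem_nhds hy)
  have hq : ∀ s, ∀ y ≠ 0, ContinuousAt (hadamardQuotient G) (s, y) := fun s y hy =>
    continuousAt_hadamardQuotient ((hG s y hy).of_le (by simp)) fun _ => by
      filter_upwards [isOpen_ne.mem_nhds hy] with z hz using hG0 z hz
  have hc : ∀ s, ∀ y ≠ 0, ContinuousAt (fun p : ℝ × E4 => fam p.1 p.2) (s, y) := by
    intro s y hy
    have : ContinuousAt (fun p : ℝ × E4 => Φ p.1 p.2) (s, y) :=
      (hq s y hy).rexp.smul (hN s y hy).continuousAt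
    refine this.congr ?_
    filter_upwards [hev s y hy] with p hp using (hfam p.1 p.2 hp).symm
  have hc' : ∀ s, ∀ y ≠ 0, ContinuousAt (fun p : ℝ × E4 => fderiv ℝ (fam p.1) p.2) (s, y) := by
    intro s y hy
    let K : ℝ × E4 → E4 →L[ℝ] E4 := fun p => (fderiv ℝ N p).comp (ContinuousLinearMap.inr ℝ ℝ E4)
    have hK : ContinuousAt K (s, y) :=
      ((hN s y hy).continuousAt_fderiv hne).clm_comp continuousAt_const
    have hq' := continuousAt_fderiv_hadamardQuotient hG hG0 s hy
    have hexp : ContinuousAt (fun p => Real.exp (hadamardQuotient G p)) (s, y) := (hq s y hy).rexp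
    have hD : ∀ p : ℝ × E4, p.2 ≠ 0 → fderiv ℝ (fam p.1) p.2 =
        Real.exp (hadamardQuotient G p) • K p +
          (Real.exp (hadamardQuotient G p) •
            fderiv ℝ (fun z => hadamardQuotient G (p.1, z)) p.2).smulRight (N p) := by
      rintro ⟨s, y⟩ hy
      rw [hfamD s y hy]
      have h1 : HasFDerivAt (fun z => N (s, z)) (K (s, y)) y :=
        HasFDerivAt.comp (g := N) y ((hN s y hy).differentiableAt hne).hasFDerivAt
          (hasFDerivAt_prodMk_right s y)
      exact (((contDiffAt_hadamardQuotient hG s hy).differentiableAt hne).hasFDerivAt.exp.smul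
        h1).fderiv
    have : ContinuousAt (fun p : ℝ × E4 => Real.exp (hadamardQuotient G p) • K p +
          (Real.exp (hadamardQuotient G p) •
            fderiv ℝ (fun z => hadamardQuotient G (p.1, z)) p.2).smulRight (N p)) (s, y) := by
      refine (hexp.smul hK).add ?_
      exact ((ContinuousLinearMap.smulRightL ℝ E4 E4).continuous₂.continuousAt.comp
        (f := fun p : ℝ × E4 => (Real.exp (hadamardQuotient G p) •
            fderiv ℝ (fun z => hadamardQuotient G (p.1, z)) p.2, N p))
        ((hexp.smul hq').prodMk (hN s y hy).continuousAt))
    refine this.congr ?_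
    filter_upwards [hev s y hy] with p hp using (hD p hp).symm
  have hfam1 : fam 1 = f := by
    ext1 y
    simp only [fam, dif_neg one_ne_zero, Equiv.Perm.mul_apply]
    change powMap 1⁻¹ (f (powMap 1 y)) = f y
    rw [inv_one, powMap_one, powMap_one]
  have hor0 : fam 0 ∈ orientedDiffeo := det_pos_of_family hmem hc' (a := 1) (by rwa [hfam1]) 0
  have hfam0 : fam 0 = hS.polarPerm _ hα hα0 := by simp [fam]
  -- second deformation
  have hβ : ∀ s : ℝ, IsRadiallyConstant fun y => Real.exp (s * Real.log (stretch f y)) := fun s =>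
    { smooth := fun y hy => (contDiffAt_const.mul ((hα.smooth y hy).log (hα0 y hy).ne')).exp
      homog := fun c hc y => by simp only [hα.homog c hc y] }
  let fam' : ℝ → Equiv.Perm E4 := fun s =>
    hS.polarPerm _ (hβ s) (fun _ _ => Real.exp_pos _)
  have hmem' : ∀ s, fam' s ∈ puncturedDiffeo := fun s => hS.polarPerm_mem hfp _ _
  have hsm' : ∀ s, ∀ y ≠ 0, ContDiffAt ℝ ∞ (fun p : ℝ × E4 => fam' p.1 p.2) (s, y) := by
    intro s y hy
    have h1 : ContDiffAt ℝ ∞ (fun p : ℝ × E4 => Real.log (stretch f p.2)) (s, y) :=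
      ContDiffAt.comp (g := fun y => Real.log (stretch f y)) (s, y)
        ((hα.smooth y hy).log (hα0 y hy).ne') contDiffAt_snd
    have h2 : ContDiffAt ℝ ∞ (fun p : ℝ × E4 => Real.log ‖p.2‖) (s, y) :=
      ContDiffAt.comp (g := fun y : E4 => Real.log ‖y‖) (s, y)
        ((contDiffAt_norm ℝ hy).log (norm_ne_zero_iff.2 hy)) contDiffAt_snd
    have h3 : ContDiffAt ℝ ∞ (fun p : ℝ × E4 => f (‖p.2‖⁻¹ • p.2)) (s, y) :=
      ContDiffAt.comp (g := fun y : E4 => f (‖y‖⁻¹ • y)) (s, y)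
        (ContDiffAt.comp (f := fun y : E4 => ‖y‖⁻¹ • y) y
          (hf1 _ (ne_zero_of_mem_unit (normalize_mem_unit hy))) (contDiffAt_normalize hy))
        contDiffAt_snd
    have h4 : ContDiffAt ℝ ∞ (fun p : ℝ × E4 =>
        Real.exp (Real.exp (p.1 * Real.log (stretch f p.2)) * Real.log ‖p.2‖) •
          f (‖p.2‖⁻¹ • p.2)) (s, y) :=
      (((contDiffAt_fst.mul h1).exp.mul h2).exp).smul h3
    refine h4.congr_of_eventuallyEq ?_
    filter_upwards [hev s y hy] with p hp using polarPerm_apply hS _ _ hp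
  have hfam'1 : fam' 1 = fam 0 := by
    rw [hfam0]
    ext1 y
    rcases eq_or_ne y 0 with rfl | hy
    · rw [(hmem' 1).1, (hS.polarPerm_mem hfp hα hα0).1]
    · change hS.polarPerm _ _ _ y = _
      rw [polarPerm_apply hS _ _ hy, polarPerm_apply hS _ _ hy, one_mul, Real.exp_log (hα0 y hy)]
  have hg : ∀ y, fam' 0 y = ‖y‖ • f (‖y‖⁻¹ • y) := by
    intro y
    rcases eq_or_ne y 0 with rfl | hy
    · rw [(hmem' 0).1]; simp
    · change hS.polarPerm _ _ _ y = _
      rw [polarPerm_apply hS _ _ hy, zero_mul, Real.exp_zero, one_mul,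
        Real.exp_log (norm_pos_iff.2 hy)]
  have hcD : ∀ s, ∀ y ≠ 0, ContinuousAt (fun p : ℝ × E4 => fderiv ℝ (fam' p.1) p.2) (s, y) :=
    fun s y hy => continuousAt_fderiv_of_family (f := fun s => fam' s) hsm' s hy
  refine ⟨fam' 0, det_pos_of_family hmem' hcD (a := 1) (by rwa [hfam'1]) 0, ?_, ?_, ?_⟩
  · intro c hc y
    rw [hg, hg, normalize_smul hc, norm_smul, Real.norm_eq_abs, abs_of_pos hc, smul_smul]
  · intro y
    rcases eq_or_ne y 0 with rfl | hy
    · rw [(hmem' 0).1]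
    · rw [hg, norm_smul, norm_norm,
        (hS.norm_eq_one _).2 (norm_of_mem_unit (normalize_mem_unit hy)), mul_one]
  · intro A hA h0
    have h1 := isot_of_family hmem hc hc' hA h0 1 0
    have h2 := isot_of_smooth_family hmem' hsm' hA h0 1 0
    rw [hfam1] at h1
    rw [hfam'1] at h2
    exact h1.trans h2

/-- Smooth maps of the punctured space that are homogeneous of degree one. -/
structure IsConical (u : E4 → E4) : Prop where
  smooth : PSmooth u
  homog : ∀ c : ℝ, 0 < c → ∀ y, u (c • y) = c • u y
  map_zero : u 0 = 0

namespace IsConical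
variable {u v : E4 → E4}

theorem differentiableAt (hu : IsConical u) {y : E4} (hy : y ≠ 0) : DifferentiableAt ℝ u y :=
  (hu.smooth y hy).differentiableAt (by simp)

theorem fderiv_smul (hu : IsConical u) {c : ℝ} (hc : 0 < c) (y : E4) :
    fderiv ℝ u (c • y) = fderiv ℝ u y := by
  have h1 := fderiv_comp_smul (𝕜 := ℝ) (f := u) (x := y) c
  have h2 : (fun z => u (c • z)) = c • u := funext fun z => hu.homog c hc z
  have := invertibleOfNonzero hc.ne'
  rw [h2, fderiv_const_smul_of_invertible] at h1
  exact (smul_right_injective _ hc.ne' h1).symm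

theorem fderiv_self (hu : IsConical u) {y : E4} (hy : y ≠ 0) : fderiv ℝ u y y = u y := by
  have h1 : HasDerivAt (fun t : ℝ => t • y) y 1 := by
    simpa using (hasDerivAt_id (1 : ℝ)).smul_const y
  have h2 : HasDerivAt (fun t : ℝ => u (t • y)) (fderiv ℝ u y y) 1 :=
    HasFDerivAt.comp_hasDerivAt (1 : ℝ) (by simpa using (hu.differentiableAt hy).hasFDerivAt) h1
  have h3 : HasDerivAt (fun t : ℝ => u (t • y)) (u y) 1 := by
    refine (show HasDerivAt (fun t : ℝ => t • u y) (u y) 1 by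
      simpa using (hasDerivAt_id (1 : ℝ)).smul_const (u y)).congr_of_eventuallyEq ?_
    filter_upwards [lt_mem_nhds one_pos] with t ht using hu.homog t ht y
  exact h2.unique h3

theorem fderiv_normalize (hu : IsConical u) {y : E4} (hy : y ≠ 0) :
    fderiv ℝ u (‖y‖⁻¹ • y) = fderiv ℝ u y :=
  hu.fderiv_smul (inv_pos.2 (norm_pos_iff.2 hy)) y

theorem exists_bound (hu : IsConical u) : ∃ B, 0 < B ∧ ∀ y ≠ 0, ‖fderiv ℝ u y‖ ≤ B := by
  have hc : ContinuousOn (fderiv ℝ u) (sphere (0 : E4) 1) := fun x hx =>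
    ((hu.smooth x (ne_zero_of_mem_unit hx)).continuousAt_fderiv (by simp)).continuousWithinAt
  obtain ⟨B, hB⟩ := (isCompact_sphere (0 : E4) 1).exists_bound_of_continuousOn hc
  refine ⟨max B 1, by positivity, fun y hy => ?_⟩
  rw [← hu.fderiv_normalize hy]
  exact (hB _ (normalize_mem_unit hy)).trans (le_max_left _ _)

theorem comp (hv : IsConical v) (hu : IsConical u) (hu0 : ∀ y ≠ 0, u y ≠ 0) :
    IsConical (v ∘ u) where
  smooth y hy := (hv.smooth _ (hu0 y hy)).comp y (hu.smooth y hy)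
  homog c hc y := by simp only [Function.comp_apply, hu.homog c hc, hv.homog c hc]
  map_zero := by simp [hu.map_zero, hv.map_zero]

theorem lipschitz (hu : IsConical u) {B : ℝ} (hB : ∀ y ≠ 0, ‖fderiv ℝ u y‖ ≤ B) (x y : E4) :
    ‖u x - u y‖ ≤ B * ‖x - y‖ := by
  have hle : ∀ z, ‖u z‖ ≤ B * ‖z‖ := by
    intro z
    rcases eq_or_ne z 0 with rfl | hz
    · simp [hu.map_zero]
    · rw [← hu.fderiv_self hz]
      exact (fderiv ℝ u z).le_of_opNorm_le (hB z hz) z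
  by_cases h0 : (0 : E4) ∈ segment ℝ y x
  · have h1 := dist_add_dist_of_mem_segment h0
    rw [dist_zero_right, dist_zero_left, dist_eq_norm, norm_sub_rev] at h1
    rw [← h1, mul_add, add_comm]
    exact (norm_sub_le _ _).trans (add_le_add (hle x) (hle y))
  · have hne : ∀ z ∈ segment ℝ y x, z ≠ 0 := fun z hz h => h0 (h ▸ hz)
    exact (convex_segment y x).norm_image_sub_le_of_norm_fderiv_le (𝕜 := ℝ)
      (fun z hz => hu.differentiableAt (hne z hz)) (fun z hz => hB z (hne z hz))
      (left_mem_segment ℝ y x) (right_mem_segment ℝ y x)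

theorem exists_isot_id_add (hu : IsConical u) (hB : ∀ y ≠ 0, ‖fderiv ℝ u y‖ ≤ 1 / 2) :
    ∃ h : Equiv.Perm E4, h ∈ puncturedDiffeo ∧ (∀ y, h y = y + u y) ∧
      ∀ A : Set E4, IsCompact A → (0 : E4) ∉ A → Isot A (h '' A) := by
  have hσ0 := Real.smoothTransition.nonneg
  have hσ1 := Real.smoothTransition.le_one
  have happ : ∀ r : ℝ, ApproximatesLinearOn (fun y => y + Real.smoothTransition r • u y)
      ((ContinuousLinearEquiv.refl ℝ E4 : E4 ≃L[ℝ] E4) : E4 →L[ℝ] E4) univ (1 / 2 : NNReal) := by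
    intro r x _ y _
    have h2 : x + Real.smoothTransition r • u x - (y + Real.smoothTransition r • u y) -
        ((ContinuousLinearEquiv.refl ℝ E4 : E4 ≃L[ℝ] E4) : E4 →L[ℝ] E4) (x - y)
        = Real.smoothTransition r • (u x - u y) := by
      simp [smul_sub]; abel
    rw [h2, norm_smul, Real.norm_of_nonneg (hσ0 r)]
    refine (mul_le_of_le_one_left (norm_nonneg _) (hσ1 r)).trans ?_
    simpa using hu.lipschitz hB x y
  have hc : Subsingleton E4 ∨ (1 / 2 : NNReal) <
      ‖((ContinuousLinearEquiv.refl ℝ E4).symm : E4 →L[ℝ] E4)‖₊⁻¹ := by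
    right
    have : ‖((ContinuousLinearEquiv.refl ℝ E4).symm : E4 →L[ℝ] E4)‖₊ = 1 := by
      have h : ‖ContinuousLinearMap.id ℝ E4‖ = 1 := ContinuousLinearMap.norm_id
      exact NNReal.eq h
    rw [this]
    norm_num
  let F : ℝ → Equiv.Perm E4 := fun r => ((happ r).toHomeomorph _ hc).toEquiv
  have hF : ∀ r y, F r y = y + Real.smoothTransition r • u y := fun r y => rfl
  have hmem : ∀ r, F r ∈ puncturedDiffeo := by
    intro r
    refine mem_puncturedDiffeo_of_injective_fderiv (by simp [hF, hu.map_zero])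
      (fun y hy => contDiffAt_id.add (contDiffAt_const (c := Real.smoothTransition r) |>.smul
        (g := u) (hu.smooth y hy))) fun y hy v hv => ?_
    have hd : HasFDerivAt (F r)
        (ContinuousLinearMap.id ℝ E4 + Real.smoothTransition r • fderiv ℝ u y) y :=
      (hasFDerivAt_id y).add ((hu.differentiableAt hy).hasFDerivAt.fun_const_smul _)
    rw [hd.fderiv] at hv
    have h6 : v = -(Real.smoothTransition r • fderiv ℝ u y v) := by
      rw [eq_neg_iff_add_eq_zero]; exact hv
    have h5 : ‖Real.smoothTransition r • fderiv ℝ u y v‖ ≤ 1 / 2 * ‖v‖ := by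
      rw [norm_smul, Real.norm_of_nonneg (hσ0 r)]
      exact (mul_le_of_le_one_left (norm_nonneg _) (hσ1 r)).trans
        ((fderiv ℝ u y).le_of_opNorm_le (hB y hy) v)
    have h7 : ‖v‖ ≤ 1 / 2 * ‖v‖ := by
      conv_lhs => rw [h6]
      rwa [norm_neg]
    exact norm_le_zero_iff.1 (by linarith)
  refine ⟨F 1, hmem 1, fun y => by simp [hF], fun A hA h0 => ?_⟩
  have h := isot_of_smooth_family hmem (fun s y hy => ?_) hA h0 0 1
  · have h1 : ⇑(F 0) = id := funext fun y => by simp [hF]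
    rwa [h1, image_id] at h
  · exact contDiffAt_snd.add ((Real.smoothTransition.contDiffAt.comp (s, y) contDiffAt_fst).smul
      ((hu.smooth y hy).comp (s, y) contDiffAt_snd))

end IsConical

/-- Cutting off, in a thin cone, a conical map vanishing to first order along the axis of the
cone yields a map with small derivative. -/
theorem exists_small_cutoff {k : E4 → E4} (hk : IsConical k) {ν : E4} (hν : ‖ν‖ = 1)
    (hkν : fderiv ℝ k ν = 0) {ε : ℝ} (hε : 0 < ε) :
    ∃ a b : ℝ, a < b ∧ b < 1 ∧ 0 ≤ b ∧ IsConical (fun y => coneCutoff ν a b y • k y) ∧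
      ∀ y ≠ 0, ‖fderiv ℝ (fun y => coneCutoff ν a b y • k y) y‖ ≤ ε := by
  have hne : (∞ : WithTop ℕ∞) ≠ 0 := by simp
  have hν0 : ν ≠ 0 := by rw [← norm_ne_zero_iff, hν]; exact one_ne_zero
  have hστ : ContDiff ℝ ∞ Real.smoothTransition := Real.smoothTransition.contDiff
  obtain ⟨K, hK⟩ := (isCompact_Icc (a := (-2 : ℝ)) (b := 2)).exists_bound_of_continuousOn
    (f := deriv Real.smoothTransition) (hστ.continuous_deriv (by simp)).continuousOn
  have hK0 : 0 ≤ K := (norm_nonneg _).trans (hK 0 (by norm_num))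
  set η := ε / (16 * K + 1) with hη
  have hη0 : 0 < η := by positivity
  have hcont := (hk.smooth ν hν0).continuousAt_fderiv hne
  obtain ⟨r, hr, hball⟩ := Metric.eventually_nhds_iff_ball.1
    ((hcont.norm.eventually (gt_mem_nhds (show ‖fderiv ℝ k ν‖ < η by simpa [hkν] using hη0))).and
      (isOpen_ne.mem_nhds hν0))
  set δ := min (r / 2) 1
  have hδ0 : 0 < δ := by positivity
  have hδ1 : δ ≤ 1 := min_le_right _ _
  have hδr : 2 * δ ≤ r := by linarith [min_le_left (r / 2) 1]
  have hkball : ∀ y, ‖y - ν‖ < r → ‖k y‖ ≤ η * ‖y - ν‖ := by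
    intro y hy
    have hkν0 : k ν = 0 := by rw [← hk.fderiv_self hν0, hkν]; rfl
    have := (convex_ball ν r).norm_image_sub_le_of_norm_fderiv_le (𝕜 := ℝ) (f := k) (C := η)
      (fun z hz => hk.differentiableAt (hball z hz).2) (fun z hz => (hball z hz).1.le)
      (mem_ball_self hr) (by simpa [dist_eq_norm] using hy : y ∈ ball ν r)
    rwa [hkν0, sub_zero] at this
  have hC : IsConical (fun y => coneCutoff ν (1 - δ ^ 2) (1 - δ ^ 2 / 2) y • k y) :=
    { smooth := fun y hy => ((isRadiallyConstant_coneCutoff _ _ _).smooth y hy).smul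
        (hk.smooth y hy)
      homog := fun c hc y => by
        rw [(isRadiallyConstant_coneCutoff _ _ _).homog c hc, hk.homog c hc, smul_comm]
      map_zero := by simp [hk.map_zero] }
  have hδ2 : 0 < δ ^ 2 := by positivity
  have hδ2' : δ ^ 2 ≤ 1 := pow_le_one₀ hδ0.le hδ1
  have hden : (1 - δ ^ 2 / 2) - (1 - δ ^ 2) = δ ^ 2 / 2 := by ring
  refine ⟨1 - δ ^ 2, 1 - δ ^ 2 / 2, by linarith, by linarith, by linarith, hC, ?_⟩
  suffices H : ∀ y, ‖y‖ = 1 →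
      ‖fderiv ℝ (fun y => coneCutoff ν (1 - δ ^ 2) (1 - δ ^ 2 / 2) y • k y) y‖ ≤ ε by
    intro y hy
    rw [← hC.fderiv_normalize hy]
    exact H _ (norm_of_mem_unit (normalize_mem_unit hy))
  intro y hy1
  have hy0 : y ≠ 0 := by rw [← norm_ne_zero_iff, hy1]; exact one_ne_zero
  have hd2 : ‖y - ν‖ ^ 2 = 2 - 2 * inner ℝ y ν := by
    rw [norm_sub_sq_real, hy1, hν]; ring
  rcases le_or_gt (2 * δ) ‖y - ν‖ with h | h
  · have h1 : inner ℝ y ν < 1 - δ ^ 2 := by nlinarith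
    have h2 : (fun y => coneCutoff ν (1 - δ ^ 2) (1 - δ ^ 2 / 2) y • k y) =ᶠ[𝓝 y]
        fun _ => (0 : E4) := by
      have h3 : ∀ᶠ z : E4 in 𝓝 y, inner ℝ z ν < (1 - δ ^ 2) * ‖z‖ :=
        (ContinuousAt.eventually_lt (f := fun z : E4 => inner ℝ z ν)
          (g := fun z : E4 => (1 - δ ^ 2) * ‖z‖) (by fun_prop) (by fun_prop) (by simpa [hy1]))
      filter_upwards [h3, isOpen_ne.mem_nhds hy0] with z hz hz0
      rw [coneCutoff_eq_zero (by linarith) hz0 hz.le, zero_smul]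
    rw [h2.fderiv_eq, fderiv_fun_const]
    simpa using hε.le
  · have hyr : ‖y - ν‖ < r := h.trans_le hδr
    have hinner : HasFDerivAt (fun y : E4 => inner ℝ y ν / ‖y‖)
        (innerSL ℝ ν - inner ℝ y ν • innerSL ℝ y) y := by
      have h1 : HasFDerivAt (fun y : E4 => inner ℝ (‖y‖⁻¹ • y) ν) _ y :=
        (hasFDerivAt_normalize hy1).inner ℝ (hasFDerivAt_const ν y)
      refine (h1.congr_of_eventuallyEq (Filter.Eventually.of_forall fun z => ?_)).congr_fderiv ?_
      · simp only [inner_smul_left, div_eq_inv_mul]; rfl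
      · ext1 v
        simp [hy1, inner_sub_left, inner_smul_left, real_inner_comm, mul_comm]
    set T := innerSL ℝ ν - inner ℝ y ν • innerSL ℝ y with hT
    have hTn : ‖T‖ ≤ 2 * ‖y - ν‖ := by
      have h1 : T = innerSL ℝ ((ν - y) + (1 - inner ℝ y ν) • y) := by
        ext1 v
        simp [hT]
        ring
      have h2 : 1 - inner ℝ y ν = inner ℝ y (y - ν) := by
        rw [inner_sub_right, real_inner_self_eq_norm_sq, hy1, one_pow]
      have h3 : |1 - inner ℝ y ν| ≤ ‖y - ν‖ := by
        rw [h2]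
        exact (abs_real_inner_le_norm _ _).trans (by rw [hy1, one_mul])
      rw [h1, innerSL_apply_norm]
      refine (norm_add_le _ _).trans ?_
      rw [norm_smul, hy1, mul_one, norm_sub_rev, Real.norm_eq_abs]
      linarith
    set τ := (inner ℝ y ν / ‖y‖ - (1 - δ ^ 2)) / ((1 - δ ^ 2 / 2) - (1 - δ ^ 2)) with hτ
    have hτmem : τ ∈ Icc (-2 : ℝ) 2 := by
      have h1 : τ = 2 - ‖y - ν‖ ^ 2 / δ ^ 2 := by
        rw [hτ, hd2, hy1, hden]; field_simp; ring
      have h2 : ‖y - ν‖ ^ 2 / δ ^ 2 ≤ 4 := by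
        rw [div_le_iff₀ hδ2]; nlinarith [norm_nonneg (y - ν)]
      have h3 : 0 ≤ ‖y - ν‖ ^ 2 / δ ^ 2 := by positivity
      constructor <;> linarith
    have hσd : HasFDerivAt (coneCutoff ν (1 - δ ^ 2) (1 - δ ^ 2 / 2))
        (deriv Real.smoothTransition τ • ((2 / δ ^ 2) • T)) y := by
      have h1 : HasFDerivAt (fun y : E4 => (inner ℝ y ν / ‖y‖ - (1 - δ ^ 2)) /
          ((1 - δ ^ 2 / 2) - (1 - δ ^ 2))) ((2 / δ ^ 2) • T) y := by
        have := (hinner.sub_const (1 - δ ^ 2)).mul_const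
          ((1 - δ ^ 2 / 2) - (1 - δ ^ 2))⁻¹
        refine (this.congr_of_eventuallyEq
          (Filter.Eventually.of_forall fun z => ?_)).congr_fderiv ?_
        · simp [div_eq_mul_inv]
        · rw [hden, inv_div]
      exact ((hστ.differentiable hne).differentiableAt.hasDerivAt).comp_hasFDerivAt y h1
    have hD := (hσd.smul (hk.differentiableAt hy0).hasFDerivAt).fderiv
    have hkD : ‖fderiv ℝ k y‖ ≤ η := (hball y (by simpa [dist_eq_norm] using hyr)).1.le
    have hky := hkball y hyr
    have hχ0 : 0 ≤ coneCutoff ν (1 - δ ^ 2) (1 - δ ^ 2 / 2) y := Real.smoothTransition.nonneg _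
    have hχ1 : coneCutoff ν (1 - δ ^ 2) (1 - δ ^ 2 / 2) y ≤ 1 := Real.smoothTransition.le_one _
    refine (congrArg norm hD).trans_le ((norm_add_le _ _).trans ?_)
    rw [norm_smul, Real.norm_of_nonneg hχ0, ContinuousLinearMap.norm_smulRight_apply, norm_smul,
      norm_smul, Real.norm_of_nonneg (by positivity : 0 ≤ 2 / δ ^ 2)]
    have h1 : coneCutoff ν (1 - δ ^ 2) (1 - δ ^ 2 / 2) y * ‖fderiv ℝ k y‖ ≤ η :=
      (mul_le_of_le_one_left (norm_nonneg _) hχ1).trans hkD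
    have h2 : ‖deriv Real.smoothTransition τ‖ * (2 / δ ^ 2 * ‖T‖) * ‖k y‖ ≤
        K * (2 / δ ^ 2 * (2 * (2 * δ))) * (η * (2 * δ)) := by
      gcongr
      · exact hK τ hτmem
      · exact hTn.trans (by gcongr)
      · exact hky.trans (by gcongr)
    have h3 : K * (2 / δ ^ 2 * (2 * (2 * δ))) * (η * (2 * δ)) = 16 * K * η := by
      field_simp; ring
    have h4 : (16 * K + 1) * η = ε := by rw [hη]; field_simp
    linarith

theorem isConical_of_perm {g : Equiv.Perm E4} (hg : g ∈ puncturedDiffeo)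
    (hom : ∀ c : ℝ, 0 < c → ∀ y, g (c • y) = c • g y) : IsConical g ∧ IsConical g.symm where
  left := ⟨hg.2.1, hom, hg.1⟩
  right := ⟨hg.2.2, fun c hc y => by rw [Equiv.symm_apply_eq, hom c hc, Equiv.apply_symm_apply],
    symm_zero hg.1⟩

theorem clm_mem_puncturedDiffeo (L : E4 ≃L[ℝ] E4) :
    (L.toLinearEquiv.toEquiv : Equiv.Perm E4) ∈ puncturedDiffeo :=
  ⟨L.map_zero, fun _ _ => L.contDiff.contDiffAt, fun _ _ => L.symm.contDiff.contDiffAt⟩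

/-- A homogeneous diffeomorphism can be replaced, as far as images of compact sets go, by a
norm-preserving one which fixes a cone. -/
theorem exists_fixing_cone {g : Equiv.Perm E4} (hg : g ∈ orientedDiffeo)
    (hom : ∀ c : ℝ, 0 < c → ∀ y, g (c • y) = c • g y) {ν : E4} (hν : ‖ν‖ = 1) :
    ∃ (h : Equiv.Perm E4) (c : ℝ), h ∈ puncturedDiffeo ∧ 0 ≤ c ∧ c < 1 ∧ (∀ y, ‖h y‖ = ‖y‖) ∧
      (∀ y, c * ‖y‖ < inner ℝ y ν → h y = y) ∧
      ∀ A : Set E4, IsCompact A → (0 : E4) ∉ A → Isot (g '' A) (h '' A) := by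
  have hν0 : ν ≠ 0 := by rw [← norm_ne_zero_iff, hν]; exact one_ne_zero
  have hgc := (isConical_of_perm hg.1 hom).1
  have hdet := hg.2 ν hν0
  set L := (fderiv ℝ g ν).toContinuousLinearEquivOfDetNeZero hdet.ne'
  have hLg : ∀ v, L v = fderiv ℝ g ν v := fun v =>
    ContinuousLinearMap.toContinuousLinearEquivOfDetNeZero_apply _ _ _
  have hLdet : 0 < (L.symm : E4 →L[ℝ] E4).det := by
    have h1 : (L.symm : E4 →L[ℝ] E4).det * (fderiv ℝ g ν).det = 1 := by
      have := L.toLinearEquiv.det_symm_mul_det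
      have h2 : fderiv ℝ g ν = (L : E4 →L[ℝ] E4) := ContinuousLinearMap.ext fun v => (hLg v).symm
      rw [h2]
      exact this
    exact pos_of_mul_pos_left (h1 ▸ one_pos) hdet.le
  set Ls : Equiv.Perm E4 := L.symm.toLinearEquiv.toEquiv
  set g₁ : Equiv.Perm E4 := Ls * g
  have hg₁a : ∀ y, g₁ y = L.symm (g y) := fun y => rfl
  have hg₁mem : g₁ ∈ puncturedDiffeo := mul_mem (clm_mem_puncturedDiffeo L.symm) hg.1
  have hg₁hom : ∀ c : ℝ, 0 < c → ∀ y, g₁ (c • y) = c • g₁ y := fun c hc y => by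
    rw [hg₁a, hg₁a, hom c hc, map_smul]
  obtain ⟨hc₁, hc₁'⟩ := isConical_of_perm hg₁mem hg₁hom
  have hg₁D : fderiv ℝ g₁ ν = ContinuousLinearMap.id ℝ E4 := by
    have h1 : HasFDerivAt g₁ ((L.symm : E4 →L[ℝ] E4).comp (fderiv ℝ g ν)) ν :=
      HasFDerivAt.comp (g := L.symm) ν L.symm.hasFDerivAt (hgc.differentiableAt hν0).hasFDerivAt
    rw [h1.fderiv]
    ext1 v
    simp [← hLg]
  have hk : IsConical fun y => y - g₁ y :=
    { smooth := fun y hy => contDiffAt_id.sub (hc₁.smooth y hy)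
      homog := fun c hc y => by rw [hg₁hom c hc, smul_sub]
      map_zero := by rw [hc₁.map_zero, sub_zero] }
  have hkν : fderiv ℝ (fun y => y - g₁ y) ν = 0 := by
    have h1 : HasFDerivAt (fun y => y - g₁ y) _ ν :=
      (hasFDerivAt_id ν).sub (hc₁.differentiableAt hν0).hasFDerivAt
    rw [h1.fderiv, hg₁D, sub_self]
  obtain ⟨B, hB0, hB⟩ := hc₁'.exists_bound
  obtain ⟨a, b, hab, hb1, hb0, hχ, hχB⟩ := exists_small_cutoff hk hν hkν
    (ε := 1 / 2 / B) (by positivity)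
  have hsymm0 : ∀ y ≠ 0, g₁.symm y ≠ 0 := fun y hy => perm_ne_zero (symm_zero hc₁.map_zero) hy
  have hu := hχ.comp hc₁' hsymm0
  obtain ⟨h₂, hh₂, hh₂a, hh₂i⟩ := hu.exists_isot_id_add fun y hy => by
    rw [fderiv_comp y (hχ.differentiableAt (hsymm0 y hy)) (hc₁'.differentiableAt hy)]
    refine (ContinuousLinearMap.opNorm_comp_le _ _).trans ?_
    calc _ ≤ 1 / 2 / B * B := by
          gcongr
          exacts [hχB _ (hsymm0 y hy), hB y hy]
      _ = 1 / 2 := by field_simp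
  set h₃ : Equiv.Perm E4 := h₂ * g₁ with hh₃
  have hh₃a : ∀ y, h₃ y = g₁ y + coneCutoff ν a b y • (y - g₁ y) := fun y => by
    rw [hh₃, Equiv.Perm.mul_apply, hh₂a, Function.comp_apply, Equiv.symm_apply_apply]
  have hh₃mem : h₃ ∈ puncturedDiffeo := mul_mem hh₂ hg₁mem
  have hh₃hom : ∀ c : ℝ, 0 < c → ∀ y, h₃ (c • y) = c • h₃ y := fun c hc y => by
    have h1 := hχ.homog c hc y
    rw [hh₃a, hh₃a, h1, hg₁hom c hc, smul_add]
  obtain ⟨hc₃, hc₃'⟩ := isConical_of_perm hh₃mem hh₃hom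
  have hsymm3 : ∀ y ≠ 0, h₃.symm y ≠ 0 := fun y hy => perm_ne_zero (symm_zero hc₃.map_zero) hy
  have hl : IsRadiallyConstant fun w => Real.log ‖h₃.symm w‖ - Real.log ‖w‖ :=
    { smooth := fun y hy => (((hc₃'.smooth y hy).norm ℝ (hsymm3 y hy)).log
        (norm_ne_zero_iff.2 (hsymm3 y hy))).sub
        ((contDiffAt_norm ℝ hy).log (norm_ne_zero_iff.2 hy))
      homog := fun c hc y => by
        rcases eq_or_ne y 0 with rfl | hy
        · simp
        · rw [hc₃'.homog c hc, norm_smul, norm_smul, Real.log_mul, Real.log_mul]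
          · ring
          all_goals first | exact norm_ne_zero_iff.2 hc.ne' | exact norm_ne_zero_iff.2 hy |
              exact norm_ne_zero_iff.2 (hsymm3 y hy) }
  have hnorm : ∀ y, ‖(radialPerm _ hl * h₃) y‖ = ‖y‖ := by
    intro y
    rcases eq_or_ne y 0 with rfl | hy
    · rw [(mul_mem (radialPerm_mem hl) hh₃mem).1]
    · have h1 := norm_pos_iff.2 hy
      have h2 := norm_pos_iff.2 (perm_ne_zero hc₃.map_zero hy)
      rw [Equiv.Perm.mul_apply, radialPerm_apply, Equiv.symm_apply_apply, norm_smul,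
        Real.norm_eq_abs, Real.abs_exp, Real.exp_sub, Real.exp_log h1, Real.exp_log h2,
        div_mul_cancel₀ _ h2.ne']
  refine ⟨radialPerm _ hl * h₃, b, mul_mem (radialPerm_mem hl) hh₃mem, hb0, hb1, hnorm, ?_, ?_⟩
  · intro y hy
    have hy0 : y ≠ 0 := by rintro rfl; simp at hy
    have h1 : h₃ y = y := by
      rw [hh₃a, coneCutoff_eq_one hab hy0 hy.le, one_smul, add_sub_cancel]
    rw [Equiv.Perm.mul_apply, h1, radialPerm_apply, (Equiv.symm_apply_eq _).2 h1.symm, sub_self,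
      Real.exp_zero, one_smul]
  · intro A hA h0
    have hAg : ∀ {p : Equiv.Perm E4}, p ∈ puncturedDiffeo → IsCompact (p '' A) ∧
        (0 : E4) ∉ p '' A := fun {p} hp => by
      refine ⟨isCompact_image_of_psmooth hp.2.1 hA h0, ?_⟩
      rintro ⟨y, hy, hy0⟩
      exact perm_ne_zero hp.1 (ne_of_mem_of_not_mem hy h0) hy0
    have e1 : Isot (g '' A) (g₁ '' A) := by
      have := isot_image_clm hLdet (hAg hg.1).1 (hAg hg.1).2
      rwa [image_image] at this
    have e2 : Isot (g₁ '' A) (h₃ '' A) := by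
      have := hh₂i _ (hAg hg₁mem).1 (hAg hg₁mem).2
      rwa [image_image] at this
    have e3 : Isot (h₃ '' A) ((radialPerm _ hl * h₃) '' A) := by
      have := isot_radialPerm hl (hAg hh₃mem).1 (hAg hh₃mem).2
      rwa [image_image] at this
    exact (e1.trans e2).trans e3

/-- A diffeomorphism of the punctured space which preserves the unit sphere does not change the
isotopy class of embedded spheres. -/
theorem IsSphereMap.isot_image {g : E4 → E4} (hg : IsSphereMap g) (h0 : (0 : E4) ∉ g '' sphere 0 1)
    {f : Equiv.Perm E4} (hf : f ∈ orientedDiffeo) (hS : PreservesUnitSphere f) :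
    Isot (g '' sphere 0 1) (f '' (g '' sphere 0 1)) := by
  obtain ⟨ν, hν, hstd⟩ := hg.exists_isot_standard h0
  obtain ⟨g', hg', hom, -, hfg⟩ := exists_homogeneous hf hS
  obtain ⟨h, c, hh, hc0, hc1, hn, hfix, hgh⟩ := exists_fixing_cone hg' hom hν
  obtain ⟨A, hPA, -, hA⟩ := hstd c hc0 hc1
  have hP : IsCompact (g '' sphere 0 1) := hg.isCompact_image
  have hcone : ∀ y, c * ‖h y‖ < inner ℝ (h y) ν ↔ c * ‖y‖ < inner ℝ y ν := fun y => by
    constructor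
    · intro hy
      rwa [h.injective (hfix _ hy)] at hy
    · intro hy
      rwa [hfix y hy]
  have hiff : ∀ y, h y ∈ A ↔ y ∈ A := by
    intro y
    by_cases hy : c * ‖y‖ < inner ℝ y ν
    · rw [hfix y hy]
    · have hy' := (hcone y).not.2 hy
      rcases hA with hA | hA
      · exact iff_of_false (hA _ hy') (hA _ hy)
      · rw [hA _ hy', hA _ hy, hn]
  have hAA : h '' A = A := by
    ext y
    constructor
    · rintro ⟨z, hz, rfl⟩
      exact (hiff z).2 hz
    · intro hy
      exact ⟨h.symm y, (hiff _).1 (by rwa [Equiv.apply_symm_apply]), Equiv.apply_symm_apply _ _⟩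
  have e1 := (hfg _ hP h0).trans (hgh _ hP h0)
  have e2 := hPA.image hh
  rw [hAA] at e2
  exact ((e1.trans e2).trans hPA.symm).symm

/-- The base point of the unit sphere. -/
def basePoint : S3 := ⟨EuclideanSpace.single 0 1, by simp⟩

/-- Radial projection to the unit sphere, with a junk value at the origin. -/
def unitVec (y : E4) : S3 :=
  if h : y = 0 then basePoint else ⟨‖y‖⁻¹ • y, normalize_mem_unit h⟩

theorem coe_unitVec {y : E4} (hy : y ≠ 0) : (unitVec y : E4) = ‖y‖⁻¹ • y := by
  simp [unitVec, hy]

theorem unitVec_coe (x : S3) : unitVec x = x := by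
  have h := norm_of_mem_unit x.2
  have h0 := ne_zero_of_mem_unit x.2
  ext1
  rw [coe_unitVec h0, h, inv_one, one_smul]

theorem unitVec_smul {c : ℝ} (hc : 0 < c) (y : E4) : unitVec (c • y) = unitVec y := by
  rcases eq_or_ne y 0 with rfl | hy
  · simp
  · ext1
    rw [coe_unitVec hy, coe_unitVec (smul_ne_zero hc.ne' hy), normalize_smul hc]

theorem coe_S3_ne_zero (x : S3) : (x : E4) ≠ 0 := ne_zero_of_mem_unit x.2

theorem norm_coe_S3 (x : S3) : ‖(x : E4)‖ = 1 := norm_of_mem_unit x.2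

theorem norm_smul_unitVec {y : E4} (hy : y ≠ 0) : ‖y‖ • (unitVec y : E4) = y := by
  rw [coe_unitVec hy, smul_smul, mul_inv_cancel₀ (norm_ne_zero_iff.2 hy), one_smul]

theorem contMDiffAt_unitVec {y : E4} (hy : y ≠ 0) :
    ContMDiffAt 𝓘(ℝ, E4) (𝓡 3) ∞ unitVec y := by
  have hpos : 0 < ‖y‖ := norm_pos_iff.2 hy
  let χ : ContDiffBump y := ⟨‖y‖ / 4, ‖y‖ / 2, by positivity, by linarith⟩
  let ρ : E4 → E4 := fun z => y + χ z • (z - y)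
  have hρ : ContDiff ℝ ∞ ρ :=
    contDiff_const.add (χ.contDiff.smul (contDiff_id.sub contDiff_const))
  have hne (z : E4) : ρ z ≠ 0 := by
    intro h
    have h1 : ‖χ z • (z - y)‖ = ‖y‖ := by
      rw [← norm_neg y]; congr 1
      exact eq_neg_of_add_eq_zero_right h
    have h2 : ‖χ z • (z - y)‖ ≤ ‖y‖ / 2 := by
      rw [norm_smul, Real.norm_of_nonneg χ.nonneg]
      by_cases hz : dist z y < ‖y‖ / 2
      · rw [← dist_eq_norm]
        nlinarith [χ.le_one (x := z), χ.nonneg (x := z), dist_nonneg (x := z) (y := y)]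
      · rw [χ.zero_of_le_dist (not_lt.1 hz), zero_mul]; positivity
    linarith
  have hsm : ContDiff ℝ ∞ fun z => ‖ρ z‖⁻¹ • ρ z :=
    contDiff_iff_contDiffAt.2 fun z =>
      (contDiffAt_normalize (hne z)).comp z hρ.contDiffAt
  have h2 := ContMDiff.codRestrict_sphere (n := 3) hsm.contMDiff
    fun z => normalize_mem_unit (hne z)
  refine (h2 y).congr_of_eventuallyEq ?_
  filter_upwards [χ.eventuallyEq_one, isOpen_ne.mem_nhds hy] with z hz hz0
  have : ρ z = z := by simp only [ρ]; rw [hz]; simp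
  ext1
  rw [coe_unitVec hz0]
  simp [this]

theorem continuousAt_unitVec {y : E4} (hy : y ≠ 0) : ContinuousAt unitVec y :=
  (contMDiffAt_unitVec hy).continuousAt

/-- Logarithmic polar coordinates, with values in the `n`-fold cover of `V`. -/
def polar (n : ℕ) (y : E4) : V := (Circle.exp (Real.log ‖y‖ / n), unitVec y)

theorem contMDiffAt_polar (n : ℕ) {y : E4} (hy : y ≠ 0) :
    ContMDiffAt 𝓘(ℝ, E4) IV ∞ (polar n) y := by
  refine ContMDiffAt.prodMk ?_ (contMDiffAt_unitVec hy)
  have h1 : ContDiffAt ℝ ∞ (fun y : E4 => Real.log ‖y‖ / n) y :=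
    ((contDiffAt_norm ℝ hy).log (norm_ne_zero_iff.2 hy)).div_const _
  exact contMDiff_circleExp.contMDiffAt.comp y h1.contMDiffAt

theorem continuousAt_polar (n : ℕ) {y : E4} (hy : y ≠ 0) : ContinuousAt (polar n) y :=
  (contMDiffAt_polar n hy).continuousAt

theorem pcovN_polar {n : ℕ} (hn : n ≠ 0) (y : E4) : pcovN n (polar n y) = polar 1 y := by
  have : (n : ℝ) ≠ 0 := by exact_mod_cast hn
  simp only [pcovN, polar, Nat.cast_one, div_one]
  rw [← Circle.exp_nsmul]
  congr 2
  simp; field_simp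

/-- A continuous angle function of a smooth circle-valued map is smooth. -/
theorem contMDiffAt_of_circleExp {E H M : Type*} [NormedAddCommGroup E] [NormedSpace ℝ E]
    [TopologicalSpace H] {I : ModelWithCorners ℝ E H} [TopologicalSpace M] [ChartedSpace H M]
    {u : M → ℝ} {x : M} (hu : ContinuousAt u x)
    (hc : ContMDiffAt I (𝓡 1) ∞ (fun q => Circle.exp (u q)) x) :
    ContMDiffAt I 𝓘(ℝ, ℝ) ∞ u x := by
  have h1 : ContMDiffAt I (𝓡 1) ∞ (fun q => Circle.exp (u q) * Circle.exp (-u x)) x :=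
    hc.mul contMDiffAt_const
  have := finrank_real_complex_fact'
  have h2 : ContMDiffAt I 𝓘(ℝ, ℂ) ∞
      (fun q => ((Circle.exp (u q) * Circle.exp (-u x) : Circle) : ℂ)) x :=
    (contMDiff_coe_sphere (E := ℂ) (n := 1) (m := ∞)).contMDiffAt.comp x h1
  have h3 : ContDiffAt ℝ ∞ (fun z : ℂ => (Complex.log z).im) 1 :=
    Complex.imCLM.contDiff.contDiffAt.comp (1 : ℂ)
      ((Complex.contDiffAt_log (n := ∞) (by simp)).restrict_scalars ℝ)
  have h4 : ContMDiffAt I 𝓘(ℝ, ℝ) ∞ (fun q => u x + (Complex.log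
      ((Circle.exp (u q) * Circle.exp (-u x) : Circle) : ℂ)).im) x := by
    refine contMDiffAt_const.add ?_
    refine ContMDiffAt.comp x (g := fun z : ℂ => (Complex.log z).im) ?_ h2
    rw [← Circle.exp_add]
    simpa using h3.contMDiffAt
  refine h4.congr_of_eventuallyEq ?_
  have h5 : ∀ᶠ q in 𝓝 x, u q - u x ∈ Ioo (-Real.pi) Real.pi := by
    have : ContinuousAt (fun q => u q - u x) x := hu.sub continuousAt_const
    refine this.eventually_mem (Ioo_mem_nhds ?_ ?_) <;> simp [Real.pi_pos]
  filter_upwards [h5] with q hq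
  rw [← Circle.exp_add, Circle.coe_exp, ← sub_eq_add_neg, Complex.log_im,
    Complex.arg_exp_mul_I, toIocMod_eq_self _ |>.2]
  · ring
  · exact ⟨hq.1, by linarith [hq.2]⟩

/-- `u` is the change of angle, in the circle factor, of a self-map of `V`. -/
structure IsWinding (φ : V → V) (u : V → ℝ) : Prop where
  continuous : Continuous u
  apply_fst : ∀ q, (φ q).1 = q.1 * Circle.exp (u q)

namespace IsWinding
variable {φ : V → V} {u : V → ℝ}

theorem add_const (h : IsWinding φ u) {θ : ℝ} (hθ : Circle.exp θ = 1) :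
    IsWinding φ fun q => u q + θ :=
  ⟨h.continuous.add continuous_const, fun q => by rw [h.apply_fst, Circle.exp_add, hθ, mul_one]⟩

theorem inverse {φ' : V → V} (h : IsWinding φ u) (hc : Continuous φ')
    (hr : Function.RightInverse φ' φ) : IsWinding φ' fun q => -u (φ' q) := by
  refine ⟨(h.continuous.comp hc).neg, fun q => ?_⟩
  have h1 := h.apply_fst (φ' q)
  rw [hr q] at h1
  rw [h1, mul_assoc, ← Circle.exp_add]
  simp

theorem exists_abs_le (h : IsWinding φ u) : ∃ K, ∀ q, |u q| ≤ K := by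
  obtain ⟨K, hK⟩ := isCompact_univ.exists_bound_of_continuousOn (f := u)
    h.continuous.continuousOn
  exact ⟨K, fun q => hK q (mem_univ q)⟩

end IsWinding

/-- The lift of a self-map of the `n`-fold cover of `V` to the punctured space. -/
def polarLift (n : ℕ) (φ : V → V) (u : V → ℝ) (y : E4) : E4 :=
  if y = 0 then 0
  else (Real.exp (n * u (polar n y)) * ‖y‖) • ((φ (polar n y)).2 : E4)

section polarLift
variable {n : ℕ} {φ : V → V} {u : V → ℝ}

theorem polarLift_zero : polarLift n φ u 0 = 0 := if_pos rfl

theorem polarLift_apply {y : E4} (hy : y ≠ 0) : polarLift n φ u y =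
    (Real.exp (n * u (polar n y)) * ‖y‖) • ((φ (polar n y)).2 : E4) := if_neg hy

theorem norm_polarLift (y : E4) :
    ‖polarLift n φ u y‖ = Real.exp (n * u (polar n y)) * ‖y‖ := by
  rcases eq_or_ne y 0 with rfl | hy
  · simp [polarLift_zero]
  · rw [polarLift_apply hy, norm_smul, norm_coe_S3, mul_one, Real.norm_of_nonneg (by positivity)]

theorem polarLift_ne_zero {y : E4} (hy : y ≠ 0) : polarLift n φ u y ≠ 0 := by
  rw [← norm_pos_iff, norm_polarLift]
  positivity

theorem polar_polarLift (hn : n ≠ 0) (hu : ∀ q, (φ q).1 = q.1 * Circle.exp (u q)) {y : E4}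
    (hy : y ≠ 0) : polar n (polarLift n φ u y) = φ (polar n y) := by
  have hpos : 0 < ‖y‖ := norm_pos_iff.2 hy
  have hn' : (n : ℝ) ≠ 0 := by exact_mod_cast hn
  ext1
  · rw [hu]
    simp only [polar, norm_polarLift]
    rw [Real.log_mul (Real.exp_pos _).ne' hpos.ne', Real.log_exp, ← Circle.exp_add]
    congr 1
    field_simp
    ring
  · change unitVec _ = _
    rw [polarLift_apply hy, unitVec_smul (by positivity), unitVec_coe]

theorem polarLift_add_const (θ : ℝ) (y : E4) :
    polarLift n φ (fun q => u q + θ) y = Real.exp (n * θ) • polarLift n φ u y := by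
  rcases eq_or_ne y 0 with rfl | hy
  · simp [polarLift_zero]
  · rw [polarLift_apply hy, polarLift_apply hy, smul_smul, mul_add, Real.exp_add]
    congr 1
    ring

theorem polarLift_polarLift {φ' : V → V} (hn : n ≠ 0)
    (hu : ∀ q, (φ q).1 = q.1 * Circle.exp (u q)) {u' : V → ℝ}
    (hl : Function.LeftInverse φ' φ) (hu' : ∀ q, u' (φ q) = -u q) (y : E4) :
    polarLift n φ' u' (polarLift n φ u y) = y := by
  rcases eq_or_ne y 0 with rfl | hy
  · simp [polarLift_zero]
  · rw [polarLift_apply (polarLift_ne_zero hy), polar_polarLift hn hu hy, hl, hu', norm_polarLift,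
      ← mul_assoc, ← Real.exp_add]
    simp only [polar]
    simpa using norm_smul_unitVec hy

theorem polar_exp_smul (hn : n ≠ 0) (m : ℤ) (y : E4) :
    polar n (Real.exp (n * (2 * Real.pi * m)) • y) = polar n y := by
  have hn' : (n : ℝ) ≠ 0 := by exact_mod_cast hn
  rcases eq_or_ne y 0 with rfl | hy
  · simp
  have hpos : ‖y‖ ≠ 0 := norm_ne_zero_iff.2 hy
  simp only [polar, unitVec_smul (Real.exp_pos _)]
  rw [norm_smul, Real.norm_of_nonneg (Real.exp_pos _).le, Real.log_mul (Real.exp_pos _).ne' hpos,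
    Real.log_exp, add_div, Circle.exp_add, mul_div_cancel_left₀ _ hn', mul_comm (2 * Real.pi),
    Circle.exp_int_mul_two_pi, one_mul]

theorem polarLift_exp_smul (hn : n ≠ 0) (m : ℤ) (y : E4) :
    polarLift n φ u (Real.exp (n * (2 * Real.pi * m)) • y) =
      Real.exp (n * (2 * Real.pi * m)) • polarLift n φ u y := by
  rcases eq_or_ne y 0 with rfl | hy
  · simp [polarLift_zero]
  rw [polarLift_apply hy, polarLift_apply (smul_ne_zero (Real.exp_pos _).ne' hy),
    polar_exp_smul hn, smul_smul, norm_smul, Real.norm_of_nonneg (Real.exp_pos _).le]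
  congr 1
  ring

end polarLift

section family
variable {Φ : ℝ → V → V} {w : ℝ → V → ℝ}

theorem continuousAt_polarLift_family (hΦ : Continuous fun p : ℝ × V => Φ p.1 p.2)
    (hw : Continuous fun p : ℝ × V => w p.1 p.2) (n : ℕ) (s : ℝ) {y : E4} (hy : y ≠ 0) :
    ContinuousAt (fun p : ℝ × E4 => polarLift n (Φ p.1) (w p.1) p.2) (s, y) := by
  have h0 : ContinuousAt (fun p : ℝ × E4 => (p.1, polar n p.2)) (s, y) :=
    continuousAt_fst.prodMk
      (ContinuousAt.comp (f := Prod.snd) (g := polar n) (continuousAt_polar n hy) continuousAt_snd)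
  have h1 : ContinuousAt (fun p : ℝ × E4 => Φ p.1 (polar n p.2)) (s, y) :=
    ContinuousAt.comp (f := fun p : ℝ × E4 => (p.1, polar n p.2))
      (g := fun p : ℝ × V => Φ p.1 p.2) hΦ.continuousAt h0
  have h2 : ContinuousAt (fun p : ℝ × E4 => w p.1 (polar n p.2)) (s, y) :=
    ContinuousAt.comp (f := fun p : ℝ × E4 => (p.1, polar n p.2))
      (g := fun p : ℝ × V => w p.1 p.2) hw.continuousAt h0
  have h3 : ContinuousAt (fun p : ℝ × E4 =>
      (Real.exp (n * w p.1 (polar n p.2)) * ‖p.2‖) • ((Φ p.1 (polar n p.2)).2 : E4)) (s, y) :=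
    ((Real.continuous_exp.continuousAt.comp (continuousAt_const.mul h2)).mul
      continuousAt_snd.norm).smul
      ((continuous_subtype_val.comp continuous_snd).continuousAt.comp h1)
  refine h3.congr ?_
  filter_upwards [(isOpen_ne.preimage continuous_snd).mem_nhds hy] with p hp
  exact (polarLift_apply hp).symm

theorem contDiffAt_polarLift_family
    (hΦ : ContMDiff (𝓘(ℝ, ℝ).prod IV) IV ∞ fun p : ℝ × V => Φ p.1 p.2)
    (hw : Continuous fun p : ℝ × V => w p.1 p.2)
    (hu : ∀ s q, (Φ s q).1 = q.1 * Circle.exp (w s q)) (n : ℕ) (s : ℝ) {y : E4} (hy : y ≠ 0) :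
    ContDiffAt ℝ ∞ (fun p : ℝ × E4 => polarLift n (Φ p.1) (w p.1) p.2) (s, y) := by
  have hsnd : ContMDiffAt 𝓘(ℝ, ℝ × E4) 𝓘(ℝ, E4) ∞ (Prod.snd : ℝ × E4 → E4) (s, y) :=
    contDiffAt_snd.contMDiffAt
  have h0 : ContMDiffAt 𝓘(ℝ, ℝ × E4) (𝓘(ℝ, ℝ).prod IV) ∞
      (fun p : ℝ × E4 => (p.1, polar n p.2)) (s, y) :=
    ContMDiffAt.prodMk contDiffAt_fst.contMDiffAt
      (ContMDiffAt.comp (s, y) (g := polar n) (contMDiffAt_polar n hy) hsnd)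
  have h1 : ContMDiffAt 𝓘(ℝ, ℝ × E4) IV ∞
      (fun p : ℝ × E4 => Φ p.1 (polar n p.2)) (s, y) :=
    ContMDiffAt.comp (s, y) (g := fun p : ℝ × V => Φ p.1 p.2) hΦ.contMDiffAt h0
  have hexp : ContMDiff (𝓘(ℝ, ℝ).prod IV) (𝓡 1) ∞
      fun p : ℝ × V => Circle.exp (w p.1 p.2) := by
    have h2 : ContMDiff (𝓘(ℝ, ℝ).prod IV) (𝓡 1) ∞
        fun p : ℝ × V => p.2.1⁻¹ * (Φ p.1 p.2).1 :=
      (contMDiff_fst.comp contMDiff_snd).inv.mul (contMDiff_fst.comp hΦ)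
    refine h2.congr fun p => ?_
    rw [hu, inv_mul_cancel_left]
  have h2 : ContMDiffAt 𝓘(ℝ, ℝ × E4) 𝓘(ℝ, ℝ) ∞
      (fun p : ℝ × E4 => w p.1 (polar n p.2)) (s, y) :=
    ContMDiffAt.comp (s, y) (g := fun p : ℝ × V => w p.1 p.2)
      (contMDiffAt_of_circleExp hw.continuousAt hexp.contMDiffAt) h0
  have h3 : ContMDiffAt 𝓘(ℝ, ℝ × E4) 𝓘(ℝ, E4) ∞
      (fun p : ℝ × E4 => ((Φ p.1 (polar n p.2)).2 : E4)) (s, y) :=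
    contMDiff_coe_sphere.contMDiffAt.comp (s, y) (contMDiff_snd.contMDiffAt.comp (s, y) h1)
  have h4 : ContDiffAt ℝ ∞ (fun p : ℝ × E4 =>
      (Real.exp (n * w p.1 (polar n p.2)) * ‖p.2‖) • ((Φ p.1 (polar n p.2)).2 : E4)) (s, y) :=
    ((contDiffAt_const.mul h2.contDiffAt).exp.mul
      (ContDiffAt.comp (s, y) (g := fun z : E4 => ‖z‖) (contDiffAt_norm ℝ hy)
        contDiffAt_snd)).smul h3.contDiffAt
  refine h4.congr_of_eventuallyEq ?_
  filter_upwards [(isOpen_ne.preimage continuous_snd).mem_nhds hy] with p hp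
  exact polarLift_apply hp

end family

theorem psmooth_polarLift {φ : V → V} {u : V → ℝ} (n : ℕ) (hφ : ContMDiff IV IV ∞ φ)
    (hu : IsWinding φ u) : PSmooth (polarLift n φ u) := fun y hy =>
  ContDiffAt.comp y (f := fun z => ((0 : ℝ), z))
    (contDiffAt_polarLift_family (Φ := fun _ => φ) (w := fun _ => u) (hφ.comp contMDiff_snd)
      (hu.continuous.comp continuous_snd) (fun _ => hu.apply_fst) n 0 hy)
    (contDiffAt_const.prodMk contDiffAt_id)

/-- The lift of a bijection of the `n`-fold cover of `V` to the punctured space. -/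
def liftPerm {n : ℕ} (hn : n ≠ 0) (φ : Equiv.Perm V) (u : V → ℝ) (hu : IsWinding φ u) :
    Equiv.Perm E4 where
  toFun := polarLift n φ u
  invFun := polarLift n φ.symm fun q => -u (φ.symm q)
  left_inv := polarLift_polarLift hn hu.apply_fst φ.symm_apply_apply fun q => by simp
  right_inv := by
    refine polarLift_polarLift hn (fun q => ?_) φ.apply_symm_apply fun q => by simp
    have h1 := hu.apply_fst (φ.symm q)
    rw [φ.apply_symm_apply] at h1
    rw [h1, mul_assoc, ← Circle.exp_add]
    simp

section liftPerm
variable {n : ℕ} {hn : n ≠ 0} {φ : Equiv.Perm V} {u : V → ℝ} {hu : IsWinding φ u}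

theorem liftPerm_apply (y : E4) : liftPerm hn φ u hu y = polarLift n φ u y := rfl

theorem liftPerm_mem (hφ : ContMDiff IV IV ∞ φ) (hφ' : ContMDiff IV IV ∞ φ.symm) :
    liftPerm hn φ u hu ∈ puncturedDiffeo :=
  ⟨polarLift_zero, psmooth_polarLift n hφ hu,
    psmooth_polarLift n hφ' (hu.inverse hφ'.continuous φ.apply_symm_apply)⟩

end liftPerm

theorem exists_winding_family {h : ℝ → V → V} (hc : Continuous fun p : ℝ × V => h p.1 p.2)
    (h0 : ∀ s ≤ 0, ∀ q, h s q = q) (h1 : ∀ s ≥ 1, ∀ q, h s q = h 1 q) :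
    ∃ w : ℝ → V → ℝ, (Continuous fun p : ℝ × V => w p.1 p.2) ∧ (∀ s ≤ 0, ∀ q, w s q = 0) ∧
      (∀ s ≥ 1, ∀ q, w s q = w 1 q) ∧ (∀ s, IsWinding (h s) (w s)) ∧ ∃ K, ∀ s q, |w s q| ≤ K := by
  let H : C(unitInterval × V, Circle) :=
    ⟨fun p => p.2.1⁻¹ * (h (p.1 : ℝ) p.2).1, by
      have h2 : Continuous fun p : unitInterval × V => h p.1 p.2 :=
        hc.comp ((continuous_subtype_val.comp continuous_fst).prodMk continuous_snd)
      exact (continuous_fst.comp continuous_snd).inv.mul (continuous_fst.comp h2)⟩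
  have hH0 : ∀ q, H (0, q) = Circle.exp ((ContinuousMap.const V (0 : ℝ)) q) := fun q => by
    simp [H, h0]
  let W := Circle.isCoveringMap_exp.liftHomotopy H (ContinuousMap.const V 0) hH0
  have hW (p) : Circle.exp (W p) = H p :=
    congrFun (Circle.isCoveringMap_exp.liftHomotopy_lifts H _ hH0) p
  have hW0 (q) : W (0, q) = 0 := Circle.isCoveringMap_exp.liftHomotopy_zero H _ hH0 q
  set π : ℝ → unitInterval := projIcc 0 1 zero_le_one with hπ_def
  have hw : Continuous fun p : ℝ × V => W (π p.1, p.2) :=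
    W.continuous.comp ((continuous_projIcc.comp continuous_fst).prodMk continuous_snd)
  have hπ (s : ℝ) (q : V) : h (π s : ℝ) q = h s q := by
    rcases le_total s 0 with hs | hs
    · simp only [hπ_def]
      rw [projIcc_of_le_left _ hs, h0 s hs]
      exact h0 0 le_rfl q
    rcases le_total 1 s with hs' | hs'
    · simp only [hπ_def]
      rw [projIcc_of_right_le _ hs', h1 s hs']
    · have h3 : (π s : ℝ) = s := congrArg Subtype.val (projIcc_of_mem zero_le_one ⟨hs, hs'⟩)
      rw [h3]
  refine ⟨fun s q => W (π s, q), hw, fun s hs q => ?_, fun s hs q => ?_,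
    fun s => ⟨W.continuous.comp (continuous_const.prodMk continuous_id), fun q => ?_⟩, ?_⟩
  · simp only [hπ_def]
    rw [projIcc_of_le_left _ hs]
    exact hW0 q
  · simp only [hπ_def]
    rw [projIcc_of_right_le _ hs, projIcc_of_right_le _ le_rfl]
  · rw [hW]
    simp [H, hπ]
  · obtain ⟨K, hK⟩ := isCompact_univ.exists_bound_of_continuousOn (f := W) W.continuous.continuousOn
    exact ⟨K, fun s q => hK _ (mem_univ _)⟩

theorem norm_polarLift_le {φ : V → V} {u : V → ℝ} (n : ℕ) {K : ℝ} (hK : ∀ q, |u q| ≤ K) (y : E4) :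
    ‖polarLift n φ u y‖ ≤ Real.exp (n * K) * ‖y‖ := by
  rw [norm_polarLift]
  gcongr
  exact (le_abs_self _).trans (hK _)

theorem le_norm_polarLift {φ : V → V} {u : V → ℝ} (n : ℕ) {K : ℝ} (hK : ∀ q, |u q| ≤ K) (y : E4) :
    ‖y‖ ≤ Real.exp (n * K) * ‖polarLift n φ u y‖ := by
  rw [norm_polarLift, ← mul_assoc, ← Real.exp_add, ← mul_add]
  refine le_mul_of_one_le_left (norm_nonneg _) (Real.one_le_exp ?_)
  have := neg_abs_le (u (polar n y))
  have := hK (polar n y)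
  have : (0 : ℝ) ≤ n := Nat.cast_nonneg n
  apply mul_nonneg this
  linarith

theorem polarLift_eq_self {n : ℕ} {φ : V → V} {u : V → ℝ} (h : ∀ q, φ q = q) (hu : ∀ q, u q = 0)
    (y : E4) : polarLift n φ u y = y := by
  rcases eq_or_ne y 0 with rfl | hy
  · exact polarLift_zero
  · rw [polarLift_apply hy, h, hu, mul_zero, Real.exp_zero, one_mul]
    exact norm_smul_unitVec hy

theorem exists_perm_of_isDiffeoB {φ : V → V} (h : IsDiffeoB IV IV φ) :
    ∃ e : Equiv.Perm V, e = φ ∧ ContMDiff IV IV ∞ e ∧ ContMDiff IV IV ∞ e.symm := by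
  obtain ⟨h1, g, h2, h3, h4⟩ := h
  exact ⟨⟨φ, g, h3, h4⟩, rfl, h1, h2⟩

/-- A diffeomorphism homotopic to the identity lifts to an orientation-preserving one. -/
theorem exists_oriented_liftPerm {φ : Equiv.Perm V} (h : InDiff0 φ) :
    ∃ (u : V → ℝ) (hu : IsWinding φ u), liftPerm one_ne_zero φ u hu ∈ orientedDiffeo := by
  obtain ⟨⟨hs, g, hg, hgl, hgr⟩, hc, ⟨H⟩⟩ := h
  have hsymm : ContMDiff IV IV ∞ φ.symm := by
    refine hg.congr fun q => ?_
    rw [Equiv.symm_apply_eq, hgr]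
  let h : ℝ → V → V := fun s q => H.symm (projIcc 0 1 zero_le_one s, q)
  have hhc : Continuous fun p : ℝ × V => h p.1 p.2 :=
    H.symm.continuous.comp ((continuous_projIcc.comp continuous_fst).prodMk continuous_snd)
  have hh1 (q) : h 1 q = φ q := by
    simp only [h]
    rw [projIcc_of_right_le _ le_rfl]
    exact H.symm.apply_one q
  have hh1' : ∀ s ≥ 1, ∀ q, h s q = h 1 q := fun s hs q => by
    simp only [h]
    rw [projIcc_of_right_le _ hs, projIcc_of_right_le _ le_rfl]
  have hh0 : ∀ s ≤ 0, ∀ q, h s q = q := fun s hs q => by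
    simp only [h]
    rw [projIcc_of_le_left _ hs]
    exact H.symm.apply_zero q
  obtain ⟨w, hw, hw0, hw1, hwind, K, hK⟩ := exists_winding_family hhc hh0 hh1'
  have hh1f : h 1 = φ := funext hh1
  have hu : IsWinding φ (w 1) := hh1f ▸ hwind 1
  have hmem : liftPerm one_ne_zero φ (w 1) hu ∈ puncturedDiffeo := liftPerm_mem hs hsymm
  refine ⟨w 1, hu, hmem, fun y hy => ?_⟩
  refine det_fderiv_pos_of_homotopy hmem
    (H := fun p => polarLift 1 (h p.1) (w p.1) p.2)
    (fun s y hy => continuousAt_polarLift_family hhc hw 1 s hy)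
    (fun s hs y _ => polarLift_eq_self (hh0 s hs) (hw0 s hs) y) (fun s hs y _ => ?_)
    (C := Real.exp ((1 : ℕ) * K)) (Real.exp_pos _)
    (fun s y _ => le_norm_polarLift 1 (hK s) y) (fun s y _ => norm_polarLift_le 1 (hK s) y) hy
  have e1 : h s = φ := funext fun q => (hh1' s hs q).trans (hh1 q)
  have e2 : w s = w 1 := funext (hw1 s hs)
  simp only [liftPerm_apply, e1, e2]

/-- The time-one map of an ambient isotopy lifts to a diffeomorphism of the punctured space which
moves compact sets by compactly supported isotopies. -/
theorem exists_lift_of_ambientIsotopy {F : ℝ → V → V} (hF : IsAmbientIsotopy IV F) {n : ℕ}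
    (hn : n ≠ 0) : ∃ (φ : Equiv.Perm V) (u : V → ℝ) (hu : IsWinding φ u), φ = F 1 ∧
      liftPerm hn φ u hu ∈ orientedDiffeo ∧
      ∀ A, IsCompact A → (0 : E4) ∉ A → Isot A (liftPerm hn φ u hu '' A) := by
  obtain ⟨hF0, -, hFs, G, hG, hGs⟩ := hF
  let σ := Real.smoothTransition
  let e : ℝ → Equiv.Perm V := fun s => ⟨F (σ s), G (σ s), (hG _).1, (hG _).2⟩
  have hσ : ContMDiff (𝓘(ℝ, ℝ).prod IV) (𝓘(ℝ, ℝ).prod IV) ∞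
      fun p : ℝ × V => (σ p.1, p.2) :=
    ContMDiff.prodMk (Real.smoothTransition.contDiff.contMDiff.comp contMDiff_fst) contMDiff_snd
  have he : ContMDiff (𝓘(ℝ, ℝ).prod IV) IV ∞ fun p : ℝ × V => e p.1 p.2 := hFs.comp hσ
  have he' : ContMDiff (𝓘(ℝ, ℝ).prod IV) IV ∞ fun p : ℝ × V => (e p.1).symm p.2 := hGs.comp hσ
  have he0 : ∀ s ≤ 0, ∀ q, e s q = q := fun s hs q => by
    change F (σ s) q = q
    simp only [σ]
    rw [Real.smoothTransition.zero_of_nonpos hs, hF0, id]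
  have he1 : ∀ s ≥ 1, ∀ q, e s q = F 1 q := fun s hs q => by
    change F (σ s) q = _
    simp only [σ]
    rw [Real.smoothTransition.one_of_one_le hs]
  obtain ⟨w, hw, hw0, hw1, hwind, -⟩ := exists_winding_family (h := fun s => e s) he.continuous he0
    fun s hs q => (he1 s hs q).trans (he1 1 le_rfl q).symm
  have hslice (s : ℝ) : ContMDiff IV (𝓘(ℝ, ℝ).prod IV) ∞ fun q : V => (s, q) :=
    ContMDiff.prodMk contMDiff_const contMDiff_id
  have hmem (s : ℝ) : liftPerm hn (e s) (w s) (hwind s) ∈ puncturedDiffeo :=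
    liftPerm_mem (he.comp (hslice s)) (he'.comp (hslice s))
  have hsm (s : ℝ) (y : E4) (hy : y ≠ 0) : ContDiffAt ℝ ∞
      (fun p : ℝ × E4 => liftPerm hn (e p.1) (w p.1) (hwind p.1) p.2) (s, y) :=
    contDiffAt_polarLift_family he hw (fun s => (hwind s).apply_fst) n s hy
  have hone : liftPerm hn (e 0) (w 0) (hwind 0) = 1 :=
    Equiv.ext fun y => polarLift_eq_self (he0 0 le_rfl) (hw0 0 le_rfl) y
  refine ⟨e 1, w 1, hwind 1, funext (he1 1 le_rfl), ?_, fun A hA h0 => ?_⟩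
  · refine det_pos_of_family (f := fun s => liftPerm hn (e s) (w s) (hwind s)) hmem
      (fun s y hy => continuousAt_fderiv_of_family
        (f := fun s => liftPerm hn (e s) (w s) (hwind s)) hsm s hy) (a := 0) ?_ 1
    simp only [hone]
    exact orientedDiffeo.one_mem
  · have h1 := isot_of_smooth_family (f := fun s => liftPerm hn (e s) (w s) (hwind s))
      hmem hsm hA h0 0 1
    simpa only [hone, Equiv.Perm.coe_one, image_id] using h1

/-- The dilation of ratio `exp t`. -/
def dilation (t : ℝ) : Equiv.Perm E4 where
  toFun y := Real.exp t • y
  invFun y := Real.exp (-t) • y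
  left_inv y := by simp only [smul_smul, ← Real.exp_add, neg_add_cancel, Real.exp_zero, one_smul]
  right_inv y := by simp only [smul_smul, ← Real.exp_add, add_neg_cancel, Real.exp_zero, one_smul]

theorem dilation_apply (t : ℝ) (y : E4) : dilation t y = Real.exp t • y := rfl

theorem dilation_mem (t : ℝ) : dilation t ∈ orientedDiffeo := by
  refine ⟨⟨smul_zero (Real.exp t), fun y _ => (contDiff_id.const_smul (Real.exp t)).contDiffAt,
    fun y _ => (contDiff_id.const_smul (Real.exp (-t))).contDiffAt⟩, fun y _ => ?_⟩
  have h1 : HasFDerivAt (fun y : E4 => Real.exp t • y)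
      (Real.exp t • ContinuousLinearMap.id ℝ E4) y := (hasFDerivAt_id y).fun_const_smul _
  have h2 : fderiv ℝ (dilation t) y = Real.exp t • ContinuousLinearMap.id ℝ E4 := h1.fderiv
  rw [h2, ContinuousLinearMap.det, ContinuousLinearMap.toLinearMap_smul, LinearMap.det_smul]
  simp
  positivity

theorem eq_of_isPreconnected_of_countable {X Y : Type*} [TopologicalSpace X] [MetricSpace Y]
    {s : Set X} (hs : IsPreconnected s) {T : Set Y} (hT : T.Countable) {g : X → Y}
    (hg : ContinuousOn g s) (hm : MapsTo g s T) {x y : X} (hx : x ∈ s) (hy : y ∈ s) : g x = g y :=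
  hT.isTotallyDisconnected _ hm.image_subset (hs.image g hg) (mem_image_of_mem g hx)
    (mem_image_of_mem g hy)

theorem countable_roots {n : ℕ} (hn : n ≠ 0) : {z : Circle | z ^ n = 1}.Countable := by
  refine (countable_range fun m : ℤ => Circle.exp (m * (2 * Real.pi) / n)).mono fun z hz => ?_
  have hn' : (n : ℝ) ≠ 0 := by exact_mod_cast hn
  obtain ⟨t, rfl⟩ := Circle.exp_surjective z
  rw [mem_ofPred_eq, ← Circle.exp_nsmul, Circle.exp_eq_one] at hz
  obtain ⟨m, hm⟩ := hz
  refine ⟨m, ?_⟩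
  simp only
  rw [← hm, nsmul_eq_mul, mul_div_cancel_left₀ _ hn']

theorem isPreconnected_univ_S3 : IsPreconnected (univ : Set S3) := by
  have h : IsPreconnected (sphere (0 : E4) 1) := isPreconnected_sphere (by
    rw [← finrank_eq_rank]; simp) _ _
  have := isPreconnected_iff_preconnectedSpace.1 h
  exact isPreconnected_univ

theorem isPreconnected_univ_V : IsPreconnected (univ : Set V) := by
  have h : IsPreconnected (univ : Set Circle) := by
    rw [← Circle.exp_surjective.range_eq]
    exact isPreconnected_range Circle.exp.continuous
  rw [← univ_prod_univ]
  exact h.prod isPreconnected_univ_S3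

theorem lift_apply_snd {n : ℕ} {φ φh : V → V} (h : IsLiftN n φ φh) (q : V) :
    (φh q).2 = (φ (pcovN n q)).2 := by
  rw [← h.2 q]
  rfl

theorem continuous_pcovN (n : ℕ) : Continuous (pcovN n) :=
  (continuous_fst.pow n).prodMk continuous_snd

/-- The winding of a lift is determined by the winding of the map. -/
theorem exists_winding_lift {n : ℕ} (hn : n ≠ 0) {φ φh : V → V} (h : IsLiftN n φ φh) {u : V → ℝ}
    (hu : IsWinding φ u) : ∃ θ : ℝ, Circle.exp (n * θ) = 1 ∧
      IsWinding φh fun q => u (pcovN n q) / n + θ := by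
  have hn' : (n : ℝ) ≠ 0 := by exact_mod_cast hn
  have hcu : Continuous fun q => u (pcovN n q) / n :=
    (hu.continuous.comp (continuous_pcovN n)).div_const _
  let ζ : V → Circle := fun q => (φh q).1 * (q.1 * Circle.exp (u (pcovN n q) / n))⁻¹
  have hζ : Continuous ζ :=
    (continuous_fst.comp h.1.1.continuous).mul
      (continuous_fst.mul (Circle.exp.continuous.comp hcu)).inv
  have hpow (q) : ζ q ^ n = 1 := by
    have h1 : (φh q).1 ^ n = _ := congrArg Prod.fst (h.2 q)
    rw [hu.apply_fst] at h1
    simp only [ζ]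
    rw [mul_pow, inv_pow, mul_pow, h1, ← Circle.exp_nsmul, nsmul_eq_mul, mul_div_cancel₀ _ hn']
    simp [pcovN]
  obtain ⟨θ, hθ⟩ := Circle.exp_surjective (ζ (1, basePoint))
  refine ⟨θ, ?_, hcu.add continuous_const, fun q => ?_⟩
  · rw [← nsmul_eq_mul, Circle.exp_nsmul, hθ, hpow]
  · have h1 : ζ (1, basePoint) = ζ q :=
      eq_of_isPreconnected_of_countable isPreconnected_univ_V (countable_roots hn)
        hζ.continuousOn (fun q _ => hpow q) (mem_univ _) (mem_univ _)
    rw [Circle.exp_add, hθ, h1]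
    simp only [ζ]
    rw [mul_comm, mul_assoc, mul_comm (q.1), mul_assoc, mul_comm (Circle.exp _) q.1]
    simp

theorem polarLift_lift {n : ℕ} (hn : n ≠ 0) {φ φh : V → V} (h : IsLiftN n φ φh) (u : V → ℝ)
    (θ : ℝ) : polarLift n φh (fun q => u (pcovN n q) / n + θ) =
      polarLift 1 φ fun q => u q + n * θ := by
  have hn' : (n : ℝ) ≠ 0 := by exact_mod_cast hn
  ext1 y
  rcases eq_or_ne y 0 with rfl | hy
  · simp only [polarLift_zero]
  rw [polarLift_apply hy, polarLift_apply hy, lift_apply_snd h, pcovN_polar hn, mul_add,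
    mul_div_cancel₀ _ hn', Nat.cast_one, one_mul]

theorem continuousAt_polarLift_zero {φ : V → V} {u : V → ℝ} (n : ℕ) (hu : IsWinding φ u) :
    ContinuousAt (polarLift n φ u) 0 := by
  obtain ⟨K, hK⟩ := hu.exists_abs_le
  rw [ContinuousAt, polarLift_zero]
  refine squeeze_zero_norm (norm_polarLift_le n hK) ?_
  have : Continuous fun y : E4 => Real.exp (n * K) * ‖y‖ := continuous_const.mul continuous_norm
  simpa using this.tendsto 0

theorem norm_lt_one_of_norm_eq_one {f : E4 → E4} (hf : Continuous f) (h0 : f 0 = 0)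
    (h1 : ∀ y, ‖f y‖ = 1 → ‖y‖ = 1) {y : E4} (hy : ‖y‖ < 1) : ‖f y‖ < 1 := by
  by_contra! h
  obtain ⟨z, hz, hz1⟩ := (convex_ball (0 : E4) 1).isPreconnected.intermediate_value
    (mem_ball_self one_pos) (mem_ball_zero_iff.2 hy) hf.norm.continuousOn
    (show (1 : ℝ) ∈ Icc ‖f 0‖ ‖f y‖ from ⟨by simp [h0], h⟩)
  exact (mem_ball_zero_iff.1 hz).ne (h1 z hz1)

theorem preservesUnitSphere_of_norm_eq_one {f : Equiv.Perm E4} (hf : f ∈ puncturedDiffeo)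
    (hc : ContinuousAt f 0) (hc' : ContinuousAt f.symm 0) (h1 : ∀ y, ‖f y‖ = 1 ↔ ‖y‖ = 1) :
    PreservesUnitSphere f := by
  have hf' : Continuous f := continuous_iff_continuousAt.2 fun y => by
    rcases eq_or_ne y 0 with rfl | hy
    exacts [hc, (hf.2.1 y hy).continuousAt]
  have hf'' : Continuous f.symm := continuous_iff_continuousAt.2 fun y => by
    rcases eq_or_ne y 0 with rfl | hy
    exacts [hc', (hf.2.2 y hy).continuousAt]
  refine ⟨h1, fun y => ⟨fun h => ?_, fun h => norm_lt_one_of_norm_eq_one hf' hf.1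
    (fun y => (h1 y).1) h⟩⟩
  have := norm_lt_one_of_norm_eq_one hf'' (symm_zero hf.1)
    (fun y h => by simpa using (h1 (f.symm y)).2 h) h
  simpa using this

/-- An equivariant diffeomorphism preserving the preimage of a sphere `{z₀} × S³` permutes its
components by a translation. -/
theorem exists_norm_eq_iff {n : ℕ} (hn : n ≠ 0) {f : Equiv.Perm E4} (hf : f ∈ puncturedDiffeo)
    (he : ∀ (m : ℤ) y, f (Real.exp (n * (2 * Real.pi * m)) • y) =
      Real.exp (n * (2 * Real.pi * m)) • f y) {t₀ : ℝ}
    (hS : ∀ y ≠ 0, (polar n (f y)).1 = Circle.exp t₀ ↔ (polar n y).1 = Circle.exp t₀) :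
    ∃ k : ℤ, ∀ y, ‖f y‖ = Real.exp (n * t₀) * Real.exp (n * (2 * Real.pi * k)) ↔
      ‖y‖ = Real.exp (n * t₀) := by
  have hn' : (n : ℝ) ≠ 0 := by exact_mod_cast hn
  have hpolar {y : E4} (hy : y ≠ 0) : (polar n y).1 = Circle.exp t₀ ↔
      ∃ m : ℤ, ‖y‖ = Real.exp (n * t₀) * Real.exp (n * (2 * Real.pi * m)) := by
    have hyp : 0 < ‖y‖ := norm_pos_iff.2 hy
    simp only [polar]
    rw [Circle.exp_eq_exp]
    refine exists_congr fun m => ?_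
    rw [← Real.exp_add, ← Real.exp_log hyp, Real.exp_eq_exp, Real.exp_log hyp, div_eq_iff hn']
    constructor <;> intro h <;> rw [h] <;> ring
  have hR : 0 < Real.exp (n * t₀) := Real.exp_pos _
  set R := Real.exp (n * t₀)
  have hne {y : E4} {r : ℝ} (hr : 0 < r) (h : ‖y‖ = r) : y ≠ 0 := norm_pos_iff.1 (h ▸ hr)
  have hmap : MapsTo (fun y => ‖f y‖) (sphere 0 R)
      (range fun m : ℤ => R * Real.exp (n * (2 * Real.pi * m))) := by
    intro y hy
    have hy' : ‖y‖ = R := by simpa using hy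
    have hy0 := hne hR hy'
    obtain ⟨m, hm⟩ := (hpolar (perm_ne_zero hf.1 hy0)).1 ((hS y hy0).2 ((hpolar hy0).2 ⟨0, by
      simpa using hy'⟩))
    exact ⟨m, hm.symm⟩
  have hpre : IsPreconnected (sphere (0 : E4) R) := isPreconnected_sphere (by
    rw [← finrank_eq_rank]; simp) _ _
  have hx₀ : R • (basePoint : E4) ∈ sphere (0 : E4) R := by
    rw [mem_sphere_zero_iff_norm, norm_smul, norm_coe_S3, mul_one, Real.norm_of_nonneg hR.le]
  obtain ⟨k, hk⟩ := hmap hx₀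
  have hconst {y : E4} (hy : ‖y‖ = R) : ‖f y‖ = R * Real.exp (n * (2 * Real.pi * k)) := by
    simp only at hk
    rw [hk]
    refine eq_of_isPreconnected_of_countable hpre (countable_range _) (fun z hz => ?_) hmap
      (mem_sphere_zero_iff_norm.2 hy) hx₀
    exact (hf.2.1 z (hne hR (by simpa using hz))).continuousAt.norm.continuousWithinAt
  refine ⟨k, fun y => ⟨fun h => ?_, hconst⟩⟩
  have hfy := hne (by positivity) h
  have hy0 : y ≠ 0 := fun h0 => hfy (by rw [h0, hf.1])
  obtain ⟨j, hj⟩ := (hpolar hy0).1 ((hS y hy0).1 ((hpolar hfy).2 ⟨k, h⟩))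
  have h2 : ‖Real.exp (n * (2 * Real.pi * (-j : ℤ))) • y‖ = R := by
    rw [norm_smul, hj, Real.norm_of_nonneg (Real.exp_pos _).le, mul_left_comm, ← Real.exp_add]
    simp
  have h3 := hconst h2
  rw [he, norm_smul, Real.norm_of_nonneg (Real.exp_pos _).le, h] at h3
  have h4 : Real.exp (n * (2 * Real.pi * (-j : ℤ))) = 1 :=
    mul_right_cancel₀ (by positivity) (h3.trans (one_mul _).symm)
  rw [hj, mul_eq_left₀ hR.ne', ← inv_inj, ← Real.exp_neg, inv_one, ← h4]
  congr 1
  push_cast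
  ring

theorem IsSphereMap.const_smul {g : E4 → E4} (hg : IsSphereMap g) {c : ℝ} (hc : c ≠ 0) :
    IsSphereMap fun y => c • g y where
  smooth y hy := (contDiffAt_const (c := c)).fun_smul (hg.smooth y hy)
  homog a ha y := by simp only [hg.homog a ha y]
  inj x hx y hy h := hg.inj hx hy (smul_right_injective _ hc h)
  immersive x hx v hv h := by
    have h1 : HasFDerivAt (fun y => c • g y) (c • fderiv ℝ g x) x :=
      (hg.hasFDerivAt (ne_zero_of_mem_unit hx)).fun_const_smul c
    rw [h1.fderiv] at h
    exact hg.immersive x hx v hv ((smul_eq_zero.1 h).resolve_left hc)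

/-- Maps preserving a round sphere of arbitrary radius act trivially on embedded spheres. -/
theorem IsSphereMap.isot_image_of_norm_eq {g : E4 → E4} (hg : IsSphereMap g)
    (h0 : (0 : E4) ∉ g '' sphere 0 1) {f : Equiv.Perm E4} (hf : f ∈ orientedDiffeo)
    (hc : ContinuousAt f 0) (hc' : ContinuousAt f.symm 0) {t : ℝ}
    (h1 : ∀ y, ‖f y‖ = Real.exp t ↔ ‖y‖ = Real.exp t) :
    Isot (g '' sphere 0 1) (f '' (g '' sphere 0 1)) := by
  let d := dilation t
  have hd : d ∈ orientedDiffeo := dilation_mem t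
  have hdc : Continuous d := continuous_const_smul (Real.exp t)
  have hdc' : Continuous ⇑d⁻¹ := continuous_const_smul (Real.exp (-t))
  have hd0 : d 0 = 0 := smul_zero (Real.exp t)
  let f' := d⁻¹ * f * d
  have hf' : f' ∈ orientedDiffeo :=
    orientedDiffeo.mul_mem (orientedDiffeo.mul_mem (orientedDiffeo.inv_mem hd) hf) hd
  have hg' : IsSphereMap fun y => Real.exp (-t) • g y := hg.const_smul (Real.exp_pos _).ne'
  have himage : (fun y => Real.exp (-t) • g y) '' sphere 0 1 = ⇑d⁻¹ '' (g '' sphere 0 1) := by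
    rw [image_image]; rfl
  have hnorm (y : E4) : ‖d y‖ = Real.exp t * ‖y‖ := by
    rw [dilation_apply, norm_smul, Real.norm_of_nonneg (Real.exp_pos _).le]
  have hnorm' (y : E4) : ‖d⁻¹ y‖ = Real.exp (-t) * ‖y‖ := by
    change ‖Real.exp (-t) • y‖ = _
    rw [norm_smul, Real.norm_of_nonneg (Real.exp_pos _).le]
  have hS : PreservesUnitSphere f' := by
    refine preservesUnitSphere_of_norm_eq_one hf'.1 ?_ ?_ fun y => ?_
    · refine hdc'.continuousAt.comp (f := fun y => f (d y)) (ContinuousAt.comp ?_ hdc.continuousAt)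
      rwa [hd0]
    · change ContinuousAt (fun y => d⁻¹ (f.symm (d y))) 0
      refine hdc'.continuousAt.comp (f := fun y => f.symm (d y))
        (ContinuousAt.comp ?_ hdc.continuousAt)
      rwa [hd0]
    · have h2 : ‖f' y‖ = Real.exp (-t) * ‖f (d y)‖ := hnorm' _
      have h3 := h1 (d y)
      rw [hnorm, mul_eq_left₀ (Real.exp_pos t).ne'] at h3
      rw [h2, ← h3, Real.exp_neg, inv_mul_eq_one₀ (Real.exp_pos t).ne', eq_comm]
  have hz : (0 : E4) ∉ (fun y => Real.exp (-t) • g y) '' sphere 0 1 := by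
    rintro ⟨x, hx, h⟩
    exact h0 ⟨x, hx, (smul_eq_zero.1 h).resolve_left (Real.exp_pos _).ne'⟩
  have h2 := (hg'.isot_image hz hf' hS).image hd.1
  rw [himage, image_image, image_image] at h2
  convert h2 using 1
  · simp
  · simp only [image_image]
    refine image_congr fun y _ => ?_
    simp [f']

theorem continuousAt_liftPerm_symm_zero {n : ℕ} (hn : n ≠ 0) {φ : Equiv.Perm V} {u : V → ℝ}
    (hu : IsWinding φ u) (hφ : Continuous φ) : ContinuousAt (liftPerm hn φ u hu).symm 0 :=
  continuousAt_polarLift_zero n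
    (hu.inverse hφ.continuous_symm_of_equiv_compact_to_t2 φ.apply_symm_apply)

/-- Lifts to a finite cover of diffeomorphisms homotopic to the identity induce
orientation-preserving diffeomorphisms of the punctured space. -/
theorem exists_liftPerm_of_isLiftN {φ φh : V → V} (hφ : InDiff0 φ) {n : ℕ} (hn : n ≠ 0)
    (h : IsLiftN n φ φh) : ∃ (e : Equiv.Perm V) (v : V → ℝ) (hv : IsWinding e v) (u : V → ℝ),
      e = φh ∧ IsWinding φ u ∧ polarLift n e v = polarLift 1 φ u ∧
      liftPerm hn e v hv ∈ orientedDiffeo := by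
  obtain ⟨e₀, rfl, -, -⟩ := exists_perm_of_isDiffeoB hφ.1
  obtain ⟨u, hu, hor⟩ := exists_oriented_liftPerm hφ
  obtain ⟨θ, hθ, hv⟩ := exists_winding_lift hn h hu
  obtain ⟨e, rfl, -, -⟩ := exists_perm_of_isDiffeoB h.1
  refine ⟨e, _, hv, fun q => u q + n * θ, rfl, hu.add_const hθ, polarLift_lift hn h u θ, ?_⟩
  have h1 : liftPerm hn e _ hv = dilation (n * θ) * liftPerm one_ne_zero e₀ u hu := by
    ext1 y
    rw [Equiv.Perm.mul_apply, dilation_apply, liftPerm_apply, liftPerm_apply,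
      polarLift_lift hn h u θ, polarLift_add_const, Nat.cast_one, one_mul]
  rw [h1]
  exact orientedDiffeo.mul_mem (dilation_mem _) hor

/-- S-equivalent maps have lifts to the punctured space which carry every embedded sphere to
isotopic spheres. -/
theorem exists_isot_of_sEquiv {φ ψ : V → V} (hφ : InDiff0 φ) (hψ : InDiff0 ψ) (h : SEquiv φ ψ) :
    ∃ u v : V → ℝ, IsWinding φ u ∧ IsWinding ψ v ∧
      ∀ g : E4 → E4, IsSphereMap g → (0 : E4) ∉ g '' sphere 0 1 →
        Isot (polarLift 1 φ u '' (g '' sphere 0 1)) (polarLift 1 ψ v '' (g '' sphere 0 1)) := by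
  obtain ⟨n, hn1, φh, ψh, hφh, hψh, z₀, F, hF, hFS⟩ := h
  have hn : n ≠ 0 := by omega
  obtain ⟨e, a, ha, u, rfl, hu, hau, hLor⟩ := exists_liftPerm_of_isLiftN hφ hn hφh
  obtain ⟨e', b, hb, v, rfl, hv, hbv, hMor⟩ := exists_liftPerm_of_isLiftN hψ hn hψh
  obtain ⟨e₁, c, hc, he₁, hNor, hNisot⟩ := exists_lift_of_ambientIsotopy hF hn
  obtain ⟨t₀, rfl⟩ := Circle.exp_surjective z₀
  have hce : Continuous e := hφh.1.1.continuous
  have hce' : Continuous e' := hψh.1.1.continuous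
  have hce₁ : Continuous e₁ := by
    rw [he₁]
    exact hF.2.2.1.continuous.comp (continuous_const.prodMk continuous_id)
  set L := liftPerm hn e a ha
  set M := liftPerm hn e' b hb
  set N := liftPerm hn e₁ c hc
  have hLe (m : ℤ) (y : E4) : L (Real.exp (n * (2 * Real.pi * m)) • y) =
      Real.exp (n * (2 * Real.pi * m)) • L y := polarLift_exp_smul hn m y
  have hMe (m : ℤ) (y : E4) : M (Real.exp (n * (2 * Real.pi * m)) • y) =
      Real.exp (n * (2 * Real.pi * m)) • M y := polarLift_exp_smul hn m y
  have hNe (m : ℤ) (y : E4) : N (Real.exp (n * (2 * Real.pi * m)) • y) =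
      Real.exp (n * (2 * Real.pi * m)) • N y := polarLift_exp_smul hn m y
  have hL0 : ContinuousAt L 0 := continuousAt_polarLift_zero n ha
  have hN0 : ContinuousAt N 0 := continuousAt_polarLift_zero n hc
  have hM0 : ContinuousAt M 0 := continuousAt_polarLift_zero n hb
  have hL0' : ContinuousAt L.symm 0 := continuousAt_liftPerm_symm_zero hn ha hce
  have hM0' : ContinuousAt M.symm 0 := continuousAt_liftPerm_symm_zero hn hb hce'
  have hN0' : ContinuousAt N.symm 0 := continuousAt_liftPerm_symm_zero hn hc hce₁
  have hLz : L 0 = 0 := hLor.1.1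
  have hMz : M 0 = 0 := hMor.1.1
  have hNz : N 0 = 0 := hNor.1.1
  have hLp {y : E4} (hy : y ≠ 0) : polar n (L y) = e (polar n y) :=
    polar_polarLift hn ha.apply_fst hy
  have hMp {y : E4} (hy : y ≠ 0) : polar n (M y) = e' (polar n y) :=
    polar_polarLift hn hb.apply_fst hy
  have hNp {y : E4} (hy : y ≠ 0) : polar n (N y) = e₁ (polar n y) :=
    polar_polarLift hn hc.apply_fst hy
  let f := M⁻¹ * N * L
  have hMf (y) : M (f y) = N (L y) := by simp [f]
  have hfor : f ∈ orientedDiffeo :=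
    orientedDiffeo.mul_mem (orientedDiffeo.mul_mem (orientedDiffeo.inv_mem hMor) hNor) hLor
  have hfe (m : ℤ) (y : E4) : f (Real.exp (n * (2 * Real.pi * m)) • y) =
      Real.exp (n * (2 * Real.pi * m)) • f y := by
    refine M.injective ?_
    rw [hMf, hMe, hMf, hLe, hNe]
  have hfS (y : E4) (hy : y ≠ 0) :
      (polar n (f y)).1 = Circle.exp t₀ ↔ (polar n y).1 = Circle.exp t₀ := by
    have hS (q : V) : q.1 = Circle.exp t₀ ↔ q ∈ ({Circle.exp t₀} : Set Circle) ×ˢ univ := by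
      simp
    have h1 : e' (polar n (f y)) = e₁ (e (polar n y)) := by
      rw [← hMp (perm_ne_zero hfor.1.1 hy), hMf, hNp (perm_ne_zero hLz hy), hLp hy]
    rw [hS, hS, ← e'.injective.mem_set_image, ← hFS, h1, ← he₁, e₁.injective.mem_set_image,
      e.injective.mem_set_image]
  obtain ⟨k, hk⟩ := exists_norm_eq_iff hn hfor.1 hfe hfS
  set τ : ℝ := n * (2 * Real.pi * k) with hτ
  let f' := dilation (-τ) * f
  have hf'or : f' ∈ orientedDiffeo := orientedDiffeo.mul_mem (dilation_mem _) hfor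
  have hf'n (y : E4) : ‖f' y‖ = Real.exp (n * t₀) ↔ ‖y‖ = Real.exp (n * t₀) := by
    rw [← hk y, show f' y = Real.exp (-τ) • f y from rfl, norm_smul,
      Real.norm_of_nonneg (Real.exp_pos _).le, Real.exp_neg, inv_mul_eq_iff_eq_mul₀
      (Real.exp_pos _).ne', mul_comm (Real.exp τ)]
  have hdc (t : ℝ) : Continuous (dilation t) := continuous_const_smul (Real.exp t)
  have hf'c : ContinuousAt f' 0 := by
    refine (hdc _).continuousAt.comp (f := f) ?_
    refine ContinuousAt.comp (g := M.symm) (f := fun y => N (L y)) ?_ ?_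
    · simpa only [hLz, hNz] using hM0'
    · refine ContinuousAt.comp (g := N) (f := L) ?_ hL0
      simpa only [hLz] using hN0
  have hf'c' : ContinuousAt f'.symm 0 := by
    change ContinuousAt (fun y => L.symm (N.symm (M ((dilation (-τ)).symm y)))) 0
    have hz : (dilation (-τ)).symm 0 = 0 := smul_zero (Real.exp (-(-τ)))
    refine ContinuousAt.comp (g := L.symm) (f := fun y => N.symm (M ((dilation (-τ)).symm y)))
      ?_ (ContinuousAt.comp (g := N.symm) (f := fun y => M ((dilation (-τ)).symm y)) ?_
        (ContinuousAt.comp (g := M) (f := (dilation (-τ)).symm) ?_ (hdc (-(-τ))).continuousAt))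
    · simpa only [hz, hMz, symm_zero hNz] using hL0'
    · simpa only [hz, hMz] using hN0'
    · simpa only [hz] using hM0
  let M' := dilation τ * M
  have hM'or : M' ∈ orientedDiffeo := orientedDiffeo.mul_mem (dilation_mem _) hMor
  have hM'f (y) : M' (f' y) = N (L y) := by
    have h1 : f' y = Real.exp (n * (2 * Real.pi * (-k : ℤ))) • f y := by
      rw [Equiv.Perm.mul_apply, dilation_apply]
      congr 2
      rw [hτ]; push_cast; ring
    rw [h1, Equiv.Perm.mul_apply, hMe, dilation_apply, smul_smul, ← Real.exp_add, hMf, hτ]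
    simp
  have hLu (y) : polarLift 1 φ u y = L y := by rw [← hau]; rfl
  have hMv (y) : polarLift 1 ψ (fun q => v q + τ) y = M' y := by
    rw [polarLift_add_const, ← hbv, Nat.cast_one, one_mul]
    rfl
  refine ⟨u, fun q => v q + τ, hu, hv.add_const (Circle.exp_eq_one.2 ⟨n * k, by
    rw [hτ]; push_cast; ring⟩), fun g hg h0 => ?_⟩
  rw [show polarLift 1 φ u = L from funext hLu,
    show polarLift 1 ψ (fun q => v q + τ) = M' from funext hMv]
  have h1 := (hg.isot_image_of_norm_eq h0 hf'or hf'c hf'c' hf'n).image hM'or.1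
  have h2 := hNisot (L '' (g '' sphere 0 1))
    (isCompact_image_of_psmooth hLor.1.2.1 hg.isCompact_image h0) (by
      rintro ⟨y, hy, hy0⟩
      refine perm_ne_zero hLz ?_ hy0
      rintro rfl
      exact h0 hy)
  refine h2.trans ?_
  convert h1.symm using 1
  simp only [image_image]
  exact image_congr fun y _ => (hM'f (g y)).symm

theorem connectedComponentIn_eq_of_countable {X Y : Type*} [TopologicalSpace X] [MetricSpace Y]
    {s F : Set X} (hs : IsPreconnected s) (hsF : s ⊆ F) {x : X} (hx : x ∈ s) {T : Set Y}
    (hT : T.Countable) {g : X → Y} (hg : ContinuousOn g F) (hm : MapsTo g F T)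
    (h : ∀ y ∈ F, g y = g x → y ∈ s) : connectedComponentIn F x = s := by
  refine Subset.antisymm (fun y hy => ?_) (hs.subset_connectedComponentIn hx hsF)
  have hsub := connectedComponentIn_subset F x
  exact h y (hsub hy) (eq_of_isPreconnected_of_countable isPreconnected_connectedComponentIn hT
    (hg.mono hsub) (hm.mono_left hsub) hy (mem_connectedComponentIn (hsF hx)))

theorem isS3Embedding_slice : IsS3Embedding IV fun x : S3 => ((1 : Circle), x) := by
  have hs : ContMDiff (𝓡 3) IV ∞ fun x : S3 => ((1 : Circle), x) :=
    contMDiff_const.prodMk contMDiff_id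
  have hinj : Function.Injective fun x : S3 => ((1 : Circle), x) :=
    fun x y h => congrArg Prod.snd h
  refine ⟨hs, hinj, (hs.continuous.isClosedEmbedding hinj).isEmbedding, fun x => ?_⟩
  have h1 := mfderiv_comp x (I'' := 𝓡 3) (g := (Prod.snd : V → S3))
    (mdifferentiableAt_snd (I := 𝓡 1) (I' := 𝓡 3)) (hs.mdifferentiableAt (by simp))
  have h2 : mfderiv (𝓡 3) (𝓡 3) ((Prod.snd : V → S3) ∘ fun x : S3 => ((1 : Circle), x)) x =
      ContinuousLinearMap.id ℝ _ := mfderiv_id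
  rw [h2] at h1
  intro v w hvw
  have h3 (v) := congrArg (fun L => L v) h1
  exact (h3 v).trans ((congrArg _ hvw).trans (h3 w).symm)

theorem isConnected_compl_one : IsConnected ({1}ᶜ : Set Circle) := by
  have h : ({1}ᶜ : Set Circle) = Circle.exp '' Ioo 0 (2 * Real.pi) := by
    ext z
    constructor
    · intro hz
      obtain ⟨t, rfl⟩ := Circle.exp_surjective z
      have h1 := toIcoMod_mem_Ico Real.two_pi_pos 0 t
      have h2 : Circle.exp (toIcoMod Real.two_pi_pos 0 t) = Circle.exp t := by
        rw [Circle.exp_eq_exp]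
        refine ⟨-toIcoDiv Real.two_pi_pos 0 t, ?_⟩
        have := toIcoMod_add_toIcoDiv_zsmul Real.two_pi_pos 0 t
        rw [zsmul_eq_mul] at this
        push_cast
        linarith
      rw [zero_add] at h1
      refine ⟨_, ⟨lt_of_le_of_ne h1.1 fun h0 => hz ?_, h1.2⟩, h2⟩
      rw [← h2, ← h0, Circle.exp_zero]
      rfl
    · rintro ⟨t, ht, rfl⟩ h1
      obtain ⟨m, hm⟩ := Circle.exp_eq_one.1 h1
      have hpi := Real.two_pi_pos
      rw [hm] at ht
      have h2 : (0 : ℝ) < m := by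
        by_contra! h
        nlinarith [ht.1]
      have h3 : (m : ℝ) < 1 := by
        by_contra! h
        nlinarith [ht.2]
      have h4 : (0 : ℤ) < m := by exact_mod_cast h2
      have h5 : m < (1 : ℤ) := by exact_mod_cast h3
      omega
  rw [h]
  exact (isConnected_Ioo Real.two_pi_pos).image _ Circle.exp.continuous.continuousOn

theorem range_slice : range (fun x : S3 => ((1 : Circle), x)) = ({1} : Set Circle) ×ˢ univ := by
  ext ⟨z, x⟩
  simp [eq_comm]

theorem isConnected_compl_slice : IsConnected (({1} : Set Circle) ×ˢ (univ : Set S3))ᶜ := by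
  have h : (({1} : Set Circle) ×ˢ (univ : Set S3))ᶜ = {1}ᶜ ×ˢ univ := by
    ext ⟨z, x⟩
    simp
  rw [h]
  exact isConnected_compl_one.prod ⟨⟨basePoint, mem_univ _⟩, isPreconnected_univ_S3⟩

theorem connectedComponentIn_preimage_slice {n : ℕ} (hn : n ≠ 0) {x₀ : V}
    (hx₀ : x₀ ∈ pcovN n ⁻¹' (({1} : Set Circle) ×ˢ univ)) :
    connectedComponentIn (pcovN n ⁻¹' (({1} : Set Circle) ×ˢ univ)) x₀ =
      ({x₀.1} : Set Circle) ×ˢ (univ : Set S3) := by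
  have hmem (q : V) : q ∈ pcovN n ⁻¹' (({1} : Set Circle) ×ˢ univ) ↔ q.1 ^ n = 1 := by
    simp [pcovN]
  refine connectedComponentIn_eq_of_countable (isPreconnected_singleton.prod isPreconnected_univ_S3)
    (fun q hq => ?_) (by simp) (countable_roots hn) (g := Prod.fst) continuousOn_fst
    (fun q hq => (hmem q).1 hq) fun q _ hq => ⟨hq, mem_univ _⟩
  rw [hmem, show q.1 = x₀.1 from hq.1]
  exact (hmem x₀).1 hx₀

/-- The condition on all nonseparating spheres, applied to a fibre, gives S-equivalence. -/
theorem sEquiv_of_slice {φ ψ : V → V} {n : ℕ} (hn : 1 ≤ n) {φh ψh : V → V}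
    (hφh : IsLiftN n φ φh) (hψh : IsLiftN n ψ ψh) {x₀ : V}
    (hx₀ : x₀ ∈ pcovN n ⁻¹' (({1} : Set Circle) ×ˢ univ))
    (h : AmbIsotopic IV
      (φh '' connectedComponentIn (pcovN n ⁻¹' (({1} : Set Circle) ×ˢ univ)) x₀)
      (ψh '' connectedComponentIn (pcovN n ⁻¹' (({1} : Set Circle) ×ˢ univ)) x₀)) :
    SEquiv φ ψ := by
  rw [connectedComponentIn_preimage_slice (by omega) hx₀] at h
  exact ⟨n, hn, φh, ψh, hφh, hψh, x₀.1, h⟩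

/-- The lift of a self-map of `V` to the `n`-fold cover determined by a winding function. -/
def coverLift (n : ℕ) (φ : V → V) (u : V → ℝ) (q : V) : V :=
  (q.1 * Circle.exp (u (pcovN n q) / n), (φ (pcovN n q)).2)

section coverLift
variable {n : ℕ} {φ : V → V} {u : V → ℝ}

theorem pcovN_coverLift (hn : n ≠ 0) (hu : IsWinding φ u) (q : V) :
    pcovN n (coverLift n φ u q) = φ (pcovN n q) := by
  have hn' : (n : ℝ) ≠ 0 := by exact_mod_cast hn
  refine Prod.ext ?_ rfl
  rw [hu.apply_fst]
  simp only [pcovN, coverLift]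
  rw [mul_pow, ← Circle.exp_nsmul, nsmul_eq_mul, mul_div_cancel₀ _ hn']

theorem coverLift_coverLift {φ' : V → V} (hn : n ≠ 0) (hu : IsWinding φ u) {u' : V → ℝ}
    (hl : Function.LeftInverse φ' φ) (hu' : ∀ q, u' (φ q) = -u q) (q : V) :
    coverLift n φ' u' (coverLift n φ u q) = q := by
  refine Prod.ext ?_ ?_
  · change (coverLift n φ u q).1 * Circle.exp (u' (pcovN n (coverLift n φ u q)) / n) = q.1
    rw [pcovN_coverLift hn hu, hu']
    simp only [coverLift]
    rw [mul_assoc, ← Circle.exp_add]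
    simp [neg_div]
  · change (φ' (pcovN n (coverLift n φ u q))).2 = q.2
    rw [pcovN_coverLift hn hu, hl]
    rfl

theorem IsWinding.contMDiff (hu : IsWinding φ u) (hφ : ContMDiff IV IV ∞ φ) :
    ContMDiff IV 𝓘(ℝ, ℝ) ∞ u := fun q => by
  refine contMDiffAt_of_circleExp hu.continuous.continuousAt ?_
  have h : ContMDiff IV (𝓡 1) ∞ fun q : V => q.1⁻¹ * (φ q).1 :=
    contMDiff_fst.inv.mul (contMDiff_fst.comp hφ)
  refine (h.congr fun q => ?_).contMDiffAt
  rw [hu.apply_fst, inv_mul_cancel_left]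

theorem contMDiff_pcovN (n : ℕ) : ContMDiff IV IV ∞ (pcovN n) :=
  (contMDiff_fst.pow n).prodMk contMDiff_snd

theorem contMDiff_coverLift (n : ℕ) (hu : IsWinding φ u) (hφ : ContMDiff IV IV ∞ φ) :
    ContMDiff IV IV ∞ (coverLift n φ u) := by
  have h1 : ContMDiff IV 𝓘(ℝ, ℝ) ∞ fun q => u (pcovN n q) / n :=
    (contDiff_id.div_const (n : ℝ)).contMDiff.comp ((hu.contMDiff hφ).comp (contMDiff_pcovN n))
  exact (contMDiff_fst.mul (contMDiff_circleExp.comp h1)).prodMk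
    (contMDiff_snd.comp (hφ.comp (contMDiff_pcovN n)))

theorem isLiftN_coverLift (hn : n ≠ 0) (hu : IsWinding φ u) (hφ : IsDiffeoB IV IV φ) :
    IsLiftN n φ (coverLift n φ u) := by
  obtain ⟨hs, φ', hs', hl, hr⟩ := hφ
  have hu' := hu.inverse hs'.continuous hr
  refine ⟨⟨contMDiff_coverLift n hu hs, coverLift n φ' _, contMDiff_coverLift n hu' hs',
    coverLift_coverLift hn hu hl fun q => ?_, coverLift_coverLift hn hu' hr fun q => ?_⟩,
    pcovN_coverLift hn hu⟩
  · simp only [hl q]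
  · simp

theorem polar_polarLift_one (hn : n ≠ 0) {y : E4} (hy : y ≠ 0) :
    polar n (polarLift 1 φ u y) = coverLift n φ u (polar n y) := by
  have hpos : 0 < ‖y‖ := norm_pos_iff.2 hy
  refine Prod.ext ?_ ?_
  · simp only [coverLift, pcovN_polar hn]
    simp only [polar, norm_polarLift]
    rw [Real.log_mul (Real.exp_pos _).ne' hpos.ne', Real.log_exp, ← Circle.exp_add, add_div,
      add_comm]
    simp
  · simp only [coverLift, pcovN_polar hn]
    change unitVec _ = _
    rw [polarLift_apply hy, unitVec_smul (by positivity), unitVec_coe]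

end coverLift

/-- The section of `polar n` over `V` with values in a fundamental domain. -/
def polarSection (n : ℕ) (q : V) : E4 := Real.exp (n * Complex.arg q.1) • (q.2 : E4)

theorem norm_polarSection (n : ℕ) (q : V) :
    ‖polarSection n q‖ = Real.exp (n * Complex.arg q.1) := by
  rw [polarSection, norm_smul, norm_coe_S3, mul_one, Real.norm_of_nonneg (Real.exp_pos _).le]

theorem polarSection_ne_zero (n : ℕ) (q : V) : polarSection n q ≠ 0 := by
  rw [← norm_ne_zero_iff, norm_polarSection]
  exact (Real.exp_pos _).ne'

theorem polar_polarSection {n : ℕ} (hn : n ≠ 0) (q : V) : polar n (polarSection n q) = q := by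
  have hn' : (n : ℝ) ≠ 0 := by exact_mod_cast hn
  refine Prod.ext ?_ ?_
  · simp only [polar]
    rw [norm_polarSection, Real.log_exp, mul_div_cancel_left₀ _ hn', Circle.exp_arg]
  · change unitVec (Real.exp (n * Complex.arg q.1) • (q.2 : E4)) = q.2
    rw [unitVec_smul (Real.exp_pos _), unitVec_coe]

theorem polarSection_polar {n : ℕ} (hn : n ≠ 0) {y : E4} (hy : y ≠ 0) (h : |Real.log ‖y‖| ≤ n) :
    polarSection n (polar n y) = y := by
  have hn' : (0 : ℝ) < n := by exact_mod_cast Nat.pos_of_ne_zero hn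
  have h1 : |Real.log ‖y‖ / n| ≤ 1 := by
    rw [abs_div, Nat.abs_cast]
    exact div_le_one_of_le₀ h hn'.le
  have hpi := Real.pi_gt_three
  have h2 := abs_le.1 h1
  simp only [polarSection, polar]
  rw [Circle.arg_exp (by linarith) (by linarith), mul_div_cancel₀ _ hn'.ne',
    Real.exp_log (norm_pos_iff.2 hy), norm_smul_unitVec hy]

theorem contMDiffAt_polarSection (n : ℕ) {q : V} (hq : (q.1 : ℂ) ∈ Complex.slitPlane) :
    ContMDiffAt IV 𝓘(ℝ, E4) ∞ (polarSection n) q := by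
  have := finrank_real_complex_fact'
  have h1 : ContDiffAt ℝ ∞ (fun z : ℂ => Real.exp (n * (Complex.log z).im)) (q.1 : ℂ) :=
    (contDiffAt_const.mul (Complex.imCLM.contDiff.contDiffAt.comp (q.1 : ℂ)
      ((Complex.contDiffAt_log (n := ∞) hq).restrict_scalars ℝ))).exp
  have h2 : ContMDiffAt IV 𝓘(ℝ, ℂ) ∞ (fun q : V => (q.1 : ℂ)) q :=
    (contMDiff_coe_sphere (E := ℂ) (n := 1) (m := ∞)).contMDiffAt.comp q contMDiffAt_fst
  have h3 : ContMDiffAt IV 𝓘(ℝ, E4) ∞ (fun q : V => (q.2 : E4)) q :=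
    contMDiff_coe_sphere.contMDiffAt.comp q contMDiffAt_snd
  have h4 : ContMDiffAt IV 𝓘(ℝ, ℝ) ∞
      (fun q : V => Real.exp (n * (Complex.log (q.1 : ℂ)).im)) q :=
    ContMDiffAt.comp q (g := fun z : ℂ => Real.exp (n * (Complex.log z).im)) h1.contMDiffAt h2
  simp only [Complex.log_im] at h4
  exact h4.smul h3

/-- A compactly supported family of maps descends to a smooth family on a sufficiently large
cover. -/
theorem contMDiff_polar_family {n : ℕ} (hn : n ≠ 0) {F : ℝ → E4 → E4}
    (hF : ContDiff ℝ ∞ fun p : ℝ × E4 => F p.1 p.2) (h0 : ∀ t, ∀ y ≠ 0, F t y ≠ 0) {C : Set E4}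
    (hC : ∀ y ∈ C, |Real.log ‖y‖| ≤ n) (hFC : ∀ t, ∀ y ∉ C, F t y = y) :
    ContMDiff (𝓘(ℝ, ℝ).prod IV) IV ∞ fun p : ℝ × V => polar n (F p.1 (polarSection n p.2)) := by
  rintro ⟨s, q⟩
  by_cases hq : (q.1 : ℂ) ∈ Complex.slitPlane
  · have h1 : ContMDiffAt (𝓘(ℝ, ℝ).prod IV) 𝓘(ℝ, E4) ∞
        (fun p : ℝ × V => polarSection n p.2) (s, q) :=
      ContMDiffAt.comp (s, q) (g := polarSection n) (contMDiffAt_polarSection n hq) contMDiffAt_snd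
    have h2 : ContMDiffAt (𝓘(ℝ, ℝ).prod IV) 𝓘(ℝ, ℝ × E4) ∞
        (fun p : ℝ × V => (p.1, polarSection n p.2)) (s, q) :=
      contMDiffAt_fst.prodMk_space h1
    have h3 : ContMDiffAt (𝓘(ℝ, ℝ).prod IV) 𝓘(ℝ, E4) ∞
        (fun p : ℝ × V => F p.1 (polarSection n p.2)) (s, q) :=
      ContMDiffAt.comp (s, q) (g := fun p : ℝ × E4 => F p.1 p.2)
        hF.contDiffAt.contMDiffAt h2
    exact ContMDiffAt.comp (s, q) (g := polar n)
      (contMDiffAt_polar n (h0 _ _ (polarSection_ne_zero n q))) h3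
  · have hre : (q.1 : ℂ).re < 0 := by
      rw [Complex.mem_slitPlane_iff, not_or, not_lt, not_not] at hq
      refine lt_of_le_of_ne hq.1 fun h => ?_
      exact q.1.coe_ne_zero (Complex.ext h hq.2)
    have hcont : Continuous fun p : ℝ × V => (p.2.1 : ℂ).re :=
      Complex.continuous_re.comp (continuous_subtype_val.comp
        (continuous_fst.comp continuous_snd))
    refine ContMDiffAt.congr_of_eventuallyEq (contMDiffAt_snd (I := 𝓘(ℝ, ℝ)) (J := IV)) ?_
    filter_upwards [(isOpen_Iio.preimage hcont).mem_nhds hre] with p hp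
    have hn' : (0 : ℝ) < n := by exact_mod_cast Nat.pos_of_ne_zero hn
    have h1 : polarSection n p.2 ∉ C := by
      intro h
      have h2 := hC _ h
      rw [norm_polarSection, Real.log_exp, abs_mul, Nat.abs_cast,
        mul_le_iff_le_one_right hn'] at h2
      have h3 : (p.2.1 : ℂ).re < 0 := hp
      have h4 : ¬ |Complex.arg p.2.1| ≤ Real.pi / 2 := by
        rw [Complex.abs_arg_le_pi_div_two_iff]
        exact not_le.2 h3
      have := Real.pi_gt_three
      linarith
    rw [hFC _ _ h1, polar_polarSection hn]

theorem exists_nat_abs_log_norm_le {K : Set E4} (hK : IsCompact K) (h0 : (0 : E4) ∉ K) :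
    ∃ n : ℕ, n ≠ 0 ∧ ∀ y ∈ K, |Real.log ‖y‖| ≤ n := by
  obtain ⟨B, hB⟩ := hK.exists_bound_of_continuousOn (f := fun y : E4 => Real.log ‖y‖)
    (continuous_norm.continuousOn.log fun y hy => norm_ne_zero_iff.2 (ne_of_mem_of_not_mem hy h0))
  refine ⟨⌈B⌉₊ + 1, by omega, fun y hy => (hB y hy).trans ((Nat.le_ceil B).trans ?_)⟩
  push_cast
  linarith

theorem polarSection_polar_perm {n : ℕ} (hn : n ≠ 0) {C : Set E4} (hC0 : (0 : E4) ∉ C)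
    (hC : ∀ y ∈ C, |Real.log ‖y‖| ≤ n) {e : Equiv.Perm E4} (he : ∀ y ∉ C, e y = y) (q : V) :
    polarSection n (polar n (e (polarSection n q))) = e (polarSection n q) := by
  by_cases hq : e (polarSection n q) ∈ C
  · exact polarSection_polar hn (ne_of_mem_of_not_mem hq hC0) (hC _ hq)
  · have h := e.injective (he _ hq)
    rw [h, polar_polarSection hn]

/-- Isotopic subsets of the punctured space are isotopic in a sufficiently large cover of `V`. -/
theorem Isot.exists_ambIsotopic {A B : Set E4} (h : Isot A B) (hA : IsCompact A)
    (h0 : (0 : E4) ∉ A) : ∃ n : ℕ, n ≠ 0 ∧ AmbIsotopic IV (polar n '' A) (polar n '' B) := by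
  obtain ⟨F, ⟨hF0, hFs, hFs', C, hC, hC0, hFC⟩, rfl⟩ := h
  obtain ⟨n, hn, hK⟩ := exists_nat_abs_log_norm_le (hC.union hA) (by simp [hC0, h0])
  have hCn : ∀ y ∈ C, |Real.log ‖y‖| ≤ n := fun y hy => hK y (Or.inl hy)
  have hFC' (t) (y) (hy : y ∉ C) : (F t).symm y = y := by
    rw [Equiv.symm_apply_eq, hFC t y hy]
  have hzero (t) : F t 0 = 0 := hFC t 0 hC0
  have hne (t) (y : E4) (hy : y ≠ 0) : F t y ≠ 0 := perm_ne_zero (hzero t) hy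
  have hne' (t) (y : E4) (hy : y ≠ 0) : (F t).symm y ≠ 0 := perm_ne_zero (symm_zero (hzero t)) hy
  let H : ℝ → V → V := fun t q => polar n (F t (polarSection n q))
  let H' : ℝ → V → V := fun t q => polar n ((F t).symm (polarSection n q))
  have hl (t) : Function.LeftInverse (H' t) (H t) := fun q => by
    simp only [H, H']
    rw [polarSection_polar_perm hn hC0 hCn (hFC t), (F t).symm_apply_apply,
      polar_polarSection hn]
  have hr (t) : Function.RightInverse (H' t) (H t) := fun q => by
    simp only [H, H']
    rw [polarSection_polar_perm hn hC0 hCn (hFC' t), (F t).apply_symm_apply,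
      polar_polarSection hn]
  have hH : ContMDiff (𝓘(ℝ, ℝ).prod IV) IV ∞ fun p : ℝ × V => H p.1 p.2 :=
    contMDiff_polar_family (F := fun t => F t) hn hFs hne hCn hFC
  have hH' : ContMDiff (𝓘(ℝ, ℝ).prod IV) IV ∞ fun p : ℝ × V => H' p.1 p.2 :=
    contMDiff_polar_family (F := fun t => (F t).symm) hn hFs' hne' hCn hFC'
  have hH0 : H 0 = id := by
    ext1 q
    simp only [H, hF0]
    exact polar_polarSection hn q
  refine ⟨n, hn, H, ⟨hH0, fun t => ⟨(hl t).injective, (hr t).surjective⟩, hH, H',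
    fun t => ⟨hl t, hr t⟩, hH'⟩, ?_⟩
  simp only [image_image]
  refine image_congr fun y hy => ?_
  simp only [H]
  rw [polarSection_polar hn (ne_of_mem_of_not_mem hy h0) (hK y (Or.inr hy))]

theorem lineMap_ne_zero_of_ne_neg {x N : S3} (h : x ≠ -N) {t : ℝ} (ht : t ∈ Icc (0 : ℝ) 1) :
    (1 - t) • (N : E4) + t • (x : E4) ≠ 0 := by
  intro h0
  have h1 : (1 - t) • (N : E4) = -(t • (x : E4)) := eq_neg_of_add_eq_zero_left h0
  have h2 := congrArg norm h1
  rw [norm_neg, norm_smul, norm_smul, norm_coe_S3, norm_coe_S3, mul_one, mul_one,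
    Real.norm_of_nonneg (by linarith [ht.2]), Real.norm_of_nonneg ht.1] at h2
  have h3 : t = 2⁻¹ := by linarith
  rw [h3, show (1 - 2⁻¹ : ℝ) = 2⁻¹ by norm_num, ← smul_neg] at h1
  have h4 := smul_right_injective E4 (by norm_num : (2⁻¹ : ℝ) ≠ 0) h1
  refine h (Subtype.ext ?_)
  rw [coe_neg_sphere, h4, neg_neg]

/-- Circle-valued maps have angle functions on the complement of a point of the sphere. -/
theorem exists_angle_compl {c : S3 → Circle} (hc : Continuous c) (N : S3) :
    ∃ a : S3 → ℝ, ContinuousOn a {-N}ᶜ ∧ ∀ x ∈ ({-N}ᶜ : Set S3), Circle.exp (a x) = c x := by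
  let D := ({-N}ᶜ : Set S3)
  let γ : unitInterval × D → E4 := fun p =>
    (1 - (p.1 : ℝ)) • (N : E4) + (p.1 : ℝ) • ((p.2 : S3) : E4)
  have hγ : Continuous γ := by fun_prop
  have hγ0 (p) : γ p ≠ 0 := lineMap_ne_zero_of_ne_neg p.2.2 p.1.2
  let H : C(unitInterval × D, Circle) := ⟨fun p => c (unitVec (γ p)),
    hc.comp (continuous_iff_continuousAt.2 fun p =>
      ContinuousAt.comp (g := unitVec) (f := γ) (continuousAt_unitVec (hγ0 p)) hγ.continuousAt)⟩
  obtain ⟨t₀, ht₀⟩ := Circle.exp_surjective (c N)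
  have hH0 : ∀ q, H (0, q) = Circle.exp ((ContinuousMap.const D t₀) q) := fun q => by
    simp [H, γ, unitVec_coe, ht₀]
  let W := Circle.isCoveringMap_exp.liftHomotopy H (ContinuousMap.const D t₀) hH0
  have hW (p) : Circle.exp (W p) = H p :=
    congrFun (Circle.isCoveringMap_exp.liftHomotopy_lifts H _ hH0) p
  have hW1 : Continuous fun x : D => W (1, x) :=
    W.continuous.comp (continuous_const.prodMk continuous_id)
  classical
  let a : S3 → ℝ := fun x => if h : x ∈ D then W (1, ⟨x, h⟩) else 0
  have ha (x : D) : a x = W (1, x) := dif_pos x.2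
  refine ⟨a, ?_, fun x hx => ?_⟩
  · rw [continuousOn_iff_continuous_domRestrict]
    exact hW1.congr fun x => (ha x).symm
  · rw [ha ⟨x, hx⟩, hW]
    simp [H, γ, unitVec_coe]

theorem isPreconnected_compl_pair (N : S3) : IsPreconnected ({N}ᶜ ∩ {-N}ᶜ : Set S3) := by
  have hr : 1 < Module.rank ℝ (E4 ⧸ Submodule.span ℝ {(N : E4)}) := by
    have h1 : _ = finrank ℝ E4 :=
      Submodule.finrank_quotient_add_finrank (Submodule.span ℝ {(N : E4)})
    rw [finrank_span_singleton (coe_S3_ne_zero N), finrank_euclideanSpace, Fintype.card_fin] at h1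
    rw [← finrank_eq_rank]
    exact_mod_cast (show 1 < finrank ℝ (E4 ⧸ Submodule.span ℝ {(N : E4)}) by linarith)
  have h2 := (isConnected_compl_of_one_lt_codim hr).isPreconnected
  have hne {y : E4} (hy : y ∈ ((Submodule.span ℝ {(N : E4)} : Submodule ℝ E4) : Set E4)ᶜ) :
      y ≠ 0 := by
    rintro rfl
    exact hy (Submodule.zero_mem _)
  have h3 : ({N}ᶜ ∩ {-N}ᶜ : Set S3) =
      unitVec '' ((Submodule.span ℝ {(N : E4)} : Submodule ℝ E4) : Set E4)ᶜ := by
    ext x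
    constructor
    · rintro ⟨h1, h2⟩
      refine ⟨x, fun h => ?_, unitVec_coe x⟩
      obtain ⟨r, hr⟩ := Submodule.mem_span_singleton.1 h
      have h4 := congrArg norm hr
      rw [norm_smul, norm_coe_S3, norm_coe_S3, mul_one, Real.norm_eq_abs] at h4
      rcases eq_or_eq_neg_of_abs_eq h4 with rfl | rfl
      · exact h1 (Subtype.ext (by rw [← hr, one_smul]))
      · exact h2 (Subtype.ext (by rw [← hr, neg_one_smul, coe_neg_sphere]))
    · rintro ⟨y, hy, rfl⟩
      have hN := Submodule.mem_span_singleton_self (R := ℝ) (N : E4)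
      constructor
      · intro h
        refine hy ?_
        rw [← norm_smul_unitVec (hne hy), show unitVec y = N from h]
        exact Submodule.smul_mem _ _ hN
      · intro h
        refine hy ?_
        rw [← norm_smul_unitVec (hne hy), show unitVec y = -N from h, coe_neg_sphere]
        exact Submodule.smul_mem _ _ (Submodule.neg_mem _ hN)
  rw [h3]
  exact h2.image _ fun y hy => (continuousAt_unitVec (hne hy)).continuousWithinAt

/-- Circle-valued maps on the 3-sphere have angle functions. -/
theorem exists_angle {c : S3 → Circle} (hc : Continuous c) :
    ∃ a : S3 → ℝ, Continuous a ∧ ∀ x, Circle.exp (a x) = c x := by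
  let N := basePoint
  obtain ⟨a, ha, hac⟩ := exists_angle_compl hc N
  obtain ⟨b, hb, hbc⟩ := exists_angle_compl hc (-N)
  rw [neg_neg] at hb hbc
  have hdiff : ∀ x ∈ ({N}ᶜ ∩ {-N}ᶜ : Set S3), ∃ m : ℤ, m * (2 * Real.pi) = b x - a x := by
    rintro x ⟨h1, h2⟩
    obtain ⟨m, hm⟩ := Circle.exp_eq_exp.1 ((hbc x h1).trans (hac x h2).symm)
    exact ⟨m, by rw [hm]; ring⟩
  have hne : ({N}ᶜ ∩ {-N}ᶜ : Set S3).Nonempty := by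
    refine ⟨⟨EuclideanSpace.single 1 1, by simp⟩, fun h => ?_, fun h => ?_⟩ <;>
    · have h1 := congrArg (fun z : S3 => (z : E4) 1) h
      simp [N, basePoint] at h1
  obtain ⟨x₀, hx₀⟩ := hne
  obtain ⟨m, hm⟩ := hdiff x₀ hx₀
  have hconst : ∀ x ∈ ({N}ᶜ ∩ {-N}ᶜ : Set S3), b x - a x = m * (2 * Real.pi) := fun x hx => by
    rw [hm]
    exact eq_of_isPreconnected_of_countable (isPreconnected_compl_pair N)
      (countable_range fun m : ℤ => (m : ℝ) * (2 * Real.pi))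
      ((hb.mono inter_subset_left).sub (ha.mono inter_subset_right)) hdiff hx hx₀
  have hNN : N ≠ -N := by
    intro h
    have h1 := congrArg (fun z : S3 => (z : E4) 0) h
    simp [N, basePoint] at h1
    linarith
  classical
  let a' : S3 → ℝ := fun x => if x = -N then b x - m * (2 * Real.pi) else a x
  have h1 {x : S3} (hx : x ≠ -N) : a' x = a x := if_neg hx
  have h2 {x : S3} (hx : x ≠ N) : a' x = b x - m * (2 * Real.pi) := by
    rcases eq_or_ne x (-N) with rfl | hx'
    · exact if_pos rfl
    · rw [h1 hx', ← hconst x ⟨hx, hx'⟩]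
      ring
  refine ⟨a', continuous_iff_continuousAt.2 fun x => ?_, fun x => ?_⟩
  · rcases eq_or_ne x (-N) with rfl | hx
    · refine ContinuousAt.congr (f := fun x => b x - m * (2 * Real.pi)) ?_ ?_
      · exact ((hb.continuousAt (isOpen_compl_singleton.mem_nhds hNN.symm)).sub
          continuousAt_const)
      · filter_upwards [isOpen_compl_singleton.mem_nhds hNN.symm] with y hy
        exact (h2 hy).symm
    · refine (ha.continuousAt (isOpen_compl_singleton.mem_nhds hx)).congr ?_
      filter_upwards [isOpen_compl_singleton.mem_nhds hx] with y hy
      exact (h1 hy).symm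
  · rcases eq_or_ne x (-N) with rfl | hx
    · rw [h2 hNN.symm, Circle.exp_sub, Circle.exp_int_mul_two_pi, div_one,
        hbc _ hNN.symm]
    · rw [h1 hx, hac x hx]

/-- Embedded 3-spheres in `V` lift to the punctured space. -/
theorem exists_isSphereMap_of_isS3Embedding {f : S3 → V} (hf : IsS3Embedding IV f) :
    ∃ g : E4 → E4, IsSphereMap g ∧ (∀ x, g x ≠ 0) ∧ ∀ x : S3, polar 1 (g x) = f x := by
  obtain ⟨hs, hinj, -, himm⟩ := hf
  obtain ⟨a, ha, hac⟩ := exists_angle (c := fun x => (f x).1) (continuous_fst.comp hs.continuous)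
  have has : ContMDiff (𝓡 3) 𝓘(ℝ, ℝ) ∞ a := fun x => by
    refine contMDiffAt_of_circleExp ha.continuousAt ?_
    simp only [hac]
    exact (contMDiff_fst.comp hs).contMDiffAt
  let g₀ : S3 → E4 := fun x => Real.exp (a x) • ((f x).2 : E4)
  have hg₀ : ContMDiff (𝓡 3) 𝓘(ℝ, E4) ∞ g₀ :=
    ContMDiff.smul (Real.contDiff_exp.contMDiff.comp has)
      (contMDiff_coe_sphere.comp (contMDiff_snd.comp hs))
  let g : E4 → E4 := fun y => g₀ (unitVec y)
  have hg0 (y) : g y ≠ 0 := smul_ne_zero (Real.exp_pos _).ne' (coe_S3_ne_zero _)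
  have hgp (x : S3) : polar 1 (g x) = f x := by
    simp only [g, unitVec_coe, g₀]
    refine Prod.ext ?_ ?_
    · simp only [polar]
      rw [norm_smul, norm_coe_S3, mul_one, Real.norm_of_nonneg (Real.exp_pos _).le, Real.log_exp,
        Nat.cast_one, div_one, hac]
    · change unitVec (Real.exp (a x) • ((f x).2 : E4)) = (f x).2
      rw [unitVec_smul (Real.exp_pos _), unitVec_coe]
  have hgs : PSmooth g := fun y hy =>
    (ContMDiffAt.comp y (g := g₀) hg₀.contMDiffAt (contMDiffAt_unitVec hy)).contDiffAt
  refine ⟨g, ⟨hgs, fun c hc y => ?_, fun x hx y hy h => ?_, fun x hx v hv h => ?_⟩, hg0, hgp⟩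
  · simp only [g, unitVec_smul hc]
  · have h1 := hgp ⟨x, hx⟩
    have h2 := hgp ⟨y, hy⟩
    simp only at h1 h2
    rw [h, h2] at h1
    exact congrArg Subtype.val (hinj h1).symm
  · let p : S3 := ⟨x, hx⟩
    let i : S3 → E4 := Subtype.val
    have hi : MDifferentiableAt (𝓡 3) 𝓘(ℝ, E4) i p :=
      (contMDiff_coe_sphere (m := 1) p).mdifferentiableAt one_ne_zero
    have hgd : HasMFDerivAt 𝓘(ℝ, E4) 𝓘(ℝ, E4) g (i p) (fderiv ℝ g x) :=
      ((hgs x (ne_zero_of_mem_unit hx)).differentiableAt (by simp)).hasFDerivAt.hasMFDerivAt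
    have hpd : MDifferentiableAt 𝓘(ℝ, E4) IV (polar 1) (g (i p)) :=
      (contMDiffAt_polar 1 (hg0 x)).mdifferentiableAt (by simp)
    have hfd := (HasMFDerivAt.comp p hpd.hasMFDerivAt (hgd.comp p hi.hasMFDerivAt)).mfderiv
    rw [show (polar 1 ∘ (g ∘ i)) = f from funext hgp] at hfd
    have hrange := range_mvfderiv_subtypeVal (n := 3) p
    have hvr : v ∈ (mvfderiv (𝓡 3) ((↑) : S3 → E4) p).range := by
      rw [hrange]
      exact Submodule.mem_orthogonal_singleton_iff_inner_right.2 hv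
    obtain ⟨w, rfl⟩ := hvr
    have hw : mfderiv (𝓡 3) IV f p w = 0 := by
      rw [hfd]
      exact (congrArg (mfderiv 𝓘(ℝ, E4) IV (polar 1) (g (i p))) h).trans (map_zero _)
    rw [himm p (hw.trans (map_zero _).symm)]
    exact map_zero _

/-- The components of the preimage of an embedded sphere in a finite cover are images of spheres
in the punctured space. -/
theorem connectedComponentIn_preimage_range {f : S3 → V} (hf : IsS3Embedding IV f) {g : E4 → E4}
    (hg : IsSphereMap g) (hg0 : ∀ x, g x ≠ 0) (hgf : ∀ x : S3, polar 1 (g x) = f x) {n : ℕ}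
    (hn : n ≠ 0) : connectedComponentIn (pcovN n ⁻¹' range f) (polar n (g basePoint)) =
      polar n '' (g '' sphere 0 1) := by
  let γ : S3 → V := fun x => polar n (g x)
  have hγ : Continuous γ := continuous_iff_continuousAt.2 fun x =>
    ContinuousAt.comp (g := polar n) (f := fun x : S3 => g x) (continuousAt_polar n (hg0 x))
      ((hg.continuousAt (coe_S3_ne_zero x)).comp continuousAt_subtype_val)
  have hpγ (x) : pcovN n (γ x) = f x := (pcovN_polar hn _).trans (hgf x)
  have hrange : polar n '' (g '' sphere 0 1) = range γ := by
    rw [image_image]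
    exact image_eq_range _ _
  have : Nonempty S3 := ⟨basePoint⟩
  let r : V → S3 := Function.invFun f
  have hr (x) : r (f x) = x := Function.leftInverse_invFun hf.2.1 x
  have hrc : ContinuousOn r (range f) := by
    rw [continuousOn_iff_continuous_domRestrict]
    refine hf.2.2.1.toHomeomorph.symm.continuous.congr fun q => ?_
    obtain ⟨x, hx⟩ := hf.2.2.1.toHomeomorph.surjective q
    rw [← hx, Homeomorph.symm_apply_apply]
    exact (hr x).symm
  have hζ : ContinuousOn (fun q : V => q.1 * (γ (r (pcovN n q))).1⁻¹) (pcovN n ⁻¹' range f) :=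
    continuousOn_fst.mul ((continuous_fst.comp hγ).comp_continuousOn
      (hrc.comp (continuous_pcovN n).continuousOn fun q hq => hq)).inv
  rw [hrange]
  refine connectedComponentIn_eq_of_countable ?_ ?_ ⟨basePoint, rfl⟩ (countable_roots hn) hζ ?_ ?_
  · rw [← image_univ]
    exact isPreconnected_univ_S3.image _ hγ.continuousOn
  · rintro q ⟨x, rfl⟩
    exact ⟨x, (hpγ x).symm⟩
  · rintro q ⟨x, hx⟩
    have h1 : (γ x).1 ^ n = q.1 ^ n := congrArg Prod.fst ((hpγ x).trans hx)
    rw [mem_ofPred_eq]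
    simp only
    rw [← hx, hr, mul_pow, inv_pow, h1, mul_inv_cancel]
  · rintro q ⟨x, hx⟩ h
    have h2 : pcovN n (polar n (g basePoint)) = f basePoint := hpγ basePoint
    rw [← hx, h2, hr, hr] at h
    have h3 : q.1 = (γ x).1 := by
      rw [← mul_inv_eq_one, h]
      exact mul_inv_cancel _
    have h4 : (pcovN n (γ x)).2 = (pcovN n q).2 := by rw [hpγ, hx]
    exact ⟨x, Prod.ext h3.symm h4⟩

/-- S-equivalent maps carry every embedded sphere to isotopic spheres in some finite cover. -/
theorem exists_isotopic_lifts_of_sEquiv {φ ψ : V → V} (hφ : InDiff0 φ) (hψ : InDiff0 ψ)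
    (h : SEquiv φ ψ) {P : Set V} (hP : IsEmbeddedS3inV P) :
    ∃ n : ℕ, 1 ≤ n ∧ ∃ φh ψh : V → V, IsLiftN n φ φh ∧ IsLiftN n ψ ψh ∧
      ∃ x₀ ∈ pcovN n ⁻¹' P,
        AmbIsotopic IV (φh '' connectedComponentIn (pcovN n ⁻¹' P) x₀)
          (ψh '' connectedComponentIn (pcovN n ⁻¹' P) x₀) := by
  obtain ⟨f, hf, rfl⟩ := hP
  obtain ⟨u, v, hu, hv, huv⟩ := exists_isot_of_sEquiv hφ hψ h
  obtain ⟨g, hg, hg0, hgf⟩ := exists_isSphereMap_of_isS3Embedding hf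
  have hA0 : (0 : E4) ∉ g '' sphere 0 1 := fun ⟨x, _, hx⟩ => hg0 x hx
  have hcompact : IsCompact (polarLift 1 φ u '' (g '' sphere 0 1)) :=
    isCompact_image_of_psmooth (psmooth_polarLift 1 hφ.1.1 hu) hg.isCompact_image hA0
  have hzero : (0 : E4) ∉ polarLift 1 φ u '' (g '' sphere 0 1) := by
    rintro ⟨y, hy, h0⟩
    exact polarLift_ne_zero (ne_of_mem_of_not_mem hy hA0) h0
  obtain ⟨n, hn, hamb⟩ := (huv g hg hA0).exists_ambIsotopic hcompact hzero
  have himage (χ : V → V) (w : V → ℝ) :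
      polar n '' (polarLift 1 χ w '' (g '' sphere 0 1)) =
        coverLift n χ w '' (polar n '' (g '' sphere 0 1)) := by
    rw [image_image, image_image (coverLift n χ w)]
    exact image_congr fun y hy => polar_polarLift_one hn (ne_of_mem_of_not_mem hy hA0)
  rw [himage, himage] at hamb
  refine ⟨n, by omega, coverLift n φ u, coverLift n ψ v, isLiftN_coverLift hn hu hφ.1,
    isLiftN_coverLift hn hv hψ.1, polar n (g basePoint),
    ⟨basePoint, ((pcovN_polar hn _).trans (hgf _)).symm⟩, ?_⟩
  rwa [connectedComponentIn_preimage_range hf hg hg0 hgf hn]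

end SphereIso

/-- Proposition 1.9 i) ↔ iii): `φ` and `ψ` are S-equivalent iff for every nonseparating
embedded 3-sphere `P ⊆ V` some finite-cover lifts carry some component of the preimage of
`P` to isotopic spheres. -/
theorem sequiv_iff_all_nonseparating_spheres (φ ψ : V → V)
    (hφ : InDiff0 φ) (hψ : InDiff0 ψ) :
    SEquiv φ ψ ↔
      ∀ P : Set V, IsEmbeddedS3inV P → IsConnected Pᶜ →
        ∃ n : ℕ, 1 ≤ n ∧ ∃ φh ψh : V → V, IsLiftN n φ φh ∧ IsLiftN n ψ ψh ∧
          ∃ x₀ ∈ pcovN n ⁻¹' P,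
            AmbIsotopic IV (φh '' connectedComponentIn (pcovN n ⁻¹' P) x₀)
              (ψh '' connectedComponentIn (pcovN n ⁻¹' P) x₀) := by
  refine ⟨fun h P hP _ => SphereIso.exists_isotopic_lifts_of_sEquiv hφ hψ h hP, fun h => ?_⟩
  obtain ⟨n, hn, φh, ψh, hφh, hψh, x₀, hx₀, hamb⟩ := h _
    ⟨_, SphereIso.isS3Embedding_slice, SphereIso.range_slice⟩ SphereIso.isConnected_compl_slice
  exact SphereIso.sEquiv_of_slice hn hφh hψh hx₀ hamb

end
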